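/- arXiv:2205.13893 — 3 statements merged into one kernel-verified Lean document; each statement's English description precedes it below -/
import Mathlib

section
/- Let n ≥ 1, let p⃗=(p_1,…,p_n), q⃗=(q_1,…,q_n) satisfy 1<p_i<∞, 1<q_i<∞ for all i, and let 0<s<n/p_i for every i=1,…,n. Then there exists a constant C>0 such that for all Schwartz functions f on ℝⁿ, ‖ f(x) / ∏_{i=1}^{n} |x_i|^{s/n} ‖_{L^{p⃗,q⃗}(ℝⁿ)} ≤ C ‖ Λ^s f ‖_{L^{p⃗,q⃗}(ℝⁿ)}. -/
open MeasureTheory ENNReal Real Set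

noncomputable section

/-- The decreasing rearrangement of an `ℝ≥0∞`-valued function. -/
def rearr {α : Type*} [MeasurableSpace α] (μ : Measure α) (f : α → ℝ≥0∞) (t : ℝ) : ℝ≥0∞ :=
  sInf {s : ℝ≥0∞ | μ {x | s < f x} ≤ ENNReal.ofReal t}

/-- The Lorentz `L^{p,q}` quasi-norm, `‖f‖_{p,q} = ‖ t^{1/p} f*(t) ‖_{L^q((0,∞),dt/t)}`,
with `q = ∞` giving the weak-`L^p` quasi-norm. -/
def lorentzNorm {α : Type*} [MeasurableSpace α] (μ : Measure α) (p q : ℝ≥0∞)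
    (f : α → ℝ≥0∞) : ℝ≥0∞ :=
  if q = ∞ then ⨆ t ∈ Set.Ioi (0 : ℝ), ENNReal.ofReal t ^ p⁻¹.toReal * rearr μ f t
  else (∫⁻ t in Set.Ioi (0 : ℝ),
      (ENNReal.ofReal t ^ p⁻¹.toReal * rearr μ f t) ^ q.toReal / ENNReal.ofReal t) ^ q⁻¹.toReal

/-- Mixed (anisotropic) Lorentz quasi-norm on `ℝⁿ`: the Lorentz quasi-norm is taken
iteratively in each coordinate, with the coordinate `x 0` innermost. -/
def mixedLorentz : (n : ℕ) → (Fin n → ℝ≥0∞) → (Fin n → ℝ≥0∞) →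
    ((Fin n → ℝ) → ℝ≥0∞) → ℝ≥0∞
  | 0, _, _, f => f (fun i => i.elim0)
  | n + 1, p, q, f => mixedLorentz n (fun i => p i.succ) (fun i => q i.succ)
      (fun y => lorentzNorm (volume : Measure ℝ) (p 0) (q 0) (fun x => f (Fin.cons x y)))

/-- Mixed (anisotropic) Lebesgue norm on `ℝⁿ`, coordinate `x 0` innermost. -/
def mixedLp : (n : ℕ) → (Fin n → ℝ) → ((Fin n → ℝ) → ℝ≥0∞) → ℝ≥0∞
  | 0, _, f => f (fun i => i.elim0)
  | n + 1, p, f => mixedLp n (fun i => p i.succ)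
      (fun y => (∫⁻ x : ℝ, (f (Fin.cons x y)) ^ (p 0)) ^ (1 / p 0))

/-- The Fourier transform on `ℝⁿ`, normalized as `(2π)^{-n/2} ∫ f(x) e^{-i ξ·x} dx`. -/
def ft (n : ℕ) (f : (Fin n → ℝ) → ℂ) (ξ : Fin n → ℝ) : ℂ :=
  (((2 * π) ^ (-(n : ℝ) / 2) : ℝ) : ℂ) *
    ∫ x : Fin n → ℝ, Complex.exp (-(Complex.I * ((∑ i, ξ i * x i : ℝ) : ℂ))) * f x

/-- `Λ^s` acting only in the coordinates of `S`: the Fourier multiplier with symbol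
`(∑_{i ∈ S} |ξ i|²)^{s/2}`. -/
def fracLapOn (n : ℕ) (S : Finset (Fin n)) (s : ℝ) (f : (Fin n → ℝ) → ℂ)
    (x : Fin n → ℝ) : ℂ :=
  ft n (fun ξ => ((((∑ i ∈ S, ξ i ^ 2) ^ (s / 2) : ℝ)) : ℂ) * ft n f ξ) (-x)

/-- The fractional Laplacian `Λ^s = (−Δ)^{s/2}`. -/
def fracLap (n : ℕ) (s : ℝ) (f : (Fin n → ℝ) → ℂ) : (Fin n → ℝ) → ℂ :=
  fracLapOn n Finset.univ s f



lemma lt_rearr_iff {α : Type*} [MeasurableSpace α] (μ : Measure α) (f : α → ℝ≥0∞) (t : ℝ)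
    (s : ℝ≥0∞) : s < rearr μ f t ↔ ENNReal.ofReal t < μ {x | s < f x} := by
  constructor
  · intro h
    by_contra hc
    exact absurd (sInf_le (show s ∈ {s : ℝ≥0∞ | μ {x | s < f x} ≤ ENNReal.ofReal t} from
      not_lt.mp hc)) (not_le.mpr h)
  · intro h
    have hs : s ≠ ∞ := by
      rintro rfl
      simp at h
    obtain ⟨u, hu, hmem, hlim⟩ := exists_seq_strictAnti_tendsto' (show s < ∞ from lt_top_iff_ne_top.mpr hs)
    have hU : {x | s < f x} = ⋃ k, {x | u k < f x} := by
      ext x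
      simp only [mem_ofPred_eq, mem_iUnion]
      constructor
      · intro hx
        exact ((hlim.eventually_lt_const hx)).exists
      · rintro ⟨k, hk⟩
        exact (hmem k).1.trans hk
    have hmono : Monotone fun k => {x | u k < f x} := by
      intro i j hij x hx
      exact lt_of_le_of_lt (hu.antitone hij) hx
    rw [hU, hmono.measure_iUnion, lt_iSup_iff] at h
    obtain ⟨k, hk⟩ := h
    refine lt_of_lt_of_le (hmem k).1 ?_
    refine le_sInf ?_
    intro r hr
    by_contra hc
    rw [not_le] at hc
    have : μ {x | u k < f x} ≤ μ {x | r < f x} := measure_mono fun x hx => hc.trans hx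
    exact absurd (this.trans hr) (not_le.mpr hk)

lemma rearr_anti {α : Type*} [MeasurableSpace α] (μ : Measure α) (f : α → ℝ≥0∞) :
    Antitone (rearr μ f) := by
  intro a b hab
  refine le_of_forall_lt fun s hs => ?_
  rw [lt_rearr_iff] at hs ⊢
  exact lt_of_le_of_lt (ENNReal.ofReal_le_ofReal hab) hs

lemma rearr_mono {α : Type*} [MeasurableSpace α] (μ : Measure α) {f g : α → ℝ≥0∞} (h : f ≤ g)
    (t : ℝ) : rearr μ f t ≤ rearr μ g t := by
  refine le_of_forall_lt fun s hs => ?_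
  rw [lt_rearr_iff] at hs ⊢
  exact lt_of_lt_of_le hs (measure_mono fun x hx => lt_of_lt_of_le hx (h x))

lemma rearr_const_mul {α : Type*} [MeasurableSpace α] (μ : Measure α) (f : α → ℝ≥0∞) (t : ℝ)
    {c : ℝ≥0∞} (hc : c ≠ 0) (hc' : c ≠ ∞) :
    rearr μ (fun x => c * f x) t = c * rearr μ f t := by
  refine eq_of_forall_lt_iff fun s => ?_
  rw [lt_rearr_iff, mul_comm c, ← ENNReal.div_lt_iff (Or.inl hc) (Or.inl hc'), lt_rearr_iff]
  simp_rw [ENNReal.div_lt_iff (Or.inl hc) (Or.inl hc'), mul_comm c]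

lemma rearr_measurable_param {β : Type*} [MeasurableSpace β] 
    (G : β → ℝ → ℝ≥0∞) (hG : Measurable (Function.uncurry G)) :
    Measurable (fun z : β × ℝ => rearr (volume : Measure ℝ) (G z.1) z.2) := by
  refine measurable_of_Ioi fun s => ?_
  have : (fun z : β × ℝ => rearr (volume : Measure ℝ) (G z.1) z.2) ⁻¹' Ioi s =
      {z : β × ℝ | ENNReal.ofReal z.2 < volume {x | s < G z.1 x}} := by
    ext z
    simp [lt_rearr_iff]
  rw [this]
  have h1 : Measurable fun b : β => volume {x | s < G b x} :=
    measurable_measure_prodMk_left (measurableSet_lt measurable_const hG)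
  exact measurableSet_lt (by fun_prop) (h1.comp measurable_fst)

/-- layer cake -/
lemma vol_layer (y : ℝ≥0∞) : volume (Ioi (0:ℝ) ∩ {s | ENNReal.ofReal s < y}) = y := by
  induction y with
  | top => simp
  | coe y =>
    have : (Ioi (0:ℝ) ∩ {s | ENNReal.ofReal s < y}) = Ioo 0 (y:ℝ) := by
      ext s
      simp only [mem_inter_iff, mem_Ioi, mem_ofPred_eq, mem_Ioo, and_congr_right_iff]
      intro hs
      rw [ENNReal.ofReal_lt_coe_iff hs.le]
    rw [this]; simp

lemma layer_cake {α : Type*} [MeasurableSpace α] (μ : Measure α) [SFinite μ] (f : α → ℝ≥0∞)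
    (hf : Measurable f) :
    ∫⁻ x, f x ∂μ = ∫⁻ s in Ioi (0:ℝ), μ {x | ENNReal.ofReal s < f x} := by
  have hm : MeasurableSet {z : α × ℝ | ENNReal.ofReal z.2 < f z.1} :=
    measurableSet_lt (by fun_prop) (by fun_prop)
  have h1 := Measure.prod_apply (μ := μ) (ν := volume.restrict (Ioi (0:ℝ))) hm
  have h2 := Measure.prod_apply_symm (μ := μ) (ν := volume.restrict (Ioi (0:ℝ))) hm
  rw [h1] at h2
  refine Eq.trans ?_ h2
  refine lintegral_congr fun x => ?_
  rw [Measure.restrict_apply (measurable_prodMk_left hm), inter_comm]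
  exact (vol_layer (f x)).symm

lemma setLIntegral_le_rearr {α : Type*} [MeasurableSpace α] (μ : Measure α) [SFinite μ]
    (f : α → ℝ≥0∞) (hf : Measurable f) (E : Set α) {m : ℝ}
    (hE : μ E ≤ ENNReal.ofReal m) :
    ∫⁻ x in E, f x ∂μ ≤ ∫⁻ u in Ioo 0 m, rearr μ f u := by
  rw [layer_cake _ _ hf, layer_cake _ _ (rearr_anti μ f).measurable]
  refine lintegral_mono fun s => ?_
  rw [Measure.restrict_apply (measurableSet_lt measurable_const hf),
    Measure.restrict_apply (measurableSet_lt measurable_const (rearr_anti μ f).measurable)]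
  simp_rw [lt_rearr_iff]
  have : ({x | ENNReal.ofReal x < μ {x | ENNReal.ofReal s < f x}} ∩ Ioo 0 m) =
     Ioi (0:ℝ) ∩ {x | ENNReal.ofReal x < min (ENNReal.ofReal m) (μ {x | ENNReal.ofReal s < f x})} := by
    ext x
    simp only [mem_inter_iff, mem_ofPred_eq, mem_Ioo, mem_Ioi, lt_min_iff]
    constructor
    · rintro ⟨h1, h2, h3⟩
      exact ⟨h2, (ENNReal.ofReal_lt_ofReal_iff (h2.trans h3)).mpr h3, h1⟩
    · rintro ⟨h1, h2, h3⟩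
      exact ⟨h3, h1, (ENNReal.ofReal_lt_ofReal_iff_of_nonneg h1.le).mp h2⟩
  rw [this, vol_layer]
  exact le_min ((measure_mono inter_subset_right).trans hE) (measure_mono inter_subset_left)

/-- Minkowski's integral inequality -/
lemma minkowski {α τ : Type*} [MeasurableSpace α] [MeasurableSpace τ] (μ : Measure α)
    [SigmaFinite μ] (ν : Measure τ) [SFinite ν] {q : ℝ} (hq : 1 < q) (G : α → τ → ℝ≥0∞)
    (hG : Measurable (Function.uncurry G)) :
    (∫⁻ x, (∫⁻ t, G x t ∂ν) ^ q ∂μ) ^ (1 / q) ≤ ∫⁻ t, (∫⁻ x, G x t ^ q ∂μ) ^ (1 / q) ∂ν := by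
  set F : α → ℝ≥0∞ := fun x => ∫⁻ t, G x t ∂ν with hF
  have hFm : Measurable F := hG.lintegral_prod_right'
  set R := ∫⁻ t, (∫⁻ x, G x t ^ q ∂μ) ^ (1 / q) ∂ν with hR
  have hq0 : 0 < q := by linarith
  -- truncations
  let S := spanningSets μ
  let T : ℕ → α → ℝ≥0∞ := fun k => (S k).indicator (fun x => min (F x) k)
  have hTm : ∀ k, Measurable (T k) := fun k =>
    (hFm.min measurable_const).indicator (measurableSet_spanningSets μ k)
  have hTF : ∀ k x, T k x ≤ F x := fun k x => 
    (indicator_le_self _ _ x).trans (min_le_left _ _)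
  have hTfin : ∀ k, ∫⁻ x, T k x ^ q ∂μ ≠ ∞ := by
    intro k
    refine ne_of_lt ?_
    calc ∫⁻ x, T k x ^ q ∂μ ≤ ∫⁻ x, (S k).indicator (fun _ => (k:ℝ≥0∞) ^ q) x ∂μ := by
          refine lintegral_mono fun x => ?_
          by_cases hx : x ∈ S k
          · simp only [T, indicator_of_mem hx]
            exact ENNReal.rpow_le_rpow (min_le_right _ _) hq0.le
          · simp [T, indicator_of_notMem hx, hq0]
      _ = (k:ℝ≥0∞) ^ q * μ (S k) := by
          rw [lintegral_indicator_const (measurableSet_spanningSets μ k)]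
      _ < ∞ := ENNReal.mul_lt_top (ENNReal.rpow_lt_top_of_nonneg hq0.le (by simp))
          (measure_spanningSets_lt_top μ k)
  have hpq : q.HolderConjugate (q / (q - 1)) := (Real.holderConjugate_iff_eq_conjExponent hq).mpr rfl
  have key : ∀ k, (∫⁻ x, T k x ^ q ∂μ) ^ (1 / q) ≤ R := by
    intro k
    set I := ∫⁻ x, T k x ^ q ∂μ with hI
    have h1 : I ≤ R * I ^ (1 / (q / (q - 1))) := by
      calc I ≤ ∫⁻ x, ∫⁻ t, G x t * T k x ^ (q - 1) ∂ν ∂μ := by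
            refine lintegral_mono fun x => ?_
            rw [lintegral_mul_const _ (show Measurable (G x) from hG.comp measurable_prodMk_left)]
            calc T k x ^ q = T k x ^ (1 + (q - 1)) := by ring_nf
              _ = T k x * T k x ^ (q - 1) := by
                rw [ENNReal.rpow_add_of_nonneg _ _ (by norm_num) (by linarith), ENNReal.rpow_one]
              _ ≤ _ := mul_le_mul_left (hTF k x) _
        _ = ∫⁻ t, ∫⁻ x, G x t * T k x ^ (q - 1) ∂μ ∂ν := by
            rw [lintegral_lintegral_swap]
            exact (hG.mul (((hTm k).comp measurable_fst).pow_const _)).aemeasurable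
        _ ≤ ∫⁻ t, (∫⁻ x, G x t ^ q ∂μ) ^ (1 / q) * I ^ (1 / (q / (q - 1))) ∂ν := by
            refine lintegral_mono fun t => ?_
            have := ENNReal.lintegral_mul_le_Lp_mul_Lq μ hpq
              (f := fun x => G x t) (g := fun x => T k x ^ (q - 1))
              (hG.comp measurable_prodMk_right).aemeasurable ((hTm k).pow_const _).aemeasurable
            refine this.trans (le_of_eq ?_)
            congr 2
            refine lintegral_congr fun x => ?_
            rw [← ENNReal.rpow_mul]
            congr 1
            field_simp [show q - 1 ≠ 0 by linarith]
        _ = _ := by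
            rw [lintegral_mul_const]
            exact ((hG.pow_const q).lintegral_prod_left').pow_const _
    by_cases hI0 : I = 0
    · rw [hI0, ENNReal.zero_rpow_of_pos (by positivity)]; exact zero_le
    have e : I = I ^ (1 / q) * I ^ (1 / (q / (q - 1))) := by
      rw [← ENNReal.rpow_add _ _ hI0 (hTfin k)]
      conv_lhs => rw [← ENNReal.rpow_one I]
      congr 1
      field_simp [show q - 1 ≠ 0 by linarith]
      ring
    have hne : I ^ (1 / (q / (q - 1))) ≠ 0 := by
      rw [Ne, ENNReal.rpow_eq_zero_iff]
      rintro (h | h)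
      · exact hI0 h.1
      · exact hTfin k h.1
    have hnt : I ^ (1 / (q / (q - 1))) ≠ ∞ := 
      ENNReal.rpow_ne_top_of_nonneg (by have := hpq.symm.pos; positivity) (hTfin k)
    exact (ENNReal.mul_le_mul_iff_left hne hnt).mp (e.symm.le.trans h1)
  have hsup : ∀ x, ⨆ k, T k x ^ q = F x ^ q := by
    intro x
    refine le_antisymm (iSup_le fun k => ENNReal.rpow_le_rpow (hTF k x) hq0.le) ?_
    have : F x = ⨆ k, T k x := by
      refine le_antisymm ?_ (iSup_le fun k => hTF k x)
      refine le_of_forall_lt fun c hc => ?_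
      obtain ⟨m, hm⟩ := ENNReal.exists_nat_gt (ne_top_of_lt hc)
      have hx : x ∈ ⋃ k, S k := by rw [iUnion_spanningSets]; trivial
      obtain ⟨j, hj⟩ := mem_iUnion.mp hx
      refine lt_of_lt_of_le ?_ (le_iSup _ (max m j))
      have hj' : x ∈ S (max m j) := monotone_spanningSets μ (le_max_right m j) hj
      simp only [T, indicator_of_mem hj']
      refine lt_min hc (hm.trans_le ?_)
      exact_mod_cast le_max_left m j
    rw [this]
    exact ((ENNReal.orderIsoRpow q hq0).map_iSup _).le
  have hmono : Monotone fun k x => T k x ^ q := by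
    intro i j hij x
    refine ENNReal.rpow_le_rpow ?_ hq0.le
    by_cases hx : x ∈ S i
    · have hx' : x ∈ S j := monotone_spanningSets μ hij hx
      simp only [T, indicator_of_mem hx, indicator_of_mem hx']
      exact min_le_min le_rfl (by exact_mod_cast hij)
    · simp [T, indicator_of_notMem hx]
  have hlim : ∫⁻ x, F x ^ q ∂μ = ⨆ k, ∫⁻ x, T k x ^ q ∂μ := by
    rw [← lintegral_iSup (fun k => (hTm k).pow_const q) hmono]
    exact lintegral_congr fun x => (hsup x).symm
  rw [one_div, ENNReal.rpow_inv_le_iff hq0, hlim]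
  refine iSup_le fun k => ?_
  have := key k
  rwa [one_div, ENNReal.rpow_inv_le_iff hq0] at this

lemma lintegral_Ioi_scale (h : ℝ → ℝ≥0∞) (hh : Measurable h) {v : ℝ} (hv : 0 < v) :
    ∫⁻ t in Ioi (0:ℝ), h (v * t) = ENNReal.ofReal v⁻¹ * ∫⁻ t in Ioi (0:ℝ), h t := by
  have h1 := Real.map_volume_mul_left hv.ne'
  have h2 : ∫⁻ t, (Ioi (0:ℝ)).indicator h t ∂(Measure.map (v * ·) volume) =
      ENNReal.ofReal v⁻¹ * ∫⁻ t in Ioi (0:ℝ), h t := by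
    rw [h1, lintegral_smul_measure, lintegral_indicator measurableSet_Ioi,
      abs_of_pos (inv_pos.mpr hv), smul_eq_mul]
  rw [← h2, lintegral_map (hh.indicator measurableSet_Ioi) (by fun_prop),
    ← lintegral_indicator measurableSet_Ioi]
  refine lintegral_congr fun t => ?_
  by_cases ht : 0 < t
  · have : 0 < v * t := by positivity
    simp [indicator, ht, this]
  · have : ¬ 0 < v * t := by
      rw [not_lt] at ht ⊢
      exact mul_nonpos_of_nonneg_of_nonpos hv.le ht
    simp only [indicator, mem_Ioi, ht, this, if_false]

lemma lorentz_eq {p q : ℝ} (hp : 1 < p) (hq : 1 < q) (f : ℝ → ℝ≥0∞) :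
    lorentzNorm (volume : Measure ℝ) (ENNReal.ofReal p) (ENNReal.ofReal q) f =
      (∫⁻ t in Ioi (0:ℝ), (ENNReal.ofReal t ^ (p⁻¹ - q⁻¹) * rearr volume f t) ^ q) ^ (1 / q) := by
  have hp0 : 0 < p := by linarith
  have hq0 : 0 < q := by linarith
  unfold lorentzNorm
  rw [if_neg ENNReal.ofReal_ne_top, ← ENNReal.ofReal_inv_of_pos hp0,
    ← ENNReal.ofReal_inv_of_pos hq0, ENNReal.toReal_ofReal (by positivity),
    ENNReal.toReal_ofReal (by positivity), ENNReal.toReal_ofReal (by positivity), one_div]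
  congr 1
  refine setLIntegral_congr_fun measurableSet_Ioi fun t ht => ?_
  have ht0 : ENNReal.ofReal t ≠ 0 := by simpa using ht
  rw [ENNReal.rpow_sub _ _ ht0 ENNReal.ofReal_ne_top, ENNReal.mul_rpow_of_nonneg _ _ hq0.le,
    ENNReal.mul_rpow_of_nonneg _ _ hq0.le, ENNReal.div_rpow_of_nonneg _ _ hq0.le,
    ← ENNReal.rpow_mul _ q⁻¹ q, inv_mul_cancel₀ hq0.ne', ENNReal.rpow_one]
  simp only [div_eq_mul_inv]
  ring

lemma lorentz_mono {p q : ℝ} (hp : 1 < p) (hq : 1 < q) {f g : ℝ → ℝ≥0∞} (h : f ≤ g) :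
    lorentzNorm (volume : Measure ℝ) (ENNReal.ofReal p) (ENNReal.ofReal q) f ≤
    lorentzNorm (volume : Measure ℝ) (ENNReal.ofReal p) (ENNReal.ofReal q) g := by
  rw [lorentz_eq hp hq, lorentz_eq hp hq]
  have hq0 : 0 < q := by linarith
  refine ENNReal.rpow_le_rpow (lintegral_mono fun t => ENNReal.rpow_le_rpow ?_ hq0.le)
    (by positivity)
  gcongr
  exact rearr_mono _ h t

lemma lorentz_const_mul {p q : ℝ} (hp : 1 < p) (hq : 1 < q) (f : ℝ → ℝ≥0∞) 
    {c : ℝ≥0∞} (hc : c ≠ 0) (hc' : c ≠ ∞) :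
    lorentzNorm (volume : Measure ℝ) (ENNReal.ofReal p) (ENNReal.ofReal q) (fun x => c * f x) =
    c * lorentzNorm (volume : Measure ℝ) (ENNReal.ofReal p) (ENNReal.ofReal q) f := by
  rw [lorentz_eq hp hq, lorentz_eq hp hq]
  have hq0 : 0 < q := by linarith
  simp_rw [rearr_const_mul _ _ _ hc hc']
  have : ∀ t : ℝ, (ENNReal.ofReal t ^ (p⁻¹ - q⁻¹) * (c * rearr volume f t)) ^ q = 
      c ^ q * (ENNReal.ofReal t ^ (p⁻¹ - q⁻¹) * (rearr volume f t)) ^ q := by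
    intro t
    rw [← ENNReal.mul_rpow_of_nonneg _ _ hq0.le]
    congr 1
    ring
  simp_rw [this]
  rw [lintegral_const_mul' _ _ (ENNReal.rpow_ne_top_of_nonneg hq0.le hc'),
    ENNReal.mul_rpow_of_nonneg _ _ (by positivity), ← ENNReal.rpow_mul, mul_one_div_cancel hq0.ne',
    ENNReal.rpow_one]

/-- scaling of the rearranged integrals -/
lemma scale_rearr {p q : ℝ} (_hp : 1 < p) (hq : 1 < q) (h : ℝ → ℝ≥0∞) (hh : Measurable h)
    {v : ℝ} (hv : 0 < v) :
    (∫⁻ t in Ioi (0:ℝ), (ENNReal.ofReal t ^ (p⁻¹ - q⁻¹) * h (v * t)) ^ q) ^ (1 / q) =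
    ENNReal.ofReal (v ^ (-p⁻¹)) *
    (∫⁻ t in Ioi (0:ℝ), (ENNReal.ofReal t ^ (p⁻¹ - q⁻¹) * h t) ^ q) ^ (1 / q) := by
  have hq0 : 0 < q := by linarith
  set b := p⁻¹ - q⁻¹ with hb
  have hv0 : ENNReal.ofReal v ≠ 0 := by simpa using hv
  have hvt : ENNReal.ofReal v ≠ ∞ := ENNReal.ofReal_ne_top
  have h1 : ∀ t ∈ Ioi (0:ℝ), (ENNReal.ofReal t ^ b * h (v * t)) ^ q =
      (ENNReal.ofReal v ^ (-b)) ^ q *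
        (fun t => (ENNReal.ofReal t ^ b * h t) ^ q) (v * t) := by
    intro t ht
    dsimp only
    rw [← ENNReal.mul_rpow_of_nonneg _ _ hq0.le, ENNReal.ofReal_mul hv.le,
      ENNReal.mul_rpow_of_ne_top ENNReal.ofReal_ne_top ENNReal.ofReal_ne_top, ← mul_assoc,
      ← mul_assoc, ← ENNReal.rpow_add _ _ hv0 hvt]
    simp
  rw [setLIntegral_congr_fun measurableSet_Ioi h1, lintegral_const_mul' _ _ (by
      refine ENNReal.rpow_ne_top_of_nonneg hq0.le ?_
      exact ENNReal.rpow_ne_top_of_ne_zero hv0 hvt),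
    lintegral_Ioi_scale (fun t => (ENNReal.ofReal t ^ b * h t) ^ q) (by fun_prop) hv, ENNReal.mul_rpow_of_nonneg _ _ (by positivity),
    ENNReal.mul_rpow_of_nonneg _ _ (by positivity), ← mul_assoc]
  congr 1
  rw [← ENNReal.rpow_mul _ q, mul_one_div_cancel hq0.ne', ENNReal.rpow_one,
    ENNReal.ofReal_inv_of_pos hv, ← ENNReal.rpow_neg_one, ← ENNReal.rpow_mul,
    ← ENNReal.rpow_add _ _ hv0 hvt, ENNReal.ofReal_rpow_of_pos hv]
  congr 2
  rw [hb]; ring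

lemma rearr_comp_mul (g : ℝ → ℝ≥0∞) {c : ℝ} (hc : c ≠ 0) (t : ℝ) :
    rearr volume (fun x => g (c * x)) t = rearr volume g (|c| * t) := by
  refine eq_of_forall_lt_iff fun s => ?_
  have hc' : 0 < |c| := abs_pos.mpr hc
  rw [lt_rearr_iff, lt_rearr_iff]
  have := Real.volume_preimage_mul_left hc {x | s < g x}
  rw [show {x | s < g (c * x)} = (c * ·) ⁻¹' {x | s < g x} from rfl, this, abs_inv,
    ENNReal.ofReal_inv_of_pos hc', ENNReal.ofReal_mul hc'.le, mul_comm (_⁻¹), mul_comm (ENNReal.ofReal |c|),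
    ← div_eq_mul_inv, ENNReal.lt_div_iff_mul_lt]
  · left; simpa using hc
  · left; simp

lemma lorentz_dil {p q : ℝ} (hp : 1 < p) (hq : 1 < q) (g : ℝ → ℝ≥0∞) {c : ℝ} (hc : c ≠ 0) :
    lorentzNorm (volume : Measure ℝ) (ENNReal.ofReal p) (ENNReal.ofReal q) (fun x => g (c * x)) =
    ENNReal.ofReal (|c| ^ (-p⁻¹)) *
      lorentzNorm (volume : Measure ℝ) (ENNReal.ofReal p) (ENNReal.ofReal q) g := by
  rw [lorentz_eq hp hq, lorentz_eq hp hq]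
  simp_rw [rearr_comp_mul g hc]
  exact scale_rearr hp hq _ (rearr_anti volume g).measurable (abs_pos.mpr hc)

lemma lorentz_measurable_param {β : Type*} [MeasurableSpace β] {p q : ℝ} (hp : 1 < p) (hq : 1 < q)
    (G : β → ℝ → ℝ≥0∞) (hG : Measurable (Function.uncurry G)) :
    Measurable (fun b => lorentzNorm (volume : Measure ℝ) (ENNReal.ofReal p) (ENNReal.ofReal q)
      (G b)) := by
  simp_rw [lorentz_eq hp hq]
  refine Measurable.pow_const ?_ _
  have h := rearr_measurable_param G hG
  refine Measurable.lintegral_prod_right' (f := fun z : β × ℝ =>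
    (ENNReal.ofReal z.2 ^ (p⁻¹ - q⁻¹) * rearr volume (G z.1) z.2) ^ q) ?_
  fun_prop

lemma lintegral_Ioo_scale (h : ℝ → ℝ≥0∞) (hh : Measurable h) {m : ℝ} (hm : 0 < m) :
    ∫⁻ u in Ioo 0 m, h u = ENNReal.ofReal m * ∫⁻ v in Ioo (0:ℝ) 1, h (m * v) := by
  have h2 := lintegral_Ioi_scale ((Iio m).indicator h) (hh.indicator measurableSet_Iio) hm
  have e1 : ∫⁻ t in Ioi (0:ℝ), (Iio m).indicator h t = ∫⁻ u in Ioo 0 m, h u := by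
    rw [setLIntegral_indicator measurableSet_Iio, inter_comm]; rfl
  have e2 : ∫⁻ t in Ioi (0:ℝ), (Iio m).indicator h (m * t) = ∫⁻ v in Ioo (0:ℝ) 1, h (m * v) := by
    have : ∀ t, (Iio m).indicator h (m * t) = (Iio 1).indicator (fun v => h (m * v)) t := by
      intro t
      have : m * t < m ↔ t < 1 := by
        constructor <;> intro h <;> nlinarith
      simp [indicator, this]
    simp_rw [this]
    rw [setLIntegral_indicator measurableSet_Iio, inter_comm]; rfl
  rw [e1, e2] at h2
  rw [h2, ← mul_assoc, ← ENNReal.ofReal_mul hm.le, mul_inv_cancel₀ hm.ne']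
  simp

lemma rearr_lintegral_le {τ : Type*} [MeasurableSpace τ] (ν : Measure τ) [SFinite ν]
    (G : ℝ → τ → ℝ≥0∞) (hG : Measurable (Function.uncurry G)) {t : ℝ} (ht : 0 < t) :
    rearr volume (fun x => ∫⁻ a, G x a ∂ν) t ≤
      ∫⁻ a, (∫⁻ v in Ioo (0:ℝ) 1, rearr volume (fun x => G x a) (v * t)) ∂ν := by
  refine le_of_forall_lt_imp_le_of_dense fun s hs => ?_
  rw [lt_rearr_iff] at hs
  have hFm : Measurable fun x => ∫⁻ a, G x a ∂ν := hG.lintegral_prod_right'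
  obtain ⟨E, hE, hEs, hEt, hEtop⟩ := Measure.exists_subset_measure_lt_top
    (measurableSet_lt measurable_const hFm) hs
  set m := (volume E).toReal with hm
  have hEm : volume E = ENNReal.ofReal m := (ENNReal.ofReal_toReal hEtop.ne).symm
  rw [hEm] at hEt
  have htm : t < m := (ENNReal.ofReal_lt_ofReal_iff_of_nonneg ht.le).mp hEt
  have hm0 : 0 < m := ht.trans htm
  have h1 : ENNReal.ofReal m * s ≤ ENNReal.ofReal m *
      ∫⁻ a, (∫⁻ v in Ioo (0:ℝ) 1, rearr volume (fun x => G x a) (v * t)) ∂ν := by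
    calc ENNReal.ofReal m * s = ∫⁻ x in E, s := by
          rw [setLIntegral_const, hEm, mul_comm]
      _ ≤ ∫⁻ x in E, (∫⁻ a, G x a ∂ν) := setLIntegral_mono hFm fun x hx => (hEs hx).le
      _ = ∫⁻ a, (∫⁻ x in E, G x a) ∂ν := lintegral_lintegral_swap hG.aemeasurable
      _ ≤ ∫⁻ a, ENNReal.ofReal m * (∫⁻ v in Ioo (0:ℝ) 1, rearr volume (fun x => G x a) (v * t)) ∂ν := by
          refine lintegral_mono fun a => ?_
          refine (setLIntegral_le_rearr volume _ (hG.comp measurable_prodMk_right) E hEm.le).trans ?_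
          rw [lintegral_Ioo_scale _ (rearr_anti volume _).measurable hm0]
          refine mul_le_mul_right ?_ _
          refine setLIntegral_mono_ae' measurableSet_Ioo (Filter.Eventually.of_forall fun v hv => ?_)
          refine rearr_anti volume _ ?_
          rw [mul_comm m]
          exact mul_le_mul_of_nonneg_left htm.le hv.1.le
      _ = _ := lintegral_const_mul' _ _ ENNReal.ofReal_ne_top
  exact (ENNReal.mul_le_mul_iff_right (by simpa using hm0) ENNReal.ofReal_ne_top).mp h1

lemma lintegral_Ioo_rpow_lt_top {p : ℝ} (hp : 1 < p) :
    ∫⁻ v in Ioo (0:ℝ) 1, ENNReal.ofReal (v ^ (-p⁻¹)) < ∞ := by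
  have h : IntegrableOn (fun v : ℝ => v ^ (-p⁻¹)) (Ioo 0 1) :=
    (intervalIntegral.integrableOn_Ioo_rpow_iff one_pos).mpr (by
      have := inv_lt_one_of_one_lt₀ hp
      linarith)
  refine lt_of_le_of_lt (lintegral_mono fun v => ?_) h.2
  exact Real.ofReal_le_enorm _

lemma lorentz_minkowski {τ : Type*} [MeasurableSpace τ] (ν : Measure τ) [SFinite ν] 
    {p q : ℝ} (hp : 1 < p) (hq : 1 < q)
    (G : ℝ → τ → ℝ≥0∞) (hG : Measurable (Function.uncurry G)) :
    lorentzNorm (volume : Measure ℝ) (ENNReal.ofReal p) (ENNReal.ofReal q)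
      (fun x => ∫⁻ a, G x a ∂ν) ≤ 
    (∫⁻ v in Ioo (0:ℝ) 1, ENNReal.ofReal (v ^ (-p⁻¹))) *
    ∫⁻ a, lorentzNorm (volume : Measure ℝ) (ENNReal.ofReal p) (ENNReal.ofReal q)
      (fun x => G x a) ∂ν := by
  have hq0 : 0 < q := by linarith
  have hr : Measurable (fun z : τ × ℝ => rearr (volume : Measure ℝ) (fun x => G x z.1) z.2) :=
    rearr_measurable_param (fun a x => G x a) (hG.comp measurable_swap)
  let κ := ν.prod (volume.restrict (Ioo (0:ℝ) 1))
  let H : ℝ → τ × ℝ → ℝ≥0∞ := fun t z =>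
    ENNReal.ofReal t ^ (p⁻¹ - q⁻¹) * rearr volume (fun x => G x z.1) (z.2 * t)
  have hr2 : Measurable fun z : ℝ × τ × ℝ => 
      rearr (volume : Measure ℝ) (fun x => G x z.2.1) (z.2.2 * z.1) :=
    hr.comp (g := fun z : τ × ℝ => rearr (volume : Measure ℝ) (fun x => G x z.1) z.2)
      (f := fun z : ℝ × τ × ℝ => (z.2.1, z.2.2 * z.1)) (by fun_prop)
  have hH : Measurable (Function.uncurry H) := by
    simp only [Function.uncurry_def, H]
    fun_prop
  have hM := minkowski (volume.restrict (Ioi (0:ℝ))) κ hq H hH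
  rw [lorentz_eq hp hq]
  refine le_trans (ENNReal.rpow_le_rpow (setLIntegral_mono_ae' measurableSet_Ioi 
    (Filter.Eventually.of_forall fun t ht => ENNReal.rpow_le_rpow ?_ hq0.le)) (by positivity)) 
    (hM.trans ?_)
  · have hHt : Measurable (H t) := hH.comp measurable_prodMk_left
    rw [show κ = ν.prod (volume.restrict (Ioo (0:ℝ) 1)) from rfl, lintegral_prod _ hHt.aemeasurable]
    have ht0 : ENNReal.ofReal t ≠ 0 := by simpa using ht
    simp only [H]
    have hne : ENNReal.ofReal t ^ (p⁻¹ - q⁻¹) ≠ ∞ :=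
      ENNReal.rpow_ne_top_of_ne_zero ht0 ENNReal.ofReal_ne_top
    simp_rw [lintegral_const_mul' _ _ hne]
    gcongr
    exact rearr_lintegral_le ν G hG ht
  · have hHm : Measurable fun z : τ × ℝ =>
        (∫⁻ (x : ℝ) in Ioi 0, H x z ^ q) ^ (1 / q) :=
      (hH.pow_const q).lintegral_prod_left'.pow_const _
    rw [show κ = ν.prod (volume.restrict (Ioo (0:ℝ) 1)) from rfl, lintegral_prod _ hHm.aemeasurable]
    rw [← lintegral_const_mul _ (lorentz_measurable_param hp hq (fun a x => G x a)
      (hG.comp measurable_swap))]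
    refine lintegral_mono fun a => ?_
    rw [← lintegral_mul_const _ (by fun_prop)]
    refine setLIntegral_mono_ae' measurableSet_Ioo (Filter.Eventually.of_forall fun v hv => ?_)
    rw [lorentz_eq hp hq]
    exact (scale_rearr hp hq (rearr volume fun x => G x a) (rearr_anti volume _).measurable hv.1).le

/-! mixed norms -/

abbrev mixN (n : ℕ) (p q : Fin n → ℝ) (f : (Fin n → ℝ) → ℝ≥0∞) : ℝ≥0∞ :=
  mixedLorentz n (fun i => ENNReal.ofReal (p i)) (fun i => ENNReal.ofReal (q i)) f

lemma mixN_mono (n : ℕ) (p q : Fin n → ℝ) (hp : ∀ i, 1 < p i) (hq : ∀ i, 1 < q i) 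
    {f g : (Fin n → ℝ) → ℝ≥0∞} (h : ∀ x, f x ≤ g x) : mixN n p q f ≤ mixN n p q g := by
  induction n with
  | zero => exact h _
  | succ n ih =>
    exact ih (fun i => p i.succ) (fun i => q i.succ) (fun i => hp _) (fun i => hq _) 
      (fun y => lorentz_mono (hp 0) (hq 0) fun x => h _)

lemma mixN_const_mul (n : ℕ) (p q : Fin n → ℝ) (hp : ∀ i, 1 < p i) (hq : ∀ i, 1 < q i) 
    (f : (Fin n → ℝ) → ℝ≥0∞) {c : ℝ≥0∞} (hc : c ≠ 0) (hc' : c ≠ ∞) :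
    mixN n p q (fun x => c * f x) = c * mixN n p q f := by
  induction n with
  | zero => rfl
  | succ n ih =>
    simp only [mixN, mixedLorentz]
    simp_rw [lorentz_const_mul (hp 0) (hq 0) _ hc hc']
    exact ih (fun i => p i.succ) (fun i => q i.succ) (fun i => hp _) (fun i => hq _) _

lemma mixN_dil (n : ℕ) (p q : Fin n → ℝ) (hp : ∀ i, 1 < p i) (hq : ∀ i, 1 < q i) 
    (f : (Fin n → ℝ) → ℝ≥0∞) (c : Fin n → ℝ) (hc : ∀ i, c i ≠ 0) :
    mixN n p q (fun x => f (fun i => c i * x i)) =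
      (∏ i, ENNReal.ofReal (|c i| ^ (-(p i)⁻¹))) * mixN n p q f := by
  induction n with
  | zero => 
    simp only [mixN, mixedLorentz, Finset.univ_eq_empty, Finset.prod_empty, one_mul]
    congr 1
    funext i
    exact i.elim0
  | succ n ih =>
    simp only [mixN, mixedLorentz]
    have h1 : ∀ y : Fin n → ℝ, lorentzNorm (volume : Measure ℝ) (ENNReal.ofReal (p 0)) 
        (ENNReal.ofReal (q 0)) (fun x => f fun i => c i * (Fin.cons x y : Fin (n+1) → ℝ) i) =
        ENNReal.ofReal (|c 0| ^ (-(p 0)⁻¹)) * 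
        lorentzNorm (volume : Measure ℝ) (ENNReal.ofReal (p 0)) 
        (ENNReal.ofReal (q 0)) (fun x => f (Fin.cons x (fun i : Fin n => c i.succ * y i))) := by
      intro y
      rw [← lorentz_dil (hp 0) (hq 0) _ (hc 0)]
      congr 1
      funext x
      congr 1
      funext i
      refine Fin.cases ?_ (fun i => ?_) i <;> simp
    simp_rw [h1]
    have hc0 : 0 < |c 0| ^ (-(p 0)⁻¹) := Real.rpow_pos_of_pos (abs_pos.mpr (hc 0)) _
    refine (mixN_const_mul n (fun i => p i.succ) (fun i => q i.succ) (fun i => hp _) (fun i => hq _) _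
      (by simpa using hc0) ENNReal.ofReal_ne_top).trans ?_
    rw [Fin.prod_univ_succ, mul_assoc]
    congr 1
    exact ih (fun i => p i.succ) (fun i => q i.succ) (fun i => hp _) (fun i => hq _) 
      (fun y => lorentzNorm (volume : Measure ℝ) (ENNReal.ofReal (p 0)) 
        (ENNReal.ofReal (q 0)) (fun x => f (Fin.cons x y))) (fun i => c i.succ) (fun i => hc _)

lemma measurable_cons (n : ℕ) {τ : Type} [MeasurableSpace τ] (G : (Fin (n+1) → ℝ) → τ → ℝ≥0∞)
    (hG : Measurable (Function.uncurry G)) :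
    Measurable fun z : ((Fin n → ℝ) × τ) × ℝ => G (Fin.cons z.2 z.1.1) z.1.2 := by
  refine hG.comp (g := Function.uncurry G) 
    (f := fun z : ((Fin n → ℝ) × τ) × ℝ => ((Fin.cons z.2 z.1.1 : Fin (n+1) → ℝ), z.1.2)) ?_
  refine Measurable.prodMk ?_ (by fun_prop)
  refine measurable_pi_lambda _ fun i => ?_
  refine Fin.cases ?_ (fun i => ?_) i
  · simpa using measurable_snd
  · simp only [Fin.cons_succ]
    fun_prop

lemma mixN_minkowski (n : ℕ) (p q : Fin n → ℝ) (hp : ∀ i, 1 < p i) (hq : ∀ i, 1 < q i) :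
    ∃ C : ℝ≥0∞, C ≠ 0 ∧ C ≠ ∞ ∧ ∀ {τ : Type} [MeasurableSpace τ] (ν : Measure τ) [SFinite ν]
      (G : (Fin n → ℝ) → τ → ℝ≥0∞) (_ : Measurable (Function.uncurry G)),
      mixN n p q (fun x => ∫⁻ a, G x a ∂ν) ≤ C * ∫⁻ a, mixN n p q (fun x => G x a) ∂ν := by
  induction n with
  | zero => exact ⟨1, by simp, by simp, fun ν _ G hG => by simp [mixN, mixedLorentz]⟩
  | succ n ih =>
    obtain ⟨C, hC0, hC, h⟩ := ih (fun i => p i.succ) (fun i => q i.succ) (fun i => hp _) (fun i => hq _)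
    set c := (∫⁻ v in Ioo (0:ℝ) 1, ENNReal.ofReal (v ^ (-(p 0)⁻¹))) + 1 with hc
    have hcT : c ≠ ∞ := by
      simpa [hc] using (lintegral_Ioo_rpow_lt_top (hp 0)).ne
    have hc0 : c ≠ 0 := by simp [hc]
    refine ⟨c * C, mul_ne_zero hc0 hC0, ENNReal.mul_ne_top hcT hC, fun ν _ G hG => ?_⟩
    have hm := measurable_cons n G hG
    let L := fun f : ℝ → ℝ≥0∞ => lorentzNorm (volume : Measure ℝ) (ENNReal.ofReal (p 0)) 
        (ENNReal.ofReal (q 0)) f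
    calc mixN (n+1) p q (fun x => ∫⁻ a, G x a ∂ν)
        ≤ mixN n (fun i => p i.succ) (fun i => q i.succ) (fun y => c * 
          ∫⁻ a, L (fun x => G (Fin.cons x y) a) ∂ν) := by
          refine mixN_mono n (fun i => p i.succ) (fun i => q i.succ) (fun i => hp _) (fun i => hq _)
            fun y => ?_
          refine (lorentz_minkowski ν (hp 0) (hq 0) (fun x a => G (Fin.cons x y) a) ?_).trans ?_
          · exact hm.comp (g := fun z : ((Fin n → ℝ) × _) × ℝ => G (Fin.cons z.2 z.1.1) z.1.2)
              (f := fun z : ℝ × _ => ((y, z.2), z.1)) (by fun_prop)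
          · exact mul_le_mul_left (by simp [hc]) _
      _ = c * mixN n (fun i => p i.succ) (fun i => q i.succ) (fun y =>  
          ∫⁻ a, L (fun x => G (Fin.cons x y) a) ∂ν) :=
          mixN_const_mul n _ _ (fun i => hp _) (fun i => hq _) _ hc0 hcT
      _ ≤ c * (C * ∫⁻ a, mixN n (fun i => p i.succ) (fun i => q i.succ)
            (fun y => L (fun x => G (Fin.cons x y) a)) ∂ν) := by
          gcongr
          refine h ν (fun y a => L (fun x => G (Fin.cons x y) a)) ?_
          exact lorentz_measurable_param (hp 0) (hq 0) (fun (z : (Fin n → ℝ) × _) x => G (Fin.cons x z.1) z.2) hm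
      _ = _ := by rw [mul_assoc]; rfl

def kk (c : ℝ) : ℝ → ℝ := (Ioo (0:ℝ) 1).indicator (fun t => t ^ (-c))

lemma kk_int {c : ℝ} (hc : c < 1) : Integrable (kk c) := by
  unfold kk
  rw [integrable_indicator_iff measurableSet_Ioo]
  exact (intervalIntegral.integrableOn_Ioo_rpow_iff one_pos).mpr (by linarith)

lemma kk_nonneg (c t : ℝ) : 0 ≤ kk c t := by
  unfold kk
  exact indicator_nonneg (fun t ht => Real.rpow_nonneg ht.1.le _) t

lemma kk_bound {c t : ℝ} (hc : 0 < c) (ht : |t| ≤ 1 / 2) : |t| ^ (-c) ≤ kk c t + kk c (-t) := by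
  rcases lt_trichotomy t 0 with h | h | h
  · have : kk c (-t) = |t| ^ (-c) := by
      rw [abs_of_neg h] at *
      unfold kk
      rw [indicator_of_mem]
      constructor <;> linarith
    linarith [kk_nonneg c t]
  · subst h
    rw [abs_zero, Real.zero_rpow (by linarith)]
    have := kk_nonneg c 0
    have := kk_nonneg c (-0)
    linarith
  · have : kk c t = |t| ^ (-c) := by
      rw [abs_of_pos h] at *
      unfold kk
      rw [indicator_of_mem]
      constructor <;> linarith
    linarith [kk_nonneg c (-t)]

lemma rpow_neg_le {c x y M : ℝ} (hc : 0 < c) (hc1 : c < 1) (hM : 1 ≤ M) (hy : 0 < y)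
    (h : y / M ≤ x) : x ^ (-c) ≤ M * y ^ (-c) := by
  have hM0 : 0 < M := by linarith
  calc x ^ (-c) ≤ (y / M) ^ (-c) := Real.rpow_le_rpow_of_nonpos (by positivity) h (by linarith)
    _ = M ^ c * y ^ (-c) := by
      rw [Real.div_rpow hy.le hM0.le, Real.rpow_neg hM0.le c, div_inv_eq_mul, mul_comm]
    _ ≤ M * y ^ (-c) := by
      refine mul_le_mul_of_nonneg_right ?_ (Real.rpow_nonneg hy.le _)
      calc M ^ c ≤ M ^ (1:ℝ) := Real.rpow_le_rpow_of_exponent_le hM hc1.le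
        _ = M := Real.rpow_one M

lemma kernel_int {a b : ℝ} (ha : 0 < a) (hab : a < b) (hb : b < 1) :
    Integrable (fun t : ℝ => |1 - t| ^ (a - 1) * |t| ^ (-b)) := by
  have hb0 : 0 < b := ha.trans hab
  have h1 : Integrable (fun t => kk b t + kk b (-t)) := (kk_int hb).add (kk_int hb).comp_neg
  have h2 : Integrable (fun t => kk (1 - a) t + kk (1 - a) (-t)) :=
    (kk_int (by linarith)).add (kk_int (by linarith)).comp_neg
  have h2' := h2.comp_sub_left 1
  have h3 : Integrable (fun t : ℝ => (1 + ‖t‖) ^ (-(1 + b - a))) :=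
    integrable_one_add_norm (by simp; linarith)
  refine Integrable.mono' (((h1.const_mul 2).add (h2'.const_mul 2)).add (h3.const_mul 15))
    (Measurable.aestronglyMeasurable (by fun_prop)) (Filter.Eventually.of_forall fun t => ?_)
  rw [Real.norm_of_nonneg (by positivity)]
  simp only [Pi.add_apply]
  have n1 : 0 ≤ kk b t + kk b (-t) := add_nonneg (kk_nonneg _ _) (kk_nonneg _ _)
  have n2 : 0 ≤ kk (1 - a) (1 - t) + kk (1 - a) (-(1 - t)) := add_nonneg (kk_nonneg _ _) (kk_nonneg _ _)
  have n3 : 0 ≤ (1 + ‖t‖) ^ (-(1 + b - a)) := by positivity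
  rw [show a - 1 = -(1 - a) by ring]
  by_cases c1 : |t| ≤ 1 / 2
  · have e1 := kk_bound hb0 c1
    have e2 : |1 - t| ^ (-(1 - a)) ≤ 2 * 1 ^ (-(1 - a)) :=
      rpow_neg_le (by linarith) (by linarith) (by norm_num) one_pos (by
        have := abs_sub_abs_le_abs_sub 1 t
        rw [abs_one] at this
        linarith)
    rw [Real.one_rpow] at e2
    have := mul_le_mul e2 e1 (by positivity) (by positivity)
    linarith
  by_cases c2 : |1 - t| ≤ 1 / 2
  · have e1 := kk_bound (c := 1 - a) (by linarith) c2
    have e2 : |t| ^ (-b) ≤ 2 * 1 ^ (-b) :=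
      rpow_neg_le (by linarith) (by linarith) (by norm_num) one_pos (by linarith)
    rw [Real.one_rpow] at e2
    have := mul_le_mul e1 e2 (by positivity) (by positivity)
    linarith
  · rw [not_le] at c1 c2
    have hp : 0 < 1 + |t| := by positivity
    have e1 : |1 - t| ^ (-(1 - a)) ≤ 5 * (1 + |t|) ^ (-(1 - a)) := by
      refine rpow_neg_le (by linarith) (by linarith) (by norm_num) hp ?_
      have := abs_sub_abs_le_abs_sub t 1
      rw [abs_one, abs_sub_comm] at this
      by_cases c3 : |t| ≤ 3 / 2 <;> linarith
    have e2 : |t| ^ (-b) ≤ 3 * (1 + |t|) ^ (-b) := by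
      refine rpow_neg_le (by linarith) (by linarith) (by norm_num) hp ?_
      linarith
    have := mul_le_mul e1 e2 (by positivity) (by positivity)
    have e3 : (1 + ‖t‖) ^ (-(1 + b - a)) = (1 + |t|) ^ (-(1 - a)) * (1 + |t|) ^ (-b) := by
      rw [← Real.rpow_add hp, Real.norm_eq_abs]
      congr 1; ring
    rw [e3]
    linarith

lemma kernel_pi (n : ℕ) (a : ℝ) (b : Fin n → ℝ) (ha : 0 < a) (hab : ∀ i, a < b i) (hb : ∀ i, b i < 1) :
    ∫⁻ t : Fin n → ℝ, (∏ i, ENNReal.ofReal (|1 - t i| ^ (a - 1))) *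
      (∏ i, ENNReal.ofReal (|t i| ^ (-b i))) < ∞ := by
  have h := Integrable.fintype_prod (ι := Fin n) (E := ℝ) (μ := fun _ => volume)
    (f := fun i (t : ℝ) => |1 - t| ^ (a - 1) * |t| ^ (-b i)) fun i => kernel_int ha (hab i) (hb i)
  refine lt_of_le_of_lt (lintegral_mono fun t => ?_) h.2
  rw [← Finset.prod_mul_distrib, ← ofReal_norm, Real.norm_of_nonneg
    (Finset.prod_nonneg fun i _ => by positivity), ENNReal.ofReal_prod_of_nonneg 
    (fun i _ => by positivity)]
  refine Finset.prod_le_prod' fun i _ => ?_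
  rw [ENNReal.ofReal_mul (by positivity)]

lemma gamma_integrable {a r : ℝ} (ha : 0 < a) (hr : 0 < r) :
    IntegrableOn (fun t : ℝ => t ^ (a - 1) * Real.exp (-(r * t))) (Ioi 0) := by
  refine not_imp_comm.1 integral_undef ?_
  rw [integral_rpow_mul_exp_neg_mul_Ioi ha hr]
  have := Real.Gamma_pos_of_pos ha
  positivity

/-- `∫ t^{-β-1} e^{-1/(4t)} dt < ∞`. -/
lemma inv_gamma_fin {β : ℝ} (hβ : 0 < β) :
    ∫⁻ t in Ioi (0:ℝ), ENNReal.ofReal (t ^ (-β - 1) * Real.exp (-(1 / (4 * t)))) < ∞ := by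
  have h := (integrableOn_Ioi_comp_rpow_iff' _ (p := -1) (by norm_num)).mpr
    (gamma_integrable hβ (show (0:ℝ) < 1 / 4 by norm_num))
  refine lt_of_le_of_lt (setLIntegral_mono_ae' measurableSet_Ioi 
    (Filter.Eventually.of_forall fun t ht => ?_)) h.2
  have ht' : 0 < t := ht
  refine (Real.ofReal_le_enorm _).trans (le_of_eq ?_)
  congr 1
  beta_reduce
  rw [smul_eq_mul, ← Real.rpow_mul ht'.le, ← mul_assoc, ← Real.rpow_add ht', Real.rpow_neg_one]
  congr 2
  · ring
  · field_simp

lemma inv_gamma_scale {β : ℝ} {r : ℝ} (hr : 0 < r) :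
    ∫⁻ t in Ioi (0:ℝ), ENNReal.ofReal (t ^ (-β - 1) * Real.exp (-(r / (4 * t)))) =
    ENNReal.ofReal (r ^ (-β)) * 
      ∫⁻ t in Ioi (0:ℝ), ENNReal.ofReal (t ^ (-β - 1) * Real.exp (-(1 / (4 * t)))) := by
  have h := lintegral_Ioi_scale (fun t => ENNReal.ofReal (t ^ (-β - 1) * Real.exp (-(1 / (4 * t)))))
    (by fun_prop) (inv_pos.mpr hr)
  rw [inv_inv] at h
  have h2 : ∀ t ∈ Ioi (0:ℝ), ENNReal.ofReal (t ^ (-β - 1) * Real.exp (-(r / (4 * t)))) =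
      ENNReal.ofReal (r ^ (-β - 1)) * 
      (fun t => ENNReal.ofReal (t ^ (-β - 1) * Real.exp (-(1 / (4 * t))))) (r⁻¹ * t) := by
    intro t ht
    have ht' : 0 < t := ht
    dsimp only
    rw [← ENNReal.ofReal_mul (by positivity), Real.mul_rpow (by positivity) ht'.le, 
      Real.inv_rpow hr.le, ← mul_assoc, ← mul_assoc, mul_inv_cancel₀ (by positivity), one_mul]
    congr 4
    field_simp
  rw [setLIntegral_congr_fun measurableSet_Ioi h2, lintegral_const_mul' _ _ ENNReal.ofReal_ne_top]
  refine (congrArg _ h).trans ?_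
  rw [← mul_assoc, ← ENNReal.ofReal_mul (by positivity)]
  congr 2
  nth_rewrite 2 [← Real.rpow_one r]
  rw [← Real.rpow_add hr]
  congr 1; ring
section DD
open scoped FourierTransform RealInnerProductSpace

/-- the normalising constant -/
def cn (n : ℕ) : ℝ := (2 * π) ^ (-(n : ℝ) / 2)

lemma cn_pos (n : ℕ) : 0 < cn n := by unfold cn; positivity

lemma cn_sq (n : ℕ) : cn n * cn n * (2 * π) ^ n = 1 := by
  unfold cn
  rw [← Real.rpow_natCast, ← Real.rpow_add (by positivity), ← Real.rpow_add (by positivity)]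
  rw [show -(n:ℝ) / 2 + -(n:ℝ) / 2 + n = 0 by ring, Real.rpow_zero]

/-- Schwartz function on Euclidean space -/
def toE (n : ℕ) (f : SchwartzMap (Fin n → ℝ) ℂ) : SchwartzMap (EuclideanSpace ℝ (Fin n)) ℂ :=
  SchwartzMap.compCLMOfContinuousLinearEquiv ℂ (EuclideanSpace.equiv (Fin n) ℝ) f

lemma ft_eq (n : ℕ) (f : SchwartzMap (Fin n → ℝ) ℂ) (ξ : Fin n → ℝ) :
    ft n f ξ = cn n * (𝓕 (toE n f)) (WithLp.toLp 2 ((2 * π)⁻¹ • ξ)) := by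
  unfold ft
  rw [SchwartzMap.fourier_coe, Real.fourier_eq']
  rw [← (PiLp.volume_preserving_toLp (Fin n)).integral_comp
    (MeasurableEquiv.toLp 2 _).measurableEmbedding]
  unfold cn
  congr 1
  refine integral_congr_ae (Filter.Eventually.of_forall fun x => ?_)
  simp only [smul_eq_mul]
  have e2 : toE n f (WithLp.toLp 2 x) = f x := rfl
  rw [e2]
  congr 2
  simp only [PiLp.inner_apply, RCLike.inner_apply, conj_trivial, Pi.smul_apply, smul_eq_mul]
  have : (-2 * π * ∑ i, (2 * π)⁻¹ * ξ i * x i : ℝ) = - ∑ i, ξ i * x i := by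
    rw [Finset.mul_sum, ← Finset.sum_neg_distrib]
    refine Finset.sum_congr rfl fun i _ => ?_
    field_simp
  rw [this]
  push_cast
  ring

/-- the Fourier transform as a Schwartz function on `Fin n → ℝ` -/
lemma ft_schwartz (n : ℕ) (f : SchwartzMap (Fin n → ℝ) ℂ) :
    ∃ φ : SchwartzMap (Fin n → ℝ) ℂ, ∀ ξ, φ ξ = ft n f ξ := by
  let L : (Fin n → ℝ) ≃L[ℝ] EuclideanSpace ℝ (Fin n) :=
    (ContinuousLinearEquiv.smulLeft (R₁ := ℝ) (Units.mk0 ((2 * π)⁻¹ : ℝ) (by positivity))).trans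
      (EuclideanSpace.equiv (Fin n) ℝ).symm
  refine ⟨(cn n : ℂ) • SchwartzMap.compCLMOfContinuousLinearEquiv ℂ L (𝓕 (toE n f)), fun ξ => ?_⟩
  rw [ft_eq]
  rfl

lemma ft_inversion (n : ℕ) (f : SchwartzMap (Fin n → ℝ) ℂ) (x : Fin n → ℝ) :
    f x = cn n * ∫ ξ : Fin n → ℝ, Complex.exp (Complex.I * ((∑ i, x i * ξ i : ℝ) : ℂ)) * ft n f ξ := by
  have h1 : f x = (𝓕⁻ (𝓕 (toE n f))) (WithLp.toLp 2 x) := by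
    rw [FourierTransform.fourierInv_fourier_eq]
    rfl
  rw [SchwartzMap.fourierInv_coe, Real.fourierInv_eq',
    ← (PiLp.volume_preserving_toLp (Fin n)).integral_comp
    (MeasurableEquiv.toLp 2 _).measurableEmbedding] at h1
  set H : (Fin n → ℝ) → ℂ := fun η => 
    Complex.exp (↑(2 * π * (inner ℝ (WithLp.toLp 2 η : EuclideanSpace ℝ (Fin n)) (WithLp.toLp 2 x))) * Complex.I) • 
      (𝓕 (toE n f)) (WithLp.toLp 2 η) with hH
  have h2 : ∀ ξ, Complex.exp (Complex.I * ((∑ i, x i * ξ i : ℝ) : ℂ)) * ft n f ξ = 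
      cn n * H ((2 * π)⁻¹ • ξ) := by
    intro ξ
    rw [ft_eq, hH]
    simp only [smul_eq_mul]
    rw [mul_left_comm]
    congr 3
    simp only [PiLp.inner_apply, RCLike.inner_apply, conj_trivial, Pi.smul_apply, smul_eq_mul]
    have : (2 * π * ∑ i, x i * ((2 * π)⁻¹ * ξ i) : ℝ) = ∑ i, x i * ξ i := by
      rw [Finset.mul_sum]
      refine Finset.sum_congr rfl fun i _ => ?_
      field_simp
    rw [this]
    push_cast
    ring
  simp_rw [h2]
  rw [integral_const_mul, Measure.integral_comp_inv_smul, h1]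
  have hfin : Module.finrank ℝ (Fin n → ℝ) = n := by simp
  rw [hfin, abs_of_pos (by positivity)]
  change ∫ η, H η = _
  rw [Complex.real_smul, ← mul_assoc, ← mul_assoc]
  have := cn_sq n
  have h4 : ((cn n : ℝ) : ℂ) * cn n * (((2 * π) ^ n : ℝ) : ℂ) = 1 := by exact_mod_cast this
  rw [h4, one_mul]

def NN (n : ℕ) (ξ : Fin n → ℝ) : ℝ := ∑ i, ξ i ^ 2

lemma NN_nonneg (n : ℕ) (ξ : Fin n → ℝ) : 0 ≤ NN n ξ := Finset.sum_nonneg fun i _ => sq_nonneg _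

lemma NN_meas (n : ℕ) : Measurable (NN n) := by unfold NN; fun_prop

lemma symbol_int (n : ℕ) {s : ℝ} (hs : 0 < s) (φ : SchwartzMap (Fin n → ℝ) ℂ) :
    Integrable (fun ξ => ((NN n ξ ^ (s / 2) : ℝ) : ℂ) * φ ξ) := by
  obtain ⟨k, hk⟩ := exists_nat_ge s
  have h1 := (φ.integrable_pow_mul volume 0)
  have h2 := (φ.integrable_pow_mul volume k)
  refine Integrable.mono' ((h1.add h2).const_mul ((n:ℝ) ^ (s / 2))) ?_ 
    (Filter.Eventually.of_forall fun ξ => ?_)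
  · refine AEStronglyMeasurable.mul (Measurable.aestronglyMeasurable ?_) 
      φ.continuous.aestronglyMeasurable
    have := NN_meas n
    fun_prop
  · rw [norm_mul, Complex.norm_real, Real.norm_of_nonneg (Real.rpow_nonneg (NN_nonneg n ξ) _)]
    simp only [Pi.add_apply, pow_zero]
    rw [← add_mul, ← mul_assoc]
    refine mul_le_mul_of_nonneg_right ?_ (norm_nonneg _)
    have h3 : NN n ξ ≤ n * ‖ξ‖ ^ 2 := by
      calc NN n ξ ≤ ∑ _i : Fin n, ‖ξ‖ ^ 2 := by
            refine Finset.sum_le_sum fun i _ => ?_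
            rw [← sq_abs]
            exact pow_le_pow_left₀ (abs_nonneg _) (norm_le_pi_norm ξ i) 2
        _ = _ := by simp
    calc NN n ξ ^ (s / 2) ≤ (n * ‖ξ‖ ^ 2) ^ (s / 2) := 
          Real.rpow_le_rpow (NN_nonneg n ξ) h3 (by positivity)
      _ = (n:ℝ) ^ (s / 2) * ‖ξ‖ ^ s := by
          rw [Real.mul_rpow (by positivity) (by positivity), ← Real.rpow_natCast, 
            ← Real.rpow_mul (norm_nonneg _)]
          congr 2
          push_cast; ring
      _ ≤ _ := by
          refine mul_le_mul_of_nonneg_left ?_ (by positivity)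
          rcases le_total ‖ξ‖ 1 with h | h
          · have := Real.rpow_le_one (norm_nonneg ξ) h hs.le
            have : 0 ≤ ‖ξ‖ ^ k := by positivity
            linarith
          · have := Real.rpow_le_rpow_of_exponent_le h hk
            rw [Real.rpow_natCast] at this
            linarith

end DD

def ee (n : ℕ) (x ξ : Fin n → ℝ) : ℂ := Complex.exp (Complex.I * ((∑ i, x i * ξ i : ℝ) : ℂ))

lemma ee_norm (n : ℕ) (x ξ : Fin n → ℝ) : ‖ee n x ξ‖ = 1 := by
  unfold ee
  rw [mul_comm]
  exact Complex.norm_exp_ofReal_mul_I _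

lemma ee_meas (n : ℕ) : Measurable (fun z : (Fin n → ℝ) × (Fin n → ℝ) => ee n z.1 z.2) := by
  unfold ee; fun_prop

lemma ee_meas' (n : ℕ) (x : Fin n → ℝ) : Measurable (ee n x) :=
  (ee_meas n).comp measurable_prodMk_left

lemma gauss_ft (n : ℕ) {t : ℝ} (ht : 0 < t) (x ξ : Fin n → ℝ) :
    ∫ y : Fin n → ℝ, (Real.exp (-(NN n (x - y) / (4 * t))) : ℂ) * ee n y ξ = 
    (((4 * π * t) ^ ((n:ℝ) / 2) : ℝ) : ℂ) * (Real.exp (-(NN n ξ * t)) * ee n x ξ) := by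
  have h := GaussianFourier.integral_cexp_neg_mul_sum_add (b := ((1 / (4 * t) : ℝ) : ℂ)) (ι := Fin n)
    (by rw [Complex.ofReal_re]; positivity) (fun i => Complex.I * (ξ i : ℂ))
  have h1 : ∫ y : Fin n → ℝ, (Real.exp (-(NN n (x - y) / (4 * t))) : ℂ) * ee n y ξ =
     ∫ y : Fin n → ℝ, (fun y => (Real.exp (-(NN n (-y) / (4 * t))) : ℂ) * ee n (y + x) ξ) (y - x) := by
    refine integral_congr_ae (Filter.Eventually.of_forall fun y => ?_)
    simp
  rw [h1, integral_sub_right_eq_self (fun y => (Real.exp (-(NN n (-y) / (4 * t))) : ℂ) * ee n (y + x) ξ)]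
  have h2 : ∀ y : Fin n → ℝ, (Real.exp (-(NN n (-y) / (4 * t))) : ℂ) * ee n (y + x) ξ = 
      ee n x ξ * Complex.exp (-((1 / (4 * t) : ℝ) : ℂ) * ∑ i, (y i : ℂ) ^ 2 + ∑ i, Complex.I * (ξ i : ℂ) * y i) := by
    intro y
    unfold ee NN
    rw [Complex.ofReal_exp, ← Complex.exp_add, ← Complex.exp_add]
    congr 1
    push_cast
    simp only [Pi.add_apply, Pi.neg_apply, Complex.ofReal_add, Complex.ofReal_neg, add_mul,
      Finset.sum_add_distrib, mul_add, Finset.mul_sum, even_two.neg_pow, Finset.sum_div]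
    rw [show ∑ i, Complex.I * (ξ i:ℂ) * (y i:ℂ) = ∑ i, Complex.I * ((y i:ℂ) * (ξ i:ℂ)) from
      Finset.sum_congr rfl fun i _ => by ring]
    rw [← Finset.sum_neg_distrib, show ∑ i, -((y i:ℂ) ^ 2 / (4 * (t:ℂ))) = ∑ i, -(1 / (4 * (t:ℂ))) * (y i:ℂ) ^ 2 from
      Finset.sum_congr rfl fun i _ => by ring]
    ring
  simp_rw [h2]
  rw [integral_const_mul, h]
  have h3 : ((π:ℂ) / ((1 / (4 * t) : ℝ) : ℂ)) ^ ((Fintype.card (Fin n) : ℂ) / 2) = 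
      (((4 * π * t) ^ ((n:ℝ) / 2) : ℝ) : ℂ) := by
    rw [Complex.ofReal_cpow (by positivity)]
    have ht' : (t : ℂ) ≠ 0 := by exact_mod_cast ht.ne'
    congr 1
    · push_cast; field_simp
    · simp
  have h4 : Complex.exp ((∑ i, (Complex.I * (ξ i : ℂ)) ^ 2) / (4 * ((1 / (4 * t) : ℝ) : ℂ))) = 
      Real.exp (-(NN n ξ * t)) := by
    have ht' : (t : ℂ) ≠ 0 := by exact_mod_cast ht.ne'
    rw [Complex.ofReal_exp]
    congr 1
    unfold NN
    simp only [mul_pow, Complex.I_sq, ← Finset.mul_sum]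
    push_cast
    field_simp
  rw [h3, h4]
  ring

lemma gauss_int (n : ℕ) {t : ℝ} (ht : 0 < t) (x : Fin n → ℝ) :
    Integrable (fun y : Fin n → ℝ => Real.exp (-(NN n (x - y) / (4 * t)))) := by
  have h := GaussianFourier.integrable_cexp_neg_mul_sum_add (b := ((1 / (4 * t) : ℝ) : ℂ)) (ι := Fin n)
    (by rw [Complex.ofReal_re]; positivity) (fun i => 0)
  have h2 : Integrable (fun y : Fin n → ℝ => Real.exp (-(NN n y / (4 * t)))) := by
    refine h.norm.congr (Filter.Eventually.of_forall fun y => ?_)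
    simp only [zero_mul, Finset.sum_const_zero, add_zero]
    have : (-((1 / (4 * t) : ℝ) : ℂ) * ∑ i, (y i : ℂ) ^ 2) = ((-(NN n y / (4 * t)) : ℝ) : ℂ) := by
      unfold NN
      push_cast
      ring
    rw [this, Complex.norm_exp_ofReal]
  exact h2.comp_sub_left x

lemma heat_eq (n : ℕ) {t : ℝ} (ht : 0 < t) (x : Fin n → ℝ) (m : (Fin n → ℝ) → ℂ)
    (hm : Integrable m) :
    (((4 * π * t) ^ ((n:ℝ) / 2) : ℝ) : ℂ) * ∫ ξ, Real.exp (-(NN n ξ * t)) * ee n x ξ * m ξ = 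
      ∫ y : Fin n → ℝ, (Real.exp (-(NN n (x - y) / (4 * t))) : ℂ) * ∫ ξ, ee n y ξ * m ξ := by
  have hF : Integrable (Function.uncurry fun (y ξ : Fin n → ℝ) => 
      ((Real.exp (-(NN n (x - y) / (4 * t))) : ℂ) * ee n y ξ * m ξ)) (volume.prod volume) := by
    have h0 := (gauss_int n ht x).ofReal (𝕜 := ℂ) |>.mul_prod hm
    refine h0.mono ?_ (Filter.Eventually.of_forall fun z => ?_)
    · have e1 : AEStronglyMeasurable (fun z : (Fin n → ℝ) × (Fin n → ℝ) => m z.2) 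
        (volume.prod volume) := hm.1.comp_snd
      have e2 := (ee_meas n).aestronglyMeasurable (μ := volume.prod volume)
      have e3 : Measurable (fun z : (Fin n → ℝ) × (Fin n → ℝ) => (Real.exp (-(NN n (x - z.1) / (4 * t))) : ℂ)) := by
        have := NN_meas n
        fun_prop
      exact (e3.aestronglyMeasurable.mul e2).mul e1
    · simp only [Function.uncurry, norm_mul, ee_norm, mul_one]
      exact le_rfl
  rw [← integral_const_mul]
  calc ∫ ξ, (((4 * π * t) ^ ((n:ℝ) / 2) : ℝ) : ℂ) * (Real.exp (-(NN n ξ * t)) * ee n x ξ * m ξ)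
      = ∫ ξ, ∫ y : Fin n → ℝ, (Real.exp (-(NN n (x - y) / (4 * t))) : ℂ) * ee n y ξ * m ξ := by
        refine integral_congr_ae (Filter.Eventually.of_forall fun ξ => ?_)
        beta_reduce
        rw [integral_mul_const, gauss_ft n ht]
        ring
    _ = ∫ y : Fin n → ℝ, ∫ ξ, (Real.exp (-(NN n (x - y) / (4 * t))) : ℂ) * ee n y ξ * m ξ :=
        (integral_integral_swap hF).symm
    _ = _ := by
        refine integral_congr_ae (Filter.Eventually.of_forall fun y => ?_)
        beta_reduce
        rw [← integral_const_mul]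
        simp_rw [mul_assoc]

lemma fracLap_eq (n : ℕ) (s : ℝ) (f : (Fin n → ℝ) → ℂ) (y : Fin n → ℝ) :
    fracLap n s f y = cn n * ∫ ξ, ee n y ξ * (((NN n ξ ^ (s / 2) : ℝ) : ℂ) * ft n f ξ) := by
  unfold fracLap fracLapOn
  conv_lhs => unfold ft
  unfold cn
  congr 1
  refine integral_congr_ae (Filter.Eventually.of_forall fun ξ => ?_)
  unfold ee NN
  beta_reduce
  congr 2
  simp

lemma fracLap_meas (n : ℕ) (s : ℝ) (f : SchwartzMap (Fin n → ℝ) ℂ) : 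
    Measurable (fracLap n s f) := by
  obtain ⟨φ, hφ⟩ := ft_schwartz n f
  have : fracLap n s f = fun y => cn n * ∫ ξ, ee n y ξ * (((NN n ξ ^ (s / 2) : ℝ) : ℂ) * φ ξ) := by
    funext y
    rw [fracLap_eq]
    simp_rw [hφ]
  rw [this]
  have h1 := NN_meas n
  have h2 := ee_meas n
  have h3 := φ.continuous.measurable
  have : StronglyMeasurable fun y => ∫ ξ, ee n y ξ * (((NN n ξ ^ (s / 2) : ℝ) : ℂ) * φ ξ) := by
    refine StronglyMeasurable.integral_prod_right' (f := fun z : (Fin n → ℝ) × (Fin n → ℝ) =>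
      ee n z.1 z.2 * (((NN n z.2 ^ (s / 2) : ℝ) : ℂ) * φ z.2)) ?_
    refine Measurable.stronglyMeasurable ?_
    fun_prop
  exact this.measurable.const_mul _

lemma NN_pos (n : ℕ) {ξ : Fin n → ℝ} {i : Fin n} (h : ξ i ≠ 0) : 0 < NN n ξ :=
  lt_of_lt_of_le (by positivity) (Finset.single_le_sum (f := fun i => ξ i ^ 2) 
    (fun i _ => sq_nonneg _) (Finset.mem_univ i))

lemma riesz_repr (n : ℕ) (hn : 1 ≤ n) {s : ℝ} (hs : 0 < s) (f : SchwartzMap (Fin n → ℝ) ℂ)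
    (x : Fin n → ℝ) :
    ENNReal.ofReal (Real.Gamma (s / 2)) * ‖f x‖ₑ ≤ ∫⁻ t in Ioi (0:ℝ), 
      ENNReal.ofReal (t ^ (s / 2 - 1) * (4 * π * t) ^ (-((n:ℝ) / 2))) * 
      ∫⁻ y : Fin n → ℝ, ENNReal.ofReal (Real.exp (-(NN n (x - y) / (4 * t)))) * ‖fracLap n s f y‖ₑ := by
  obtain ⟨φ, hφ⟩ := ft_schwartz n f
  have hs2 : 0 < s / 2 := by positivity
  set G := Real.Gamma (s / 2) with hG
  have hGp : 0 < G := Real.Gamma_pos_of_pos hs2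
  have hNm := NN_meas n
  have hae : ∀ᵐ ξ : Fin n → ℝ, 0 < NN n ξ := by
    have := Measure.ae_eval_ne (μ := fun _ : Fin n => (volume : Measure ℝ)) ⟨0, hn⟩ 0
    filter_upwards [this] with ξ hξ
    exact NN_pos n hξ
  set m : (Fin n → ℝ) → ℂ := fun ξ => ((NN n ξ ^ (s / 2) : ℝ) : ℂ) * φ ξ with hm
  have hmi : Integrable m := symbol_int n hs φ
  let w : (Fin n → ℝ) → ℝ → ℝ := fun ξ t => t ^ (s / 2 - 1) * Real.exp (-(NN n ξ * t))
  let K : (Fin n → ℝ) → ℝ → ℂ := fun ξ t => (w ξ t : ℂ) * (ee n x ξ * m ξ)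
  have hw : ∀ ξ, 0 < NN n ξ → ∫ t in Ioi (0:ℝ), w ξ t = (NN n ξ ^ (s / 2))⁻¹ * G := by
    intro ξ hξ
    simp only [w]
    rw [integral_rpow_mul_exp_neg_mul_Ioi hs2 hξ, one_div, Real.inv_rpow hξ.le]
  have hwi : ∀ ξ, 0 < NN n ξ → IntegrableOn (w ξ) (Ioi 0) := fun ξ hξ => gamma_integrable hs2 hξ
  have hKm : AEStronglyMeasurable (Function.uncurry K) (volume.prod (volume.restrict (Ioi (0:ℝ)))) := by
    refine Measurable.aestronglyMeasurable ?_
    have h2 := ee_meas' n x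
    have h3 := φ.continuous.measurable
    simp only [K, w, m, Function.uncurry_def]
    fun_prop
  have hKi : Integrable (Function.uncurry K) (volume.prod (volume.restrict (Ioi (0:ℝ)))) := by
    rw [integrable_prod_iff hKm]
    constructor
    · filter_upwards [hae] with ξ hξ
      show Integrable (fun t => (w ξ t : ℂ) * (ee n x ξ * m ξ)) (volume.restrict (Ioi (0:ℝ)))
      exact Integrable.mul_const (Integrable.ofReal (𝕜 := ℂ) (hwi ξ hξ)) (ee n x ξ * m ξ)
    · refine (φ.integrable.norm.const_mul G).congr ?_
      filter_upwards [hae] with ξ hξ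
      have e : ∀ t ∈ Ioi (0:ℝ), ‖Function.uncurry K (ξ, t)‖ = w ξ t * ‖m ξ‖ := by
        intro t ht
        have : 0 ≤ w ξ t := by
          have : (0:ℝ) < t := ht
          simp only [w]; positivity
        simp only [Function.uncurry, K, norm_mul, ee_norm, one_mul, Complex.norm_real]
        rw [Real.norm_of_nonneg this]
      rw [setIntegral_congr_fun measurableSet_Ioi e, integral_mul_const, hw ξ hξ, hm]
      have : 0 < NN n ξ ^ (s / 2) := by positivity
      simp only [norm_mul, Complex.norm_real]
      rw [Real.norm_of_nonneg this.le]
      field_simp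
  have h1 : (G : ℂ) * f x = cn n * ∫ ξ, ∫ t in Ioi (0:ℝ), K ξ t := by
    rw [ft_inversion n f x, mul_left_comm, ← integral_const_mul]
    congr 1
    refine integral_congr_ae ?_
    filter_upwards [hae] with ξ hξ
    simp only [K]
    rw [integral_mul_const, integral_complex_ofReal, hw ξ hξ, ← hφ, hm]
    have h0 : 0 < NN n ξ ^ (s / 2) := by positivity
    have : ((NN n ξ ^ (s / 2) : ℝ) : ℂ) ≠ 0 := by exact_mod_cast h0.ne'
    rw [show Complex.exp (Complex.I * ((∑ i, x i * ξ i : ℝ) : ℂ)) = ee n x ξ from rfl]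
    push_cast at this ⊢
    field_simp
  rw [integral_integral_swap hKi, ← integral_const_mul] at h1
  have h2 : ENNReal.ofReal G * ‖f x‖ₑ = ‖(G : ℂ) * f x‖ₑ := by
    rw [enorm_mul]
    congr 1
    rw [← ofReal_norm, Complex.norm_real, Real.norm_of_nonneg hGp.le]
  rw [h2, h1]
  refine (enorm_integral_le_lintegral_enorm _).trans ?_
  refine setLIntegral_mono_ae' measurableSet_Ioi (Filter.Eventually.of_forall fun t ht => ?_)
  have ht' : 0 < t := ht
  have h3 : cn n * ∫ ξ, K ξ t = ((t ^ (s / 2 - 1) * (4 * π * t) ^ (-((n:ℝ) / 2)) : ℝ) : ℂ) * 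
      ∫ y : Fin n → ℝ, (Real.exp (-(NN n (x - y) / (4 * t))) : ℂ) * fracLap n s f y := by
    have e1 : ∫ ξ, K ξ t = ((t ^ (s / 2 - 1) : ℝ) : ℂ) * 
        ∫ ξ, Real.exp (-(NN n ξ * t)) * ee n x ξ * m ξ := by
      rw [← integral_const_mul]
      refine integral_congr_ae (Filter.Eventually.of_forall fun ξ => ?_)
      simp only [K, w]
      push_cast
      ring
    have e2 := heat_eq n ht' x m hmi
    have e3 : ∀ y, fracLap n s f y = cn n * ∫ ξ, ee n y ξ * m ξ := by
      intro y
      rw [fracLap_eq]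
      simp_rw [hm, hφ]
    simp_rw [e3]
    have e4 : ∫ y : Fin n → ℝ, (Real.exp (-(NN n (x - y) / (4 * t))) : ℂ) * (cn n * ∫ ξ, ee n y ξ * m ξ) =
        cn n * ((((4 * π * t) ^ ((n:ℝ) / 2) : ℝ) : ℂ) * ∫ ξ, Real.exp (-(NN n ξ * t)) * ee n x ξ * m ξ) := by
      rw [e2, ← integral_const_mul]
      refine integral_congr_ae (Filter.Eventually.of_forall fun ξ => ?_)
      beta_reduce
      ring
    rw [e4, e1, Real.rpow_neg (by positivity)]
    have h0 : 0 < (4 * π * t) ^ ((n:ℝ) / 2) := by positivity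
    have : (((4 * π * t) ^ ((n:ℝ) / 2) : ℝ) : ℂ) ≠ 0 := by exact_mod_cast h0.ne'
    rw [Complex.ofReal_mul, Complex.ofReal_inv]
    generalize (∫ ξ, (Real.exp (-(NN n ξ * t)) : ℂ) * ee n x ξ * m ξ) = J
    generalize (((4 * π * t) ^ ((n:ℝ) / 2) : ℝ) : ℂ) = P at this ⊢
    generalize ((t ^ (s / 2 - 1) : ℝ) : ℂ) = T
    field_simp
  rw [h3, enorm_mul]
  refine mul_le_mul' (le_of_eq ?_) ((enorm_integral_le_lintegral_enorm _).trans (le_of_eq ?_))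
  · rw [← ofReal_norm, Complex.norm_real, Real.norm_of_nonneg (by positivity)]
  · refine lintegral_congr fun y => ?_
    rw [enorm_mul]
    congr 1
    rw [← ofReal_norm, Complex.norm_real, Real.norm_of_nonneg (by positivity)]

lemma NN_rpow_le (n : ℕ) (hn : 1 ≤ n) {s : ℝ} (hsn : s < n) (z : Fin n → ℝ) (hz : ∀ i, z i ≠ 0) :
    NN n z ^ (-(((n:ℝ) - s) / 2)) ≤ ∏ i, |z i| ^ (s / n - 1) := by
  have hpos : 0 < NN n z := NN_pos n (hz ⟨0, hn⟩)
  have hn0 : (0:ℝ) < n := by exact_mod_cast hn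
  have h1 : ∀ i, (NN n z ^ ((1:ℝ) / 2)) ^ (s / n - 1) ≤ |z i| ^ (s / n - 1) := by
    intro i
    refine Real.rpow_le_rpow_of_nonpos (abs_pos.mpr (hz i)) ?_ ?_
    · rw [← Real.sqrt_eq_rpow]
      refine Real.abs_le_sqrt ?_
      exact Finset.single_le_sum (f := fun i => z i ^ 2) (fun i _ => sq_nonneg _) (Finset.mem_univ i)
    · have : s / n < 1 := by rw [div_lt_one hn0]; exact hsn
      linarith
  refine le_trans (le_of_eq ?_) (Finset.prod_le_prod (fun i _ => by positivity) fun i _ => h1 i)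
  rw [Finset.prod_const, Finset.card_univ, Fintype.card_fin, ← Real.rpow_mul hpos.le,
    ← Real.rpow_natCast, ← Real.rpow_mul hpos.le]
  congr 1
  field_simp
  ring

lemma riesz_prod (n : ℕ) (hn : 1 ≤ n) {s : ℝ} (hs : 0 < s) (hsn : s < n) :
    ∃ C : ℝ≥0∞, C ≠ 0 ∧ C ≠ ∞ ∧ ∀ (f : SchwartzMap (Fin n → ℝ) ℂ) (x : Fin n → ℝ),
      ‖f x‖ₑ ≤ C * ∫⁻ y : Fin n → ℝ, (∏ i, ENNReal.ofReal (|x i - y i| ^ (s / n - 1))) *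
        ‖fracLap n s f y‖ₑ := by
  set β : ℝ := ((n:ℝ) - s) / 2 with hβd
  have hβ : 0 < β := by rw [hβd]; linarith
  set I := ∫⁻ t in Ioi (0:ℝ), ENNReal.ofReal (t ^ (-β - 1) * Real.exp (-(1 / (4 * t)))) with hI
  have hIf : I < ∞ := inv_gamma_fin hβ
  set G := Real.Gamma (s / 2) with hG
  have hGp : 0 < G := Real.Gamma_pos_of_pos (by positivity)
  set D : ℝ≥0∞ := ENNReal.ofReal ((4 * π) ^ (-((n:ℝ) / 2))) * I with hD
  have hDf : D ≠ ∞ := ENNReal.mul_ne_top ENNReal.ofReal_ne_top hIf.ne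
  have hG0 : ENNReal.ofReal G ≠ 0 := by simpa using hGp
  refine ⟨(ENNReal.ofReal G)⁻¹ * D + 1, by simp, ?_, fun f x => ?_⟩
  · exact ENNReal.add_ne_top.mpr ⟨ENNReal.mul_ne_top (ENNReal.inv_ne_top.mpr hG0) hDf, by simp⟩
  set P := ∫⁻ y : Fin n → ℝ, (∏ i, ENNReal.ofReal (|x i - y i| ^ (s / n - 1))) *
        ‖fracLap n s f y‖ₑ with hP
  have hgm0 := fracLap_meas n s f
  have hgm := (fracLap_meas n s f).enorm
  have hNm := NN_meas n
  have key : ENNReal.ofReal G * ‖f x‖ₑ ≤ D * P := by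
    refine (riesz_repr n hn hs f x).trans ?_
    have e1 : ∀ t : ℝ, ENNReal.ofReal (t ^ (s / 2 - 1) * (4 * π * t) ^ (-((n:ℝ) / 2))) * 
      ∫⁻ y : Fin n → ℝ, ENNReal.ofReal (Real.exp (-(NN n (x - y) / (4 * t)))) * ‖fracLap n s f y‖ₑ =
      ∫⁻ y : Fin n → ℝ, ENNReal.ofReal (t ^ (s / 2 - 1) * (4 * π * t) ^ (-((n:ℝ) / 2))) * 
        (ENNReal.ofReal (Real.exp (-(NN n (x - y) / (4 * t)))) * ‖fracLap n s f y‖ₑ) := by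
      intro t
      rw [lintegral_const_mul]
      fun_prop
    simp_rw [e1]
    rw [lintegral_lintegral_swap (by
      refine Measurable.aemeasurable ?_
      simp only [Function.uncurry_def]
      fun_prop), hP, ← lintegral_const_mul' _ _ hDf]
    have hae : ∀ᵐ y : Fin n → ℝ, ∀ i, y i ≠ x i := by
      rw [ae_all_iff]
      intro i
      exact Measure.ae_eval_ne (μ := fun _ : Fin n => (volume : Measure ℝ)) i (x i)
    refine lintegral_mono_ae ?_
    filter_upwards [hae] with y hy
    have hz : ∀ i, (x - y) i ≠ 0 := fun i => sub_ne_zero.mpr (hy i).symm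
    have hpos : 0 < NN n (x - y) := NN_pos n (hz ⟨0, hn⟩)
    have e2 : ∫⁻ t in Ioi (0:ℝ), ENNReal.ofReal (t ^ (s / 2 - 1) * (4 * π * t) ^ (-((n:ℝ) / 2))) * 
        (ENNReal.ofReal (Real.exp (-(NN n (x - y) / (4 * t)))) * ‖fracLap n s f y‖ₑ) =
        (ENNReal.ofReal ((4 * π) ^ (-((n:ℝ) / 2))) * ‖fracLap n s f y‖ₑ) * 
        ∫⁻ t in Ioi (0:ℝ), ENNReal.ofReal (t ^ (-β - 1) * Real.exp (-(NN n (x - y) / (4 * t)))) := by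
      rw [← lintegral_const_mul' _ _ (ENNReal.mul_ne_top ENNReal.ofReal_ne_top enorm_ne_top)]
      refine setLIntegral_congr_fun measurableSet_Ioi fun t ht => ?_
      have ht' : 0 < t := ht
      beta_reduce
      have e3 : t ^ (s / 2 - 1) * (4 * π * t) ^ (-((n:ℝ) / 2)) = 
          (4 * π) ^ (-((n:ℝ) / 2)) * t ^ (-β - 1) := by
        rw [Real.mul_rpow (by positivity) ht'.le, mul_left_comm, ← Real.rpow_add ht']
        congr 2
        rw [hβd]; ring
      rw [e3, ENNReal.ofReal_mul (by positivity), ENNReal.ofReal_mul (p := t ^ (-β - 1)) (by positivity)]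
      ring
    rw [e2, inv_gamma_scale hpos, ← hI]
    have e4 : ENNReal.ofReal (NN n (x - y) ^ (-β)) ≤ ∏ i, ENNReal.ofReal (|x i - y i| ^ (s / n - 1)) := by
      rw [← ENNReal.ofReal_prod_of_nonneg (fun i _ => by positivity)]
      exact ENNReal.ofReal_le_ofReal (NN_rpow_le n hn hsn (x - y) hz)
    calc _ = D * (ENNReal.ofReal (NN n (x - y) ^ (-β)) * ‖fracLap n s f y‖ₑ) := by rw [hD]; ring
      _ ≤ _ := by gcongr
  calc ‖f x‖ₑ = (ENNReal.ofReal G)⁻¹ * (ENNReal.ofReal G * ‖f x‖ₑ) := by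
        rw [← mul_assoc, ENNReal.inv_mul_cancel hG0 ENNReal.ofReal_ne_top, one_mul]
    _ ≤ (ENNReal.ofReal G)⁻¹ * (D * P) := by gcongr
    _ = ((ENNReal.ofReal G)⁻¹ * D) * P := by ring
    _ ≤ _ := by gcongr; exact le_self_add

lemma lintegral_diag (n : ℕ) (x : Fin n → ℝ) (hx : ∀ i, x i ≠ 0) (F : (Fin n → ℝ) → ℝ≥0∞)
    (hF : Measurable F) :
    ∫⁻ y, F y = ENNReal.ofReal (∏ i, |x i|) * ∫⁻ τ : Fin n → ℝ, F (fun i => x i * τ i) := by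
  have hd : (Matrix.diagonal x).det ≠ 0 := by
    rw [Matrix.det_diagonal]; exact Finset.prod_ne_zero_iff.mpr fun i _ => hx i
  have h := Real.smul_map_diagonal_volume_pi hd
  conv_lhs => rw [← h]
  rw [lintegral_smul_measure, lintegral_map hF (by
    have : Continuous (Matrix.toLin' (Matrix.diagonal x)) := LinearMap.continuous_of_finiteDimensional _
    exact this.measurable), Matrix.det_diagonal, Finset.abs_prod, smul_eq_mul]
  congr 1
  refine lintegral_congr fun τ => ?_
  congr 1
  funext i
  simp [Matrix.mulVec_diagonal]

lemma pointwise_bound (n : ℕ) (hn : 1 ≤ n) {s : ℝ} (hs : 0 < s) (hsn : s < n) :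
    ∃ C : ℝ≥0∞, C ≠ 0 ∧ C ≠ ∞ ∧ ∀ (f : SchwartzMap (Fin n → ℝ) ℂ) (x : Fin n → ℝ),
      ‖f x / (((∏ i, |x i| ^ (s / (n : ℝ))) : ℝ) : ℂ)‖ₑ ≤ 
      C * ∫⁻ τ : Fin n → ℝ, (∏ i, ENNReal.ofReal (|1 - τ i| ^ (s / n - 1))) *
        ‖fracLap n s f (fun i => τ i * x i)‖ₑ := by
  obtain ⟨C, hC0, hC, h⟩ := riesz_prod n hn hs hsn
  have hn0 : (0:ℝ) < n := by exact_mod_cast hn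
  refine ⟨C, hC0, hC, fun f x => ?_⟩
  by_cases hx : ∀ i, x i ≠ 0
  swap
  · push Not at hx
    obtain ⟨i, hi⟩ := hx
    have : ∏ i, |x i| ^ (s / (n : ℝ)) = 0 := Finset.prod_eq_zero (Finset.mem_univ i) (by
      rw [hi, abs_zero, Real.zero_rpow (by positivity)])
    rw [this]
    simp
  have hW : 0 < ∏ i, |x i| ^ (s / (n : ℝ)) := 
    Finset.prod_pos fun i _ => Real.rpow_pos_of_pos (abs_pos.mpr (hx i)) _
  have hgm := (fracLap_meas n s f).enorm
  set W := ∏ i, |x i| ^ (s / (n : ℝ)) with hWd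
  have h1 := h f x
  rw [lintegral_diag n x hx _ (by fun_prop)] at h1
  have e1 : ∀ τ : Fin n → ℝ, (∏ i, ENNReal.ofReal (|x i - x i * τ i| ^ (s / n - 1))) = 
      ENNReal.ofReal (∏ i, |x i| ^ (s / n - 1)) * ∏ i, ENNReal.ofReal (|1 - τ i| ^ (s / n - 1)) := by
    intro τ
    rw [ENNReal.ofReal_prod_of_nonneg (fun i _ => by positivity), ← Finset.prod_mul_distrib]
    refine Finset.prod_congr rfl fun i _ => ?_
    rw [← ENNReal.ofReal_mul (by positivity), ← Real.mul_rpow (abs_nonneg _) (abs_nonneg _), ← abs_mul,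
      mul_sub, mul_one]
  simp_rw [e1, mul_assoc] at h1
  rw [lintegral_const_mul' _ _ ENNReal.ofReal_ne_top, ← mul_assoc (ENNReal.ofReal _), ← ENNReal.ofReal_mul
    (by positivity), ← Finset.prod_mul_distrib] at h1
  have e2 : ∏ i, |x i| * |x i| ^ (s / (n:ℝ) - 1) = W := by
    refine Finset.prod_congr rfl fun i _ => ?_
    have := abs_pos.mpr (hx i)
    rw [Real.rpow_sub this, Real.rpow_one]
    field_simp
  rw [e2] at h1
  have e3 : ‖f x / (W : ℂ)‖ₑ = (ENNReal.ofReal W)⁻¹ * ‖f x‖ₑ := by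
    rw [← ofReal_norm, norm_div, Complex.norm_real, Real.norm_of_nonneg hW.le, div_eq_inv_mul,
      ENNReal.ofReal_mul (by positivity), ENNReal.ofReal_inv_of_pos hW, ofReal_norm]
  rw [e3]
  have hW0 : ENNReal.ofReal W ≠ 0 := by simpa using hW
  refine (mul_le_mul_right h1 _).trans (le_of_eq ?_)
  rw [mul_left_comm C, ← mul_assoc, ENNReal.inv_mul_cancel hW0 ENNReal.ofReal_ne_top, one_mul]
  congr 1
  refine lintegral_congr fun τ => ?_
  simp_rw [mul_comm (x _)]
/-- **Strengthened anisotropic Hardy–Sobolev inequality in mixed Lorentz spaces**,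
with the weight `∏_{i=1}^{n} |x_i|^{s/n}` in place of `|x|^s`. -/
theorem anisotropic_hardy_sobolev_mixed_lorentz_product_weight
    (n : ℕ) (hn : 1 ≤ n) (p q : Fin n → ℝ)
    (hp : ∀ i, 1 < p i) (hq : ∀ i, 1 < q i)
    (s : ℝ) (hs : 0 < s) (hsn : ∀ i, s < n / p i) :
    ∃ C : ℝ, 0 < C ∧ ∀ f : SchwartzMap ((Fin n) → ℝ) ℂ,
      mixedLorentz n (fun i => ENNReal.ofReal (p i)) (fun i => ENNReal.ofReal (q i))
        (fun x => (‖f x / (((∏ i, |x i| ^ (s / (n : ℝ))) : ℝ) : ℂ)‖₊ : ℝ≥0∞))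
      ≤ ENNReal.ofReal C *
        mixedLorentz n (fun i => ENNReal.ofReal (p i)) (fun i => ENNReal.ofReal (q i))
          (fun x => (‖fracLap n s (⇑f) x‖₊ : ℝ≥0∞)) := by
  have hn0 : (0:ℝ) < n := by exact_mod_cast hn
  have hsn' : s < n := (hsn ⟨0, hn⟩).trans (div_lt_self hn0 (hp _))
  obtain ⟨C₁, h10, h1t, h1⟩ := pointwise_bound n hn hs hsn'
  obtain ⟨C₂, h20, h2t, h2⟩ := mixN_minkowski n p q hp hq
  have hkp := kernel_pi n (s / n) (fun i => (p i)⁻¹) (by positivity)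
    (fun i => by
      rw [div_lt_iff₀ hn0, mul_comm, ← div_eq_mul_inv]; exact hsn i)
    (fun i => inv_lt_one_of_one_lt₀ (hp i))
  set Kt := ∫⁻ t : Fin n → ℝ, (∏ i, ENNReal.ofReal (|1 - t i| ^ (s / n - 1))) *
      (∏ i, ENNReal.ofReal (|t i| ^ (-(p i)⁻¹))) with hKt
  set T : ℝ≥0∞ := C₁ * (C₂ * Kt) with hT
  have hTt : T ≠ ∞ := ENNReal.mul_ne_top h1t (ENNReal.mul_ne_top h2t hkp.ne)
  refine ⟨T.toReal + 1, by positivity, fun f => ?_⟩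
  have hgm := (fracLap_meas n s f).enorm
  set g : (Fin n → ℝ) → ℝ≥0∞ := fun y => ‖fracLap n s f y‖ₑ with hg
  change mixN n p q (fun x => ‖f x / (((∏ i, |x i| ^ (s / (n : ℝ))) : ℝ) : ℂ)‖ₑ) ≤
    ENNReal.ofReal (T.toReal + 1) * mixN n p q g
  have hTle : T ≤ ENNReal.ofReal (T.toReal + 1) := by
    conv_lhs => rw [← ENNReal.ofReal_toReal hTt]
    exact ENNReal.ofReal_le_ofReal (by linarith)
  refine le_trans ?_ (mul_le_mul_left hTle _)
  let w : (Fin n → ℝ) → ℝ≥0∞ := fun τ => ∏ i, ENNReal.ofReal (|1 - τ i| ^ (s / n - 1))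
  have hwm : Measurable w := by simp only [w]; fun_prop
  let ν : Measure (Fin n → ℝ) := volume.withDensity w
  have hGm : Measurable (Function.uncurry fun (x τ : Fin n → ℝ) => g (fun i => τ i * x i)) := by
    simp only [Function.uncurry_def]
    fun_prop
  have hGx : ∀ x : Fin n → ℝ, ∫⁻ τ, w τ * g (fun i => τ i * x i) = ∫⁻ τ, g (fun i => τ i * x i) ∂ν := by
    intro x
    rw [lintegral_withDensity_eq_lintegral_mul _ hwm (by fun_prop)]
    rfl
  have hae : ∀ᵐ τ : Fin n → ℝ, ∀ i, τ i ≠ 0 := by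
    rw [ae_all_iff]
    intro i
    exact Measure.ae_eval_ne (μ := fun _ : Fin n => (volume : Measure ℝ)) i 0
  have hae' : ∀ᵐ τ ∂ν, ∀ i, τ i ≠ 0 := (withDensity_absolutelyContinuous _ _).ae_le hae
  have hdm : Measurable fun τ : Fin n → ℝ => ∏ i, ENNReal.ofReal (|τ i| ^ (-(p i)⁻¹)) := by fun_prop
  calc mixN n p q (fun x => ‖f x / (((∏ i, |x i| ^ (s / (n : ℝ))) : ℝ) : ℂ)‖ₑ) 
      ≤ mixN n p q (fun x => C₁ * ∫⁻ τ, g (fun i => τ i * x i) ∂ν) :=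
        mixN_mono n p q hp hq fun x => by
          rw [← hGx]; exact h1 f x
    _ = C₁ * mixN n p q (fun x => ∫⁻ τ, g (fun i => τ i * x i) ∂ν) :=
        mixN_const_mul n p q hp hq _ h10 h1t
    _ ≤ C₁ * (C₂ * ∫⁻ τ, mixN n p q (fun x => g (fun i => τ i * x i)) ∂ν) :=
        mul_le_mul_right (h2 ν _ hGm) _
    _ = C₁ * (C₂ * ∫⁻ τ, (∏ i, ENNReal.ofReal (|τ i| ^ (-(p i)⁻¹))) * mixN n p q g ∂ν) := by
        congr 2
        refine lintegral_congr_ae ?_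
        filter_upwards [hae'] with τ hτ
        exact mixN_dil n p q hp hq g τ hτ
    _ = T * mixN n p q g := by
        rw [lintegral_mul_const _ hdm, lintegral_withDensity_eq_lintegral_mul _ hwm hdm, hT, hKt]
        simp only [w, Pi.mul_apply]
        ring
end
end

section
/- Let k_1,…,k_i be positive integers with k_1+…+k_i ≤ n. Partition pairwise disjoint groups of coordinates of ℝⁿ: choose k_1 coordinates x_{i_1},…,x_{i_{k_1}} and set r_1 = √(x_{i_1}² + … + x_{i_{k_1}}²); from the remaining coordinates choose k_2 coordinates and set r_2 to be the Euclidean norm of that group; and so on, defining r_1,…,r_i as the Euclidean norms of i pairwise disjoint groups of coordinates of sizes k_1,…,k_i. Suppose 1<p<∞ and 0<α_j<k_j/p for each 1≤j≤i. Then there exists a constant C>0 such that for all f ∈ C_0^∞(ℝⁿ), ‖ f(x) / ∏_{j=1}^{i} r_j^{α_j} ‖_{L^p(ℝⁿ)} ≤ C ‖ Λ_{x_{i_1},…,x_{i_{k_1+…+k_i}}}^{α_1+…+α_i} f ‖_{L^p(ℝⁿ)}, where the fractional derivative acts only in the selected k_1+…+k_i coordinates. -/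
open MeasureTheory ENNReal Real Set

noncomputable section

/-- The one-dimensional power weight `|x|^a`, with values in `ℝ≥0∞`. -/
def pw (a x : ℝ) : ℝ≥0∞ := ENNReal.ofReal |x| ^ a

lemma measurable_pw (a : ℝ) : Measurable (pw a) := by
  unfold pw; fun_prop

lemma pw_eq (a : ℝ) {x : ℝ} (hx : x ≠ 0) : pw a x = ENNReal.ofReal (|x| ^ a) := by
  unfold pw
  rw [ENNReal.ofReal_rpow_of_pos (abs_pos.mpr hx)]

lemma pw_ne_zero (a : ℝ) {x : ℝ} (hx : x ≠ 0) : pw a x ≠ 0 := by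
  rw [pw_eq a hx]
  have : 0 < |x| ^ a := Real.rpow_pos_of_pos (abs_pos.mpr hx) _
  simpa using this

lemma pw_ne_top (a : ℝ) {x : ℝ} (hx : x ≠ 0) : pw a x ≠ ⊤ := by
  rw [pw_eq a hx]; exact ENNReal.ofReal_ne_top

lemma pw_add (a b : ℝ) {x : ℝ} (hx : x ≠ 0) : pw (a + b) x = pw a x * pw b x := by
  unfold pw
  rw [ENNReal.rpow_add _ _ (by simpa using hx) ENNReal.ofReal_ne_top]

lemma pw_mul (a x y : ℝ) : pw a (x * y) = pw a x * pw a y := by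
  unfold pw
  rw [abs_mul, ENNReal.ofReal_mul (abs_nonneg _),
    ENNReal.mul_rpow_of_ne_top ENNReal.ofReal_ne_top ENNReal.ofReal_ne_top]

lemma pw_rpow (a b x : ℝ) : pw a x ^ b = pw (a * b) x := by
  unfold pw
  rw [ENNReal.rpow_mul]

lemma pw_one (x : ℝ) : pw 1 x = ENNReal.ofReal |x| := by simp [pw]

lemma pw_neg_arg (a x : ℝ) : pw a (-x) = pw a x := by simp [pw]

lemma integrableOn_abs_rpow {b : ℝ} (hb : b < 1) :
    IntegrableOn (fun v : ℝ => |v| ^ (-b)) (Metric.ball 0 1) := by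
  apply integrableOn_ball_of_norm_le_rpow (C := 1) (α := b) (by simp) (by simpa using hb)
  · refine Filter.Eventually.of_forall fun x => ?_
    rw [Real.norm_eq_abs, abs_of_nonneg (by positivity)]
    simp
  · exact (by fun_prop : Measurable (fun v : ℝ => |v| ^ (-b))).aestronglyMeasurable

lemma beta_integrable {a b : ℝ} (ha : 0 < a) (ha1 : a < 1) (hb : 0 < b) (hb1 : b < 1)
    (hab : 1 < a + b) : Integrable (fun v : ℝ => |1 - v| ^ (-a) * |v| ^ (-b)) := by
  have h1 : Integrable ((Metric.ball (0:ℝ) 1).indicator (fun v : ℝ => |v| ^ (-b))) :=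
    (integrable_indicator_iff measurableSet_ball).2 (integrableOn_abs_rpow hb1)
  have h2 : Integrable (fun v : ℝ => (Metric.ball (0:ℝ) 1).indicator (fun v : ℝ => |v| ^ (-a)) (1 - v)) :=
    ((integrable_indicator_iff measurableSet_ball).2 (integrableOn_abs_rpow ha1)).comp_sub_left 1
  have h3 : Integrable (fun v : ℝ => (1 + ‖v‖) ^ (-(a+b))) :=
    integrable_one_add_norm (by simpa using hab)
  refine Integrable.mono' (((h1.const_mul (2 ^ a)).add (h2.const_mul (2 ^ b))).add
    (h3.const_mul (5 ^ a * 3 ^ b))) ?_ ?_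
  · exact (by fun_prop : Measurable (fun v : ℝ => |1 - v| ^ (-a) * |v| ^ (-b))).aestronglyMeasurable
  · have key : ∀ (c x y : ℝ), 0 ≤ c → 0 < y → 0 < x → ∀ K : ℝ, 0 < K → y ≤ K * x → x ^ (-c) ≤ K ^ c * y ^ (-c) := by
      intro c x y hc hy hx K hK h
      have : x ^ (-c) = K ^ c * (K * x) ^ (-c) := by
        rw [Real.mul_rpow hK.le hx.le, ← mul_assoc, ← Real.rpow_add hK]; simp
      rw [this]
      refine mul_le_mul_of_nonneg_left ?_ (by positivity)
      exact Real.rpow_le_rpow_of_nonpos hy h (by linarith)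
    have key0 : ∀ (c x : ℝ), 0 ≤ c → (1/2) ≤ x → x ^ (-c) ≤ 2 ^ c := by
      intro c x hc h
      have := key c x 1 hc one_pos (by linarith) 2 (by norm_num) (by linarith)
      simpa using this
    refine Filter.Eventually.of_forall fun v => ?_
    rw [Real.norm_eq_abs, abs_of_nonneg (by positivity)]
    simp only [Pi.add_apply]
    have p1 : 0 ≤ 2 ^ a * (Metric.ball (0:ℝ) 1).indicator (fun v : ℝ => |v| ^ (-b)) v :=
      mul_nonneg (by positivity) (indicator_nonneg (fun _ _ => by positivity) _)
    have p2 : 0 ≤ 2 ^ b * (Metric.ball (0:ℝ) 1).indicator (fun v : ℝ => |v| ^ (-a)) (1 - v) :=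
      mul_nonneg (by positivity) (indicator_nonneg (fun _ _ => by positivity) _)
    have p3 : 0 ≤ 5 ^ a * 3 ^ b * (1 + ‖v‖) ^ (-(a+b)) := by positivity
    by_cases hv : |v| < 1/2
    · have hv' : v ∈ Metric.ball (0:ℝ) 1 := by simp; linarith
      have hh : 1/2 ≤ |1 - v| := by
        have := abs_sub_abs_le_abs_sub 1 v; simp at this; linarith
      have : |1 - v| ^ (-a) * |v| ^ (-b) ≤ 2 ^ a * |v| ^ (-b) :=
        mul_le_mul_of_nonneg_right (key0 _ _ ha.le hh) (by positivity)
      rw [indicator_of_mem hv'] at *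
      linarith
    by_cases hv1 : |1 - v| < 1/2
    · have hv' : 1 - v ∈ Metric.ball (0:ℝ) 1 := by simp; linarith
      have : |1 - v| ^ (-a) * |v| ^ (-b) ≤ |1 - v| ^ (-a) * 2 ^ b :=
        mul_le_mul_of_nonneg_left (key0 _ _ hb.le (not_lt.mp hv)) (by positivity)
      rw [indicator_of_mem hv'] at *
      linarith
    · push Not at hv hv1
      have e1 := key b |v| (1 + |v|) hb.le (by positivity) (by linarith) 3 (by norm_num) (by linarith)
      have e2 := key a |1 - v| (1 + |v|) ha.le (by positivity) (by linarith) 5 (by norm_num) (by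
        have := abs_sub_abs_le_abs_sub v 1
        rw [abs_sub_comm v 1, abs_one] at this; linarith)
      have : |1 - v| ^ (-a) * |v| ^ (-b) ≤ 5 ^ a * 3 ^ b * (1 + ‖v‖) ^ (-(a+b)) := by
        calc _ ≤ (5 ^ a * (1 + |v|) ^ (-a)) * (3 ^ b * (1 + |v|) ^ (-b)) := by gcongr
          _ = _ := by
            rw [Real.norm_eq_abs, neg_add, Real.rpow_add (by positivity)]; ring
      linarith

lemma beta_bound {a b : ℝ} (ha : 0 < a) (ha1 : a < 1) (hb : 0 < b) (hb1 : b < 1)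
    (hab : 1 < a + b) : ∃ C : ℝ≥0∞, C ≠ ⊤ ∧ ∀ x : ℝ, x ≠ 0 →
      ∫⁻ y, pw (-a) (x - y) * pw (-b) y ≤ C * pw (1 - a - b) x := by
  refine ⟨∫⁻ v, pw (-a) (1 - v) * pw (-b) v, ?_, fun x hx => ?_⟩
  · have h := (beta_integrable ha ha1 hb hb1 hab).lintegral_lt_top.ne
    convert h using 1
    apply lintegral_congr_ae
    have e0 : ∀ᵐ v : ℝ, v ≠ 0 := by simp [ae_iff]
    have e1 : ∀ᵐ v : ℝ, v ≠ 1 := by simp [ae_iff]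
    filter_upwards [e0, e1] with v h0 h1
    rw [pw_eq _ h0, pw_eq _ (sub_ne_zero.mpr h1.symm), ← ENNReal.ofReal_mul (by positivity)]
  · have hm : Measurable (fun y => pw (-a) (x - y) * pw (-b) y) :=
      ((measurable_pw _).comp (by fun_prop)).mul (measurable_pw _)
    conv_lhs => rw [← Real.smul_map_volume_mul_left hx, lintegral_smul_measure,
      lintegral_map hm (by fun_prop)]
    have : ∀ v, pw (-a) (x - x * v) * pw (-b) (x * v) =
        (pw (-a) x * pw (-b) x) * (pw (-a) (1 - v) * pw (-b) v) := by
      intro v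
      rw [show x - x * v = x * (1 - v) by ring, pw_mul, pw_mul]; ring
    simp_rw [this]
    rw [lintegral_const_mul', smul_eq_mul, ← pw_one, ← mul_assoc, ← pw_add _ _ hx, ← pw_add _ _ hx,
      mul_comm, show 1 + (-a + -b) = 1 - a - b by ring]
    exact ENNReal.mul_ne_top (pw_ne_top _ hx) (pw_ne_top _ hx)


/-- The one-dimensional Hardy kernel `|a|^{-β} |a-u|^{β-1}`. -/
def hk (β a u : ℝ) : ℝ≥0∞ := pw (-β) a * pw (β - 1) (a - u)

lemma measurable_hk (β : ℝ) : Measurable (fun z : ℝ × ℝ => hk β z.1 z.2) :=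
  ((measurable_pw _).comp measurable_fst).mul
    ((measurable_pw _).comp (measurable_fst.sub measurable_snd))

lemma schur_one {p q β : ℝ} (hpq : p.HolderConjugate q) (hβ : 0 < β) (hβ' : β < 1 / p) :
    ∃ C : ℝ≥0∞, C ≠ ⊤ ∧ ∀ H : ℝ → ℝ≥0∞, Measurable H →
      ∫⁻ a, (∫⁻ u, hk β a u * H u) ^ p ≤ C * ∫⁻ u, H u ^ p := by
  have hp := hpq.pos
  have hq := hpq.symm.pos
  have hsum := hpq.inv_add_inv_eq_one
  have hp1 := hpq.lt
  have hβ1 : β < 1 := hβ'.trans (by rw [div_lt_one hp]; exact hp1)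
  obtain ⟨t, ht1, ht2⟩ : ∃ t, β / q < t ∧ t < min (1 / q) ((1 - β) / p) := by
    apply exists_between
    refine lt_min (by gcongr) ?_
    have : β / q + β / p = β := by
      rw [div_eq_mul_inv, div_eq_mul_inv, ← mul_add, add_comm, hsum, mul_one]
    rw [sub_div]; linarith
  obtain ⟨ht2, ht3⟩ := lt_min_iff.mp ht2
  have ht0 : 0 < t := lt_trans (by positivity) ht1
  rw [div_lt_iff₀ hq] at ht1
  rw [lt_div_iff₀ hq] at ht2
  rw [lt_div_iff₀ hp] at ht3
  have htp : 0 < t * p := by positivity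
  obtain ⟨C1, hC1, B1⟩ := beta_bound (a := 1 - β) (b := t * q) (by linarith) (by linarith)
    (by linarith) ht2 (by linarith)
  obtain ⟨C2, hC2, B2⟩ := beta_bound (a := 1 - β) (b := β + t * p) (by linarith) (by linarith)
    (by linarith) (by linarith) (by linarith)
  have e0 : ∀ᵐ v : ℝ, v ≠ 0 := by simp [ae_iff]
  refine ⟨C1 ^ (p / q) * C2, ENNReal.mul_ne_top
    (ENNReal.rpow_ne_top_of_nonneg (by positivity) hC1) hC2, fun H hH => ?_⟩
  have hCq : C1 ^ (p / q) ≠ ⊤ := ENNReal.rpow_ne_top_of_nonneg (by positivity) hC1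
  have mK : ∀ a, Measurable (fun u => hk β a u) := fun a =>
    (measurable_hk β).comp (measurable_const.prodMk measurable_id)
  have step1 : ∀ a : ℝ, a ≠ 0 → (∫⁻ u, hk β a u * H u) ^ p ≤
      C1 ^ (p / q) * ∫⁻ u, hk β a u * pw (-(t * p)) a * (pw (t * p) u * H u ^ p) := by
    intro a ha
    have hold := ENNReal.lintegral_mul_le_Lp_mul_Lq volume hpq.symm
      (f := fun u => hk β a u ^ (1 / q) * pw (-t) u)
      (g := fun u => hk β a u ^ (1 / p) * (pw t u * H u))
      (((mK a).pow_const _).mul (measurable_pw _)).aemeasurable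
      (((mK a).pow_const _).mul ((measurable_pw _).mul hH)).aemeasurable
    have i1 : ∫⁻ u, hk β a u * H u = ∫⁻ u, ((fun u => hk β a u ^ (1 / q) * pw (-t) u) *
        (fun u => hk β a u ^ (1 / p) * (pw t u * H u))) u := by
      apply lintegral_congr_ae
      filter_upwards [e0] with u hu
      have k1 : hk β a u ^ (1 / q) * hk β a u ^ (1 / p) = hk β a u := by
        rw [← ENNReal.rpow_add_of_nonneg _ _ (by positivity) (by positivity), one_div, one_div,
          add_comm, hsum, ENNReal.rpow_one]
      have k2 : pw (-t) u * pw t u = 1 := by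
        rw [← pw_add _ _ hu]; simp [pw]
      simp only [Pi.mul_apply]
      calc hk β a u * H u = (hk β a u ^ (1 / q) * hk β a u ^ (1 / p)) * (pw (-t) u * pw t u) * H u := by
            rw [k1, k2, mul_one]
        _ = _ := by ring
    have i2 : ∫⁻ u, (hk β a u ^ (1 / q) * pw (-t) u) ^ q ≤ C1 * pw (-(t * q)) a := by
      have : ∀ u, (hk β a u ^ (1 / q) * pw (-t) u) ^ q =
          pw (-β) a * (pw (-(1 - β)) (a - u) * pw (-(t * q)) u) := by
        intro u
        rw [ENNReal.mul_rpow_of_nonneg _ _ hq.le, ← ENNReal.rpow_mul, one_div_mul_cancel hq.ne',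
          ENNReal.rpow_one, pw_rpow, hk, neg_mul, neg_sub]
        ring
      simp_rw [this]
      rw [lintegral_const_mul' _ _ (pw_ne_top _ ha)]
      calc _ ≤ pw (-β) a * (C1 * pw (1 - (1 - β) - t * q) a) := by gcongr; exact B1 a ha
        _ = C1 * (pw (-β) a * pw (1 - (1 - β) - t * q) a) := by ring
        _ = _ := by
          rw [← pw_add _ _ ha]; ring_nf
    have i3 : ∫⁻ u, (hk β a u ^ (1 / p) * (pw t u * H u)) ^ p =
        ∫⁻ u, hk β a u * (pw (t * p) u * H u ^ p) := by
      congr 1; ext u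
      rw [ENNReal.mul_rpow_of_nonneg _ _ hp.le, ← ENNReal.rpow_mul, one_div_mul_cancel hp.ne',
          ENNReal.rpow_one, ENNReal.mul_rpow_of_nonneg _ _ hp.le, pw_rpow]
    rw [← i1, i3] at hold
    calc _ ≤ ((C1 * pw (-(t * q)) a) ^ (1 / q) *
          (∫⁻ u, hk β a u * (pw (t * p) u * H u ^ p)) ^ (1 / p)) ^ p := by
            gcongr
            exact hold.trans (by gcongr)
      _ = C1 ^ (p / q) * (pw (-(t * p)) a * ∫⁻ u, hk β a u * (pw (t * p) u * H u ^ p)) := by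
        rw [ENNReal.mul_rpow_of_nonneg _ _ hp.le, ← ENNReal.rpow_mul, ← ENNReal.rpow_mul,
          one_div_mul_cancel hp.ne', ENNReal.rpow_one,
          ENNReal.mul_rpow_of_nonneg _ _ (by positivity), pw_rpow, mul_assoc]
        rw [show 1 / q * p = p / q by ring, show -(t * q) * (p / q) = -(t * p) by field_simp]
      _ = _ := by
        rw [← lintegral_const_mul' _ _ (pw_ne_top _ ha)]
        congr 2; ext u; ring
  calc _ ≤ ∫⁻ a, C1 ^ (p / q) * ∫⁻ u, hk β a u * pw (-(t * p)) a * (pw (t * p) u * H u ^ p) := by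
        apply lintegral_mono_ae
        filter_upwards [e0] with a ha using step1 a ha
    _ = C1 ^ (p / q) * ∫⁻ u, ∫⁻ a, hk β a u * pw (-(t * p)) a * (pw (t * p) u * H u ^ p) := by
        rw [lintegral_const_mul' _ _ hCq, lintegral_lintegral_swap]
        refine Measurable.aemeasurable ?_
        exact ((measurable_hk β).mul ((measurable_pw _).comp measurable_fst)).mul
          (((measurable_pw _).comp measurable_snd).mul ((hH.comp measurable_snd).pow_const _))
    _ ≤ C1 ^ (p / q) * ∫⁻ u, C2 * H u ^ p := by
        refine mul_le_mul_right ?_ _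
        apply lintegral_mono_ae
        filter_upwards [e0] with u hu
        have mm : Measurable (fun a => hk β a u * pw (-(t * p)) a) :=
          ((measurable_hk β).comp (measurable_id.prodMk measurable_const)).mul (measurable_pw _)
        rw [lintegral_mul_const _ mm]
        have : ∫⁻ a, hk β a u * pw (-(t * p)) a =
            ∫⁻ a, pw (-(1 - β)) (u - a) * pw (-(β + t * p)) a := by
          apply lintegral_congr_ae
          filter_upwards [e0] with a ha
          rw [neg_add, pw_add _ _ ha, hk, ← pw_neg_arg _ (a - u), neg_sub, neg_sub]; ring
        rw [this]
        calc _ ≤ C2 * pw (1 - (1 - β) - (β + t * p)) u * (pw (t * p) u * H u ^ p) := by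
              gcongr; exact B2 u hu
          _ = C2 * (pw (1 - (1 - β) - (β + t * p)) u * pw (t * p) u) * H u ^ p := by ring
          _ = _ := by
            rw [← pw_add _ _ hu]; simp [pw]
    _ = _ := by
        rw [lintegral_const_mul' _ _ hC2, mul_assoc]

lemma schur_coord {n : ℕ} {p q β : ℝ} (hpq : p.HolderConjugate q) (hβ : 0 < β) (hβ' : β < 1 / p)
    (i : Fin n) :
    ∃ C : ℝ≥0∞, C ≠ ⊤ ∧ ∀ H : (Fin n → ℝ) → ℝ≥0∞, Measurable H →
      ∫⁻ x : Fin n → ℝ, (∫⁻ u, hk β (x i) u * H (Function.update x i u)) ^ p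
        ≤ C * ∫⁻ x, H x ^ p := by
  obtain ⟨C, hC, hS⟩ := schur_one hpq hβ hβ'
  refine ⟨C, hC, fun H hH => ?_⟩
  have mF : Measurable (fun x : Fin n → ℝ => (∫⁻ u, hk β (x i) u * H (Function.update x i u)) ^ p) := by
    refine Measurable.pow_const ?_ _
    apply Measurable.lintegral_prod_right' (f := fun z : (Fin n → ℝ) × ℝ =>
      hk β (z.1 i) z.2 * H (Function.update z.1 i z.2))
    have h1 : Measurable (fun z : (Fin n → ℝ) × ℝ => ((z.1 i, z.2) : ℝ × ℝ)) := by fun_prop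
    refine ((measurable_hk β).comp h1).mul (hH.comp ?_)
    exact measurable_update'.comp (by fun_prop)
  rw [volume_pi, lintegral_eq_lmarginal_univ (0 : Fin n → ℝ),
    lintegral_eq_lmarginal_univ (0 : Fin n → ℝ), lmarginal_erase' _ mF (Finset.mem_univ i),
    lmarginal_erase' _ (hH.pow_const p) (Finset.mem_univ i)]
  rw [lmarginal, lmarginal, ← lintegral_const_mul' _ _ hC]
  apply lintegral_mono
  intro y
  simp only [Function.update_self, Function.update_idem]
  exact hS (fun u => H (Function.update _ i u)) (hH.comp (measurable_update _))

/-- Iterated Hardy operator over the coordinates in `S`. -/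
def hop {n : ℕ} (β : Fin n → ℝ) (S : Finset (Fin n)) (H : (Fin n → ℝ) → ℝ≥0∞) (x : Fin n → ℝ) :
    ℝ≥0∞ :=
  ∫⁻ y : S → ℝ, (∏ i : S, hk (β i) (x i) (y i)) * H (Function.updateFinset x S y)

lemma hop_bound {n : ℕ} {p q : ℝ} (hpq : p.HolderConjugate q) (β : Fin n → ℝ)
    (S : Finset (Fin n)) (hβ : ∀ i ∈ S, 0 < β i) (hβ' : ∀ i ∈ S, β i < 1 / p) :
    ∃ C : ℝ≥0∞, C ≠ ⊤ ∧ ∀ H : (Fin n → ℝ) → ℝ≥0∞, Measurable H →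
      ∫⁻ x : Fin n → ℝ, hop β S H x ^ p ≤ C * ∫⁻ x, H x ^ p := by
  have rep : ∀ (S : Finset (Fin n)) (H : (Fin n → ℝ) → ℝ≥0∞) (x : Fin n → ℝ), hop β S H x =
      lmarginal (fun _ => volume) S (fun z => (∏ i ∈ S, hk (β i) (x i) (z i)) * H z) x := by
    intro S H x
    rw [hop, lmarginal, volume_pi]
    congr 1; ext y
    congr 1
    rw [← Finset.prod_coe_sort S (fun i => hk (β i) (x i) (Function.updateFinset x S y i))]
    refine Finset.prod_congr rfl fun i _ => ?_
    simp [Function.updateFinset]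
  have mz : ∀ (S : Finset (Fin n)) (H : (Fin n → ℝ) → ℝ≥0∞) (x : Fin n → ℝ), Measurable H →
      Measurable (fun z : Fin n → ℝ => (∏ i ∈ S, hk (β i) (x i) (z i)) * H z) := by
    intro S H x hH
    refine (Finset.measurable_prod _ fun i _ => ?_).mul hH
    exact (measurable_hk (β i)).comp (measurable_const.prodMk (measurable_pi_apply i))
  have mh : ∀ (S : Finset (Fin n)) (H : (Fin n → ℝ) → ℝ≥0∞), Measurable H → Measurable (hop β S H) := by
    intro S H hH
    unfold hop
    apply Measurable.lintegral_prod_right' (f := fun z : (Fin n → ℝ) × (S → ℝ) =>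
      (∏ i : S, hk (β i) (z.1 i) (z.2 i)) * H (Function.updateFinset z.1 S z.2))
    refine (Finset.measurable_prod _ fun i _ => ?_).mul (hH.comp ?_)
    · have h1 : Measurable (fun z : (Fin n → ℝ) × (S → ℝ) => ((z.1 i, z.2 i) : ℝ × ℝ)) := by fun_prop
      exact (measurable_hk (β i)).comp h1
    · exact measurable_updateFinset'
  induction S using Finset.induction_on with
  | empty =>
    refine ⟨1, by simp, fun H hH => ?_⟩
    simp [rep]
  | insert i S hi ih =>
    obtain ⟨C1, hC1, h1⟩ := ih (fun j hj => hβ j (Finset.mem_insert_of_mem hj))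
      (fun j hj => hβ' j (Finset.mem_insert_of_mem hj))
    obtain ⟨C2, hC2, h2⟩ := schur_coord hpq (hβ i (Finset.mem_insert_self i S))
      (hβ' i (Finset.mem_insert_self i S)) i
    refine ⟨C2 * C1, ENNReal.mul_ne_top hC2 hC1, fun H hH => ?_⟩
    have e : ∀ x, hop β (insert i S) H x =
        ∫⁻ u, hk (β i) (x i) u * hop β S H (Function.update x i u) := by
      intro x
      rw [rep, lmarginal_insert _ (mz _ H x hH) hi]
      congr 1; ext u
      rw [rep, lmarginal, lmarginal, ← lintegral_const_mul]
      · congr 1; ext y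
        rw [Finset.prod_insert hi, mul_assoc]
        congr 1
        · simp [Function.updateFinset, hi]
        · congr 1
          refine Finset.prod_congr rfl fun j hj => ?_
          rw [Function.update_of_ne (by rintro rfl; exact hi hj)]
      · exact (mz _ H _ hH).comp measurable_updateFinset
    simp_rw [e]
    calc _ ≤ C2 * ∫⁻ x, hop β S H x ^ p := h2 _ (mh S H hH)
      _ ≤ C2 * (C1 * ∫⁻ x, H x ^ p) := by gcongr; exact h1 H hH
      _ = _ := by rw [mul_assoc]


lemma pw_neg_ne_zero {a : ℝ} (ha : a < 0) (x : ℝ) : pw a x ≠ 0 := by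
  by_cases hx : x = 0
  · subst hx
    simp [pw, ENNReal.zero_rpow_of_neg ha]
  · exact pw_ne_zero a hx

lemma pw_neg_zero {a : ℝ} (ha : a < 0) : pw a 0 = ⊤ := by
  simp [pw, ENNReal.zero_rpow_of_neg ha]

/-- Comparing a power of a sum of squares with a product of powers. -/
lemma sum_sq_rpow_le {ι : Type*} (S : Finset ι) (γ : ι → ℝ) (hγ : ∀ i ∈ S, 0 < γ i) (v : ι → ℝ) :
    ENNReal.ofReal ((∑ i ∈ S, v i ^ 2) ^ (-(∑ i ∈ S, γ i) / 2)) ≤ ∏ i ∈ S, pw (-γ i) (v i) := by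
  classical
  by_cases h : ∃ i ∈ S, v i = 0
  · obtain ⟨i, hi, hv⟩ := h
    rw [← Finset.mul_prod_erase S _ hi, hv, pw_neg_zero (by linarith [hγ i hi]), ENNReal.top_mul]
    · exact le_top
    · rw [Finset.prod_ne_zero_iff]
      intro j hj
      exact pw_neg_ne_zero (by linarith [hγ j (Finset.mem_of_mem_erase hj)]) _
  · push Not at h
    rcases S.eq_empty_or_nonempty with rfl | ⟨i0, hi0⟩
    · simp
    set R := ∑ i ∈ S, v i ^ 2
    have hR : ∀ i ∈ S, v i ^ 2 ≤ R := fun i hi =>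
      Finset.single_le_sum (f := fun i => v i ^ 2) (fun _ _ => sq_nonneg _) hi
    have hR0 : 0 < R := lt_of_lt_of_le (by have := h i0 hi0; positivity) (hR i0 hi0)
    have e1 : R ^ (-(∑ i ∈ S, γ i) / 2) = ∏ i ∈ S, R ^ (-γ i / 2) := by
      rw [← Real.rpow_sum_of_pos hR0, neg_div, Finset.sum_div, ← Finset.sum_neg_distrib]
      simp_rw [neg_div]
    rw [e1, ENNReal.ofReal_prod_of_nonneg (fun i _ => by positivity)]
    refine Finset.prod_le_prod' fun i hi => ?_
    rw [pw_eq _ (h i hi)]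
    apply ENNReal.ofReal_le_ofReal
    have hv := h i hi
    have : |v i| ^ (-γ i) = (v i ^ 2) ^ (-γ i / 2) := by
      rw [← sq_abs, ← Real.rpow_natCast, ← Real.rpow_mul (abs_nonneg _)]
      congr 1; push_cast; ring
    rw [this]
    exact Real.rpow_le_rpow_of_nonpos (by positivity) (hR i hi) (by linarith [hγ i hi])

lemma gamma_inv_bound {a r : ℝ} (ha : 0 < a) (hr : 0 < r) :
    ∫⁻ t in Ioi (0:ℝ), ENNReal.ofReal (t ^ (-a - 1) * Real.exp (-(r / t))) =
      ENNReal.ofReal ((1 / r) ^ a * Real.Gamma a) := by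
  have h1 := integral_comp_rpow_Ioi (fun u : ℝ => u ^ (a - 1) * Real.exp (-(r * u))) (p := -1) (by norm_num)
  rw [Real.integral_rpow_mul_exp_neg_mul_Ioi ha hr] at h1
  have h2 : ∫ t in Ioi (0:ℝ), (t ^ (-a - 1) * Real.exp (-(r / t))) = (1 / r) ^ a * Real.Gamma a := by
    rw [← h1]
    refine setIntegral_congr_fun measurableSet_Ioi fun t ht => ?_
    have ht : 0 < t := ht
    simp only [smul_eq_mul, Real.rpow_neg_one, abs_neg, abs_one, one_mul]
    rw [Real.inv_rpow ht.le, ← Real.rpow_neg ht.le, ← mul_assoc, ← Real.rpow_add ht, div_eq_mul_inv]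
    congr 2; ring
  have hpos : 0 < (1 / r) ^ a * Real.Gamma a := mul_pos (by positivity) (Real.Gamma_pos_of_pos ha)
  rw [← h2, ofReal_integral_eq_lintegral_ofReal]
  · by_contra hh
    rw [integral_undef hh] at h2
    linarith
  · filter_upwards [ae_restrict_mem measurableSet_Ioi] with t ht
    have ht : 0 < t := ht
    simp only [Pi.zero_apply]; positivity

/-- The heat kernel on `ℝ^ι`. -/
def heat (ι : Type*) [Fintype ι] (t : ℝ) (v : ι → ℝ) : ℝ :=
  (√(4 * π * t))⁻¹ ^ (Fintype.card ι) * Real.exp (-((∑ i, v i ^ 2) / (4 * t)))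

lemma heat_nonneg (ι : Type*) [Fintype ι] (t : ℝ) (v : ι → ℝ) : 0 ≤ heat ι t v := by
  unfold heat; positivity

lemma heat_time_bound (ι : Type*) [Fintype ι] [Nonempty ι] (β : ι → ℝ) (hβ : ∀ i, β i < 1) :
    ∃ C : ℝ≥0∞, C ≠ ⊤ ∧ ∀ v : ι → ℝ,
      ∫⁻ t in Ioi (0:ℝ), ENNReal.ofReal (t ^ ((∑ i, β i) / 2 - 1)) * ENNReal.ofReal (heat ι t v)
        ≤ C * ∏ i, pw (β i - 1) (v i) := by
  set s := ∑ i, β i with hs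
  set k : ℝ := (Fintype.card ι : ℝ) with hk
  have hks : k - s = ∑ i, (1 - β i) := by simp [hk, hs]
  have ha : 0 < (k - s) / 2 := by
    rw [hks]
    have := Finset.sum_pos (s := Finset.univ) (f := fun i => 1 - β i)
      (fun i _ => by linarith [hβ i]) Finset.univ_nonempty
    linarith
  set a := (k - s) / 2 with hadef
  set c : ℝ := (√(4 * π))⁻¹ ^ (Fintype.card ι) with hc
  have hcpos : 0 < c := by positivity
  have hG := Real.Gamma_pos_of_pos ha
  refine ⟨ENNReal.ofReal (c * (4 ^ a * Real.Gamma a)), ENNReal.ofReal_ne_top, fun v => ?_⟩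
  by_cases h : ∃ i, v i = 0
  · obtain ⟨i, hv⟩ := h
    classical
    have : ∏ i, pw (β i - 1) (v i) = ⊤ := by
      rw [← Finset.mul_prod_erase Finset.univ _ (Finset.mem_univ i), hv,
        pw_neg_zero (by linarith [hβ i]), ENNReal.top_mul]
      rw [Finset.prod_ne_zero_iff]
      intro j hj
      exact pw_neg_ne_zero (by linarith [hβ j]) _
    rw [this, ENNReal.mul_top]
    · exact le_top
    · simp only [ne_eq, ENNReal.ofReal_eq_zero, not_le]; positivity
  push Not at h
  set R := ∑ i, v i ^ 2 with hR
  have hR0 : 0 < R := Finset.sum_pos (fun i _ => by have := h i; positivity) Finset.univ_nonempty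
  have e : ∀ t ∈ Ioi (0:ℝ), ENNReal.ofReal (t ^ (s / 2 - 1)) * ENNReal.ofReal (heat ι t v) =
      ENNReal.ofReal c * ENNReal.ofReal (t ^ (-a - 1) * Real.exp (-((R / 4) / t))) := by
    intro t ht
    have ht : 0 < t := ht
    rw [← ENNReal.ofReal_mul (by positivity), ← ENNReal.ofReal_mul (by positivity)]
    congr 1
    have e1 : (√t)⁻¹ ^ (Fintype.card ι) = t ^ (-k / 2) := by
      rw [← Real.rpow_natCast, Real.sqrt_eq_rpow, ← Real.rpow_neg ht.le, ← Real.rpow_mul ht.le]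
      congr 1; rw [← hk]; ring
    rw [heat, Real.sqrt_mul (by positivity), mul_inv, mul_pow, e1,
      show -a - 1 = (s / 2 - 1) + (-k / 2) by rw [hadef]; ring, Real.rpow_add ht, div_div]
    ring
  rw [setLIntegral_congr_fun measurableSet_Ioi e, lintegral_const_mul' _ _ ENNReal.ofReal_ne_top,
    gamma_inv_bound ha (by positivity), ENNReal.ofReal_mul hcpos.le, mul_assoc]
  gcongr
  have e2 : (1 / (R / 4)) ^ a * Real.Gamma a = (4 ^ a * Real.Gamma a) * R ^ (-(∑ i, (1 - β i)) / 2) := by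
    rw [← hks, one_div_div, Real.div_rpow (by norm_num) hR0.le, neg_div, ← hadef, Real.rpow_neg hR0.le]
    ring
  rw [e2, ENNReal.ofReal_mul (by positivity)]
  gcongr
  have := sum_sq_rpow_le Finset.univ (fun i => 1 - β i) (fun i _ => by linarith [hβ i]) v
  simpa using this


lemma ft_schwartz_s3 (n : ℕ) (f : (Fin n → ℝ) → ℂ) (hf : ContDiff ℝ (⊤ : ℕ∞) f)
    (hc : HasCompactSupport f) :
    ∃ φ : SchwartzMap (Fin n → ℝ) ℂ, (∀ ξ, ft n f ξ = φ ξ) ∧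
      ∀ x, f x = (((2 * π) ^ (-(n : ℝ) / 2) : ℝ) : ℂ) *
        ∫ ξ : Fin n → ℝ, Complex.exp (Complex.I * ((∑ i, x i * ξ i : ℝ) : ℂ)) * φ ξ := by
  let L : EuclideanSpace ℝ (Fin n) ≃L[ℝ] (Fin n → ℝ) := EuclideanSpace.equiv (Fin n) ℝ
  have hF1 : ContDiff ℝ (⊤ : ℕ∞) (f ∘ L) := hf.comp L.contDiff
  have hF2 : HasCompactSupport (f ∘ L) := hc.comp_homeomorph L.toHomeomorph
  let F : SchwartzMap (EuclideanSpace ℝ (Fin n)) ℂ := hF2.toSchwartzMap hF1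
  have hFv : ∀ x, F x = f (L x) := fun x => rfl
  have hπ : (2 * π)⁻¹ ≠ 0 := by positivity
  let M : (Fin n → ℝ) ≃L[ℝ] EuclideanSpace ℝ (Fin n) :=
    (ContinuousLinearEquiv.smulLeft (Units.mk0 ((2 * π)⁻¹) hπ)).trans L.symm
  have hM : ∀ ξ, M ξ = L.symm ((2 * π)⁻¹ • ξ) := fun ξ => rfl
  let c : ℂ := (((2 * π) ^ (-(n : ℝ) / 2) : ℝ) : ℂ)
  have mp : ∀ G : EuclideanSpace ℝ (Fin n) → ℂ, ∫ v, G v = ∫ x : Fin n → ℝ, G (L.symm x) := by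
    intro G
    exact ((EuclideanSpace.volume_preserving_symm_measurableEquiv_toLp (Fin n)).symm.integral_comp
      (MeasurableEquiv.measurableEmbedding _) G).symm
  have hin : ∀ x y : Fin n → ℝ, inner ℝ (L.symm x) (L.symm y) = ∑ i, x i * y i := by
    intro x y
    rw [PiLp.inner_apply]
    refine Finset.sum_congr rfl fun i _ => ?_
    change y i * x i = _
    ring
  refine ⟨c • SchwartzMap.compCLMOfContinuousLinearEquiv ℂ M (FourierTransform.fourier F), ?_, ?_⟩
  · intro ξ
    change ft n f ξ = c * (FourierTransform.fourier F) (M ξ)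
    rw [SchwartzMap.fourier_coe, Real.fourier_eq', mp, ft]
    congr 1
    congr 1; ext x
    rw [hFv, hM, hin, smul_eq_mul]
    congr 2
    · simp only [Pi.smul_apply, smul_eq_mul]
      have : -2 * π * ∑ i, x i * ((2 * π)⁻¹ * ξ i) = - ∑ i, ξ i * x i := by
        rw [Finset.mul_sum, ← Finset.sum_neg_distrib]
        refine Finset.sum_congr rfl fun i _ => ?_
        field_simp
      rw [this]; push_cast; ring
  · intro x
    have h1 : f x = (FourierTransformInv.fourierInv (FourierTransform.fourier F)) (L.symm x) := by
      rw [FourierTransform.fourierInv_fourier_eq, hFv]; simp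
    rw [h1, SchwartzMap.fourierInv_coe, Real.fourierInv_eq', mp]
    have h2 := Measure.integral_comp_smul (volume : Measure (Fin n → ℝ))
      (fun η => Complex.exp (((2 * π * inner ℝ (L.symm η) (L.symm x) : ℝ) : ℂ) * Complex.I) •
        (FourierTransform.fourier F) (L.symm η)) ((2 * π)⁻¹)
    simp only [Module.finrank_fin_fun] at h2
    have h3 : ∀ ξ : Fin n → ℝ, Complex.exp (Complex.I * ((∑ i, x i * ξ i : ℝ) : ℂ)) *
        (c • SchwartzMap.compCLMOfContinuousLinearEquiv ℂ M (FourierTransform.fourier F)) ξ =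
        c * (Complex.exp (((2 * π * inner ℝ (L.symm ((2 * π)⁻¹ • ξ)) (L.symm x) : ℝ) : ℂ) * Complex.I) •
        (FourierTransform.fourier F) (L.symm ((2 * π)⁻¹ • ξ))) := by
      intro ξ
      change _ * (c * (FourierTransform.fourier F) (M ξ)) = _
      rw [hM, hin, smul_eq_mul]
      have : 2 * π * ∑ i, ((2 * π)⁻¹ • ξ) i * x i = ∑ i, x i * ξ i := by
        simp only [Pi.smul_apply, smul_eq_mul]
        rw [Finset.mul_sum]
        refine Finset.sum_congr rfl fun i _ => ?_
        field_simp
      rw [this, mul_comm Complex.I]; ring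
    simp_rw [h3]
    rw [integral_const_mul, h2, ← mul_assoc, Complex.real_smul, ← mul_assoc]
    have h4 : c * c * ((|(((2 * π)⁻¹) ^ n)⁻¹| : ℝ) : ℂ) = 1 := by
      simp only [c]
      rw [← Complex.ofReal_mul, ← Complex.ofReal_mul, ← Complex.ofReal_one]
      congr 1
      rw [abs_of_pos (by positivity), ← Real.rpow_add (by positivity), ← Real.rpow_natCast,
        Real.inv_rpow (by positivity), inv_inv, ← Real.rpow_add (by positivity)]
      rw [show -(n:ℝ) / 2 + -(n:ℝ) / 2 + n = 0 by ring, Real.rpow_zero]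
    change _ = c * c * _ * _
    rw [h4, one_mul]


lemma heat_fourier (ι : Type*) [Fintype ι] {t : ℝ} (ht : 0 < t) (ξ : ι → ℝ) :
    ∫ v : ι → ℝ, (heat ι t v : ℂ) * Complex.exp (-(Complex.I * ((∑ i, v i * ξ i : ℝ) : ℂ))) =
      ((Real.exp (-(t * ∑ i, ξ i ^ 2)) : ℝ) : ℂ) := by
  have h := GaussianFourier.integral_cexp_neg_sum_mul_add (ι := ι)
    (b := fun _ => ((1 / (4 * t) : ℝ) : ℂ))
    (fun i => by rw [Complex.ofReal_re]; positivity) (fun i => -(Complex.I * ξ i))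
  have e1 : ∀ v : ι → ℝ, (heat ι t v : ℂ) * Complex.exp (-(Complex.I * ((∑ i, v i * ξ i : ℝ) : ℂ))) =
      (((√(4 * π * t))⁻¹ ^ (Fintype.card ι) : ℝ) : ℂ) *
      Complex.exp (-∑ i, ((1 / (4 * t) : ℝ) : ℂ) * (v i : ℂ) ^ 2 + ∑ i, -(Complex.I * ξ i) * (v i : ℂ)) := by
    intro v
    rw [heat, Complex.ofReal_mul, mul_assoc, Complex.ofReal_exp, ← Complex.exp_add]
    congr 2
    push_cast
    rw [← Finset.mul_sum, Finset.mul_sum, ← Finset.sum_neg_distrib]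
    congr 1
    · ring
    · refine Finset.sum_congr rfl fun i _ => ?_
      ring
  simp_rw [e1]
  rw [integral_const_mul, h, Finset.prod_mul_distrib, Finset.prod_const, Finset.card_univ,
    ← Complex.exp_sum, ← mul_assoc]
  have e2 : ((π : ℂ) / ((1 / (4 * t) : ℝ) : ℂ)) ^ (1 / 2 : ℂ) = ((√(4 * π * t) : ℝ) : ℂ) := by
    rw [Real.sqrt_eq_rpow, Complex.ofReal_cpow (by positivity)]
    congr 1
    · push_cast
      have : (t : ℂ) ≠ 0 := by exact_mod_cast ht.ne'
      field_simp
    · norm_num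
  rw [e2]
  have e3 : (((√(4 * π * t))⁻¹ ^ (Fintype.card ι) : ℝ) : ℂ) * ((√(4 * π * t) : ℝ) : ℂ) ^ (Fintype.card ι) = 1 := by
    rw [← Complex.ofReal_pow, ← Complex.ofReal_mul, ← mul_pow, inv_mul_cancel₀ (by positivity)]
    simp
  rw [e3, one_mul, Complex.ofReal_exp]
  congr 1
  push_cast
  rw [Finset.mul_sum, ← Finset.sum_neg_distrib]
  refine Finset.sum_congr rfl fun i _ => ?_
  have : (t : ℂ) ≠ 0 := by exact_mod_cast ht.ne'
  rw [neg_sq, mul_pow, Complex.I_sq]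
  field_simp

lemma heat_integrable (ι : Type*) [Fintype ι] {t : ℝ} (ht : 0 < t) :
    Integrable (fun v : ι → ℝ => (heat ι t v : ℂ)) := by
  have h := heat_fourier ι ht 0
  simp only [Pi.zero_apply, mul_zero, Finset.sum_const_zero, Complex.ofReal_zero, neg_zero,
    Complex.exp_zero, mul_one] at h
  by_contra hh
  rw [integral_undef hh] at h
  simp at h

lemma measurable_heat (ι : Type*) [Fintype ι] : Measurable (fun z : ℝ × (ι → ℝ) => heat ι z.1 z.2) := by
  unfold heat; fun_prop

/-- The character `e^{i x·ξ}`. -/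
def ech {n : ℕ} (x ξ : Fin n → ℝ) : ℂ := Complex.exp (Complex.I * ((∑ i, x i * ξ i : ℝ) : ℂ))

lemma norm_ech {n : ℕ} (x ξ : Fin n → ℝ) : ‖ech x ξ‖ = 1 := by
  rw [ech, mul_comm, Complex.norm_exp_ofReal_mul_I]

lemma continuous_ech {n : ℕ} : Continuous (fun z : (Fin n → ℝ) × (Fin n → ℝ) => ech z.1 z.2) := by
  unfold ech; fun_prop

lemma heat_conv {n : ℕ} (S : Finset (Fin n)) {t : ℝ} (ht : 0 < t) (x : Fin n → ℝ)
    (ψ : (Fin n → ℝ) → ℂ) (hψ : Integrable ψ) :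
    ∫ ξ, ech x ξ * ((Real.exp (-(t * ∑ i ∈ S, ξ i ^ 2)) : ℝ) : ℂ) * ψ ξ =
      ∫ y : S → ℝ, (heat S t (fun i => x i - y i) : ℂ) *
        ∫ ξ, ech (Function.updateFinset x S y) ξ * ψ ξ := by
  have e0 : ∀ (v : S → ℝ) ξ, ech (Function.updateFinset x S (fun i => x i - v i)) ξ =
      ech x ξ * Complex.exp (-(Complex.I * ((∑ i : S, v i * ξ i : ℝ) : ℂ))) := by
    intro v ξ
    rw [ech, ech, ← Complex.exp_add]
    congr 1
    rw [← mul_neg, ← mul_add, ← Complex.ofReal_neg, ← Complex.ofReal_add]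
    congr 2
    have h1 : ∀ i, Function.updateFinset x S (fun i => x i - v i) i * ξ i =
        x i * ξ i - (if h : i ∈ S then v ⟨i, h⟩ * ξ i else 0) := by
      intro i
      by_cases h : i ∈ S <;> simp [Function.updateFinset, h, sub_mul]
    simp_rw [h1]
    rw [Finset.sum_sub_distrib, sub_eq_add_neg]
    congr 2
    rw [Finset.sum_dite]
    simp only [Finset.sum_const_zero, add_zero]
    refine Finset.sum_bij (fun a _ => ⟨a.1, (Finset.mem_filter.mp a.2).2⟩) ?_ ?_ ?_ ?_
    · simp
    · intro a _ b _ h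
      exact Subtype.ext (by simpa using h)
    · intro b _
      exact ⟨⟨b.1, by simp⟩, by simp, rfl⟩
    · simp
  rw [← integral_sub_left_eq_self (fun y : S → ℝ => (heat S t (fun i => x i - y i) : ℂ) *
        ∫ ξ, ech (Function.updateFinset x S y) ξ * ψ ξ) volume (fun i : S => x i)]
  have e1 : ∀ v : S → ℝ, ((fun i : S => x i) - v) = fun i : S => x i - v i := fun v => rfl
  have e2 : ∀ v : S → ℝ, (fun i : S => x i - ((fun i : S => x i) - v) i) = v := by
    intro v; ext i; simp
  simp_rw [e2, e1, e0, ← integral_const_mul]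
  rw [integral_integral_swap]
  · congr 1; ext ξ
    have := heat_fourier S ht (fun i : S => ξ i)
    rw [Finset.sum_coe_sort S (fun i => ξ i ^ 2)] at this
    rw [← this, ← integral_const_mul, ← integral_mul_const]
    congr 1; ext v
    ring
  · have h1 : Integrable (fun z : (S → ℝ) × (Fin n → ℝ) => (heat S t z.1 : ℂ) * ψ z.2) :=
      (heat_integrable S ht).mul_prod hψ
    have h2 : Integrable (fun z : (S → ℝ) × (Fin n → ℝ) =>
        (ech x z.2 * Complex.exp (-(Complex.I * ((∑ i : S, z.1 i * z.2 i : ℝ) : ℂ)))) *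
          ((heat S t z.1 : ℂ) * ψ z.2)) := by
      refine h1.bdd_mul (c := 1) ?_ ?_
      · refine Continuous.aestronglyMeasurable ?_
        unfold ech; fun_prop
      · refine Filter.Eventually.of_forall fun z => ?_
        rw [norm_mul, norm_ech, one_mul, ← mul_neg, ← Complex.ofReal_neg, mul_comm Complex.I,
          Complex.norm_exp_ofReal_mul_I]
    refine h2.congr (Filter.Eventually.of_forall fun z => ?_)
    simp only [Function.uncurry]
    ring


lemma symbol_integrable {n : ℕ} (S : Finset (Fin n)) {s : ℝ} (hs : 0 < s)
    (φ : SchwartzMap (Fin n → ℝ) ℂ) :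
    Integrable (fun ξ : Fin n → ℝ => (((∑ i ∈ S, ξ i ^ 2) ^ (s / 2) : ℝ) : ℂ) * φ ξ) := by
  obtain ⟨N, hN⟩ := exists_nat_ge s
  have h0 : Integrable (fun ξ => ‖φ ξ‖) := by
    simpa using φ.integrable_pow_mul volume 0
  have h1 := φ.integrable_pow_mul volume N
  refine Integrable.mono' ((h0.add h1).const_mul ((n : ℝ) ^ (s / 2))) ?_ ?_
  · refine (Measurable.aestronglyMeasurable ?_).mul φ.continuous.aestronglyMeasurable
    fun_prop
  · refine Filter.Eventually.of_forall fun ξ => ?_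
    have hρ : 0 ≤ ∑ i ∈ S, ξ i ^ 2 := Finset.sum_nonneg fun _ _ => sq_nonneg _
    rw [norm_mul, Complex.norm_real, Real.norm_eq_abs, abs_of_nonneg (by positivity)]
    simp only [Pi.add_apply]
    have e1 : ∑ i ∈ S, ξ i ^ 2 ≤ n * ‖ξ‖ ^ 2 := by
      calc ∑ i ∈ S, ξ i ^ 2 ≤ ∑ i : Fin n, ξ i ^ 2 :=
            Finset.sum_le_univ_sum_of_nonneg fun _ => sq_nonneg _
        _ ≤ ∑ i : Fin n, ‖ξ‖ ^ 2 := by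
            refine Finset.sum_le_sum fun i _ => ?_
            rw [← sq_abs]
            gcongr
            exact norm_le_pi_norm ξ i
        _ = _ := by simp
    have e2 : (∑ i ∈ S, ξ i ^ 2) ^ (s / 2) ≤ (n : ℝ) ^ (s / 2) * ‖ξ‖ ^ s := by
      calc _ ≤ (n * ‖ξ‖ ^ 2) ^ (s / 2) := Real.rpow_le_rpow hρ e1 (by positivity)
        _ = _ := by
          rw [Real.mul_rpow (by positivity) (by positivity), ← Real.rpow_natCast ‖ξ‖ 2,
            ← Real.rpow_mul (norm_nonneg _)]
          congr 2; push_cast; ring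
    have e3 : ‖ξ‖ ^ s ≤ 1 + ‖ξ‖ ^ N := by
      rcases le_total ‖ξ‖ 1 with h | h
      · have := Real.rpow_le_one (norm_nonneg ξ) h hs.le
        have : 0 ≤ ‖ξ‖ ^ N := by positivity
        linarith
      · have := Real.rpow_le_rpow_of_exponent_le h hN
        rw [Real.rpow_natCast] at this
        linarith
    calc _ ≤ ((n : ℝ) ^ (s / 2) * (1 + ‖ξ‖ ^ N)) * ‖φ ξ‖ := by
          gcongr
          exact e2.trans (by gcongr)
      _ = _ := by ring

lemma time_integral {ρ s : ℝ} (hs : 0 < s) (hρ : 0 < ρ) :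
    ∫ t in Ioi (0:ℝ), t ^ (s / 2 - 1) * Real.exp (-(t * ρ)) * ρ ^ (s / 2) = Real.Gamma (s / 2) := by
  have := Real.integral_rpow_mul_exp_neg_mul_Ioi (a := s / 2) (r := ρ) (by positivity) hρ
  rw [integral_mul_const]
  simp_rw [mul_comm _ ρ]
  rw [this, one_div, Real.inv_rpow hρ.le]
  field_simp

lemma time_integrable {ρ s : ℝ} (hs : 0 < s) (hρ : 0 ≤ ρ) :
    IntegrableOn (fun t : ℝ => t ^ (s / 2 - 1) * Real.exp (-(t * ρ)) * ρ ^ (s / 2)) (Ioi 0) := by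
  rcases hρ.eq_or_lt with rfl | hρ
  · simp [Real.zero_rpow (by positivity : s / 2 ≠ 0)]
  · have := time_integral hs hρ
    by_contra hh
    rw [integral_undef hh] at this
    exact (Real.Gamma_pos_of_pos (by positivity : 0 < s / 2)).ne this

lemma time_fubini {n : ℕ} (S : Finset (Fin n)) (hS : S.Nonempty) {s : ℝ} (hs : 0 < s)
    (φ : SchwartzMap (Fin n → ℝ) ℂ) (x : Fin n → ℝ) :
    (Real.Gamma (s / 2) : ℂ) * ∫ ξ, ech x ξ * φ ξ =
      ∫ t in Ioi (0:ℝ), ((t ^ (s / 2 - 1) : ℝ) : ℂ) *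
        ∫ ξ, ech x ξ * ((Real.exp (-(t * ∑ i ∈ S, ξ i ^ 2)) : ℝ) : ℂ) *
          ((((∑ i ∈ S, ξ i ^ 2) ^ (s / 2) : ℝ) : ℂ) * φ ξ) := by
  have hnn : ∀ ξ : Fin n → ℝ, 0 ≤ ∑ i ∈ S, ξ i ^ 2 := fun ξ => Finset.sum_nonneg fun _ _ => sq_nonneg _
  have hpos : ∀ᵐ ξ : Fin n → ℝ, 0 < ∑ i ∈ S, ξ i ^ 2 := by
    obtain ⟨i, hi⟩ := hS
    have e0 : ∀ᵐ v : ℝ, v ≠ 0 := by simp [ae_iff]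
    have := (Measure.quasiMeasurePreserving_eval (fun _ : Fin n => (volume : Measure ℝ)) i).ae e0
    rw [volume_pi]
    filter_upwards [this] with ξ hξ
    exact lt_of_lt_of_le (by positivity)
      (Finset.single_le_sum (f := fun i => ξ i ^ 2) (fun _ _ => sq_nonneg _) hi)
  have hφ : Integrable (fun ξ => φ ξ) := φ.integrable
  let K : ℝ → (Fin n → ℝ) → ℝ := fun t ξ =>
    t ^ (s / 2 - 1) * Real.exp (-(t * ∑ i ∈ S, ξ i ^ 2)) * (∑ i ∈ S, ξ i ^ 2) ^ (s / 2)
  have hKm : Measurable (fun z : ℝ × (Fin n → ℝ) => K z.1 z.2) := by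
    simp only [K]; fun_prop
  have hint : Integrable (fun z : ℝ × (Fin n → ℝ) => ech x z.2 * ((K z.1 z.2 : ℂ) * φ z.2))
      ((volume.restrict (Ioi 0)).prod volume) := by
    have hm : AEStronglyMeasurable (fun z : ℝ × (Fin n → ℝ) => ech x z.2 * ((K z.1 z.2 : ℂ) * φ z.2))
      ((volume.restrict (Ioi 0)).prod volume) := by
      refine AEStronglyMeasurable.mul (Continuous.aestronglyMeasurable ?_)
        (AEStronglyMeasurable.mul ?_ (Continuous.aestronglyMeasurable ?_))
      · exact continuous_ech.comp (by fun_prop : Continuous fun z : ℝ × (Fin n → ℝ) => (x, z.2))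
      · exact (Complex.measurable_ofReal.comp hKm).aestronglyMeasurable
      · exact φ.continuous.comp continuous_snd
    rw [integrable_prod_iff' hm]
    constructor
    · refine Filter.Eventually.of_forall fun ξ => ?_
      have := (time_integrable hs (hnn ξ)).ofReal (𝕜 := ℂ)
      exact (this.mul_const (φ ξ)).const_mul (ech x ξ)
    · refine (hφ.norm.const_mul (Real.Gamma (s / 2))).congr ?_
      filter_upwards [hpos] with ξ hξ
      have h1 := time_integral hs hξ
      rw [← h1, ← integral_mul_const]
      refine setIntegral_congr_fun measurableSet_Ioi fun t ht => ?_
      have ht : 0 < t := ht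
      have hK0 : 0 ≤ K t ξ := by simp only [K]; positivity
      simp only [norm_mul, norm_ech, one_mul, Complex.norm_real, Real.norm_eq_abs]
      rw [abs_of_nonneg hK0]
  have hsw := integral_integral_swap (f := fun t ξ => ech x ξ * ((K t ξ : ℂ) * φ ξ)) hint
  rw [← integral_const_mul]
  calc _ = ∫ ξ, ∫ t in Ioi (0:ℝ), ech x ξ * ((K t ξ : ℂ) * φ ξ) := by
        apply integral_congr_ae
        filter_upwards [hpos] with ξ hξ
        have hk2 : ∫ t in Ioi (0:ℝ), ((K t ξ : ℝ) : ℂ) = (Real.Gamma (s / 2) : ℂ) := by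
          rw [← time_integral hs hξ]
          exact integral_complex_ofReal
        rw [integral_const_mul, integral_mul_const, hk2]
        ring
    _ = _ := by
        rw [← hsw]
        refine setIntegral_congr_fun measurableSet_Ioi fun t ht => ?_
        rw [← integral_const_mul]
        congr 1; ext ξ
        simp only [K]; push_cast; ring

lemma riesz_pointwise {n : ℕ} (S : Finset (Fin n)) (hS : S.Nonempty) (β : Fin n → ℝ)
    (hβ : ∀ i ∈ S, 0 < β i) (hβ1 : ∀ i ∈ S, β i < 1) :
    ∃ C : ℝ≥0∞, C ≠ ⊤ ∧ ∀ f : (Fin n → ℝ) → ℂ, ContDiff ℝ (⊤ : ℕ∞) f → HasCompactSupport f →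
      Continuous (fracLapOn n S (∑ i ∈ S, β i) f) ∧
      ∀ x, ‖f x‖ₑ ≤ C * ∫⁻ y : S → ℝ, (∏ i : S, pw (β i - 1) (x i - y i)) *
        ‖fracLapOn n S (∑ i ∈ S, β i) f (Function.updateFinset x S y)‖ₑ := by
  set s := ∑ i ∈ S, β i with hsdef
  have hs : 0 < s := Finset.sum_pos hβ hS
  have : Nonempty S := hS.to_subtype
  obtain ⟨C, hC, hB⟩ := heat_time_bound S (fun i => β i) (fun i => hβ1 i i.2)
  rw [Finset.sum_coe_sort S β, ← hsdef] at hB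
  have hG : 0 < Real.Gamma (s / 2) := Real.Gamma_pos_of_pos (by positivity)
  refine ⟨ENNReal.ofReal (Real.Gamma (s / 2))⁻¹ * C, ENNReal.mul_ne_top ENNReal.ofReal_ne_top hC,
    fun f hf hc => ?_⟩
  obtain ⟨φ, hφ, hinv⟩ := ft_schwartz_s3 n f hf hc
  set c : ℂ := (((2 * π) ^ (-(n : ℝ) / 2) : ℝ) : ℂ) with hcdef
  set ψ : (Fin n → ℝ) → ℂ := fun ξ => (((∑ i ∈ S, ξ i ^ 2) ^ (s / 2) : ℝ) : ℂ) * φ ξ with hψdef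
  have hψ : Integrable ψ := symbol_integrable S hs φ
  have hg : ∀ z, fracLapOn n S s f z = c * ∫ ξ, ech z ξ * ψ ξ := by
    intro z
    rw [fracLapOn, ft]
    congr 2; ext ξ
    rw [hφ, ech]
    congr 3
    simp
  have hgc : Continuous (fracLapOn n S s f) := by
    rw [show fracLapOn n S s f = fun z => c * ∫ ξ, ech z ξ * ψ ξ from funext hg]
    refine continuous_const.mul (continuous_of_dominated (bound := fun ξ => ‖ψ ξ‖) ?_ ?_ hψ.norm ?_)
    · intro z
      refine AEStronglyMeasurable.mul (Continuous.aestronglyMeasurable ?_) hψ.1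
      exact continuous_ech.comp (by fun_prop : Continuous fun ξ : Fin n → ℝ => (z, ξ))
    · intro z
      refine Filter.Eventually.of_forall fun ξ => ?_
      rw [norm_mul, norm_ech, one_mul]
    · refine Filter.Eventually.of_forall fun ξ => ?_
      exact (continuous_ech.comp (by fun_prop : Continuous fun z : Fin n → ℝ => (z, ξ))).mul
        continuous_const
  refine ⟨hgc, fun x => ?_⟩
  have hx : f x = ((Real.Gamma (s / 2))⁻¹ : ℝ) * ∫ t in Ioi (0:ℝ), ((t ^ (s / 2 - 1) : ℝ) : ℂ) *
      ∫ y : S → ℝ, (heat S t (fun i => x i - y i) : ℂ) *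
        fracLapOn n S s f (Function.updateFinset x S y) := by
    have h1 := time_fubini S hS hs φ x
    have h2 : f x = c * ∫ ξ, ech x ξ * φ ξ := hinv x
    have hGc : (Real.Gamma (s / 2) : ℂ) ≠ 0 := by exact_mod_cast hG.ne'
    have h3 : f x = ((Real.Gamma (s / 2))⁻¹ : ℝ) * (c * ((Real.Gamma (s / 2) : ℂ) * ∫ ξ, ech x ξ * φ ξ)) := by
      rw [h2]; push_cast; field_simp
    rw [h3, h1, ← integral_const_mul c]
    congr 1
    refine setIntegral_congr_fun measurableSet_Ioi fun t ht => ?_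
    rw [heat_conv S ht x ψ hψ]
    simp_rw [hg]
    rw [mul_left_comm, ← integral_const_mul c]
    congr 2; ext y; ring
  rw [hx, enorm_mul, mul_assoc]
  have hge : ∀ r : ℝ, 0 ≤ r → ‖(r : ℂ)‖ₑ = ENNReal.ofReal r := by
    intro r hr
    rw [← ofReal_norm, Complex.norm_real, Real.norm_of_nonneg hr]
  rw [hge _ (by positivity)]
  gcongr
  have mU : Measurable (fun y : S → ℝ => Function.updateFinset x S y) := measurable_updateFinset
  have mH : Measurable (fun z : ℝ × (S → ℝ) => heat S z.1 (fun i => x i - z.2 i)) := by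
    have h1 : Measurable (fun z : ℝ × (S → ℝ) => ((z.1, fun i => x i - z.2 i) : ℝ × (S → ℝ))) := by
      fun_prop
    exact (measurable_heat S).comp h1
  have mg : Measurable (fun y : S → ℝ => ‖fracLapOn n S s f (Function.updateFinset x S y)‖ₑ) :=
    (hgc.measurable.comp mU).enorm
  calc _ ≤ ∫⁻ t in Ioi (0:ℝ), ENNReal.ofReal (t ^ (s / 2 - 1)) * ∫⁻ y : S → ℝ,
        ENNReal.ofReal (heat S t (fun i => x i - y i)) *
          ‖fracLapOn n S s f (Function.updateFinset x S y)‖ₑ := by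
        refine (enorm_integral_le_lintegral_enorm _).trans ?_
        refine setLIntegral_mono' measurableSet_Ioi fun t ht => ?_
        have ht : 0 < t := ht
        rw [enorm_mul, hge _ (by positivity)]
        gcongr
        refine (enorm_integral_le_lintegral_enorm _).trans (lintegral_mono fun y => ?_)
        simp only
        rw [enorm_mul, hge _ (heat_nonneg _ _ _)]
    _ = ∫⁻ t in Ioi (0:ℝ), ∫⁻ y : S → ℝ, ENNReal.ofReal (t ^ (s / 2 - 1)) *
        (ENNReal.ofReal (heat S t (fun i => x i - y i)) *
          ‖fracLapOn n S s f (Function.updateFinset x S y)‖ₑ) := by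
        congr 1; ext t
        rw [lintegral_const_mul' _ _ ENNReal.ofReal_ne_top]
    _ = ∫⁻ y : S → ℝ, ∫⁻ t in Ioi (0:ℝ), ENNReal.ofReal (t ^ (s / 2 - 1)) *
        (ENNReal.ofReal (heat S t (fun i => x i - y i)) *
          ‖fracLapOn n S s f (Function.updateFinset x S y)‖ₑ) := by
        rw [lintegral_lintegral_swap]
        refine Measurable.aemeasurable ?_
        refine Measurable.mul (by fun_prop) ((mH.ennreal_ofReal).mul (mg.comp measurable_snd))
    _ ≤ ∫⁻ y : S → ℝ, C * ((∏ i : S, pw (β i - 1) (x i - y i)) *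
        ‖fracLapOn n S s f (Function.updateFinset x S y)‖ₑ) := by
        refine lintegral_mono fun y => ?_
        simp only
        simp_rw [← mul_assoc]
        rw [lintegral_mul_const' _ _ enorm_ne_top]
        gcongr
        exact hB (fun i => x i - y i)
    _ = _ := by rw [lintegral_const_mul' _ _ hC]

/-- The weight is dominated by a product of one-dimensional weights. -/
lemma weight_bound {n m : ℕ} (G : Fin m → Finset (Fin n))
    (hGdisj : ∀ j j', j ≠ j' → Disjoint (G j) (G j'))
    (α : Fin m → ℝ) (β : Fin n → ℝ) (hβ : ∀ i ∈ Finset.univ.biUnion G, 0 < β i)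
    (hsum : ∀ j, ∑ i ∈ G j, β i = α j) (f : (Fin n → ℝ) → ℂ) (x : Fin n → ℝ) :
    ‖f x / (((∏ j, (∑ ℓ ∈ G j, x ℓ ^ 2) ^ (α j / 2) : ℝ)) : ℂ)‖ₑ ≤
      (∏ i ∈ Finset.univ.biUnion G, pw (-β i) (x i)) * ‖f x‖ₑ := by
  have h1 : ‖((((∏ j, (∑ ℓ ∈ G j, x ℓ ^ 2) ^ (α j / 2) : ℝ))⁻¹ : ℝ) : ℂ)‖ₑ =
      ∏ j, ENNReal.ofReal ((∑ ℓ ∈ G j, x ℓ ^ 2) ^ (-(∑ i ∈ G j, β i) / 2)) := by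
    rw [← ofReal_norm, Complex.norm_real, Real.norm_eq_abs, abs_of_nonneg
      (inv_nonneg.2 (Finset.prod_nonneg fun j _ => by positivity)), ← Finset.prod_inv_distrib,
      ENNReal.ofReal_prod_of_nonneg (fun j _ => by positivity)]
    refine Finset.prod_congr rfl fun j _ => ?_
    rw [hsum, neg_div, Real.rpow_neg (by positivity)]
  rw [div_eq_mul_inv, ← Complex.ofReal_inv, enorm_mul, h1, mul_comm, Finset.prod_biUnion
    (fun j _ j' _ h => hGdisj j j' h)]
  gcongr with j
  exact sum_sq_rpow_le (G j) β (fun i hi => hβ i (Finset.mem_biUnion.2 ⟨j, Finset.mem_univ _, hi⟩)) x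

/-- **Theorem 1.2: anisotropic Hardy–Sobolev inequality with several radial weights.**
Given pairwise disjoint nonempty groups `G j` of coordinates of `ℝⁿ` (of cardinalities
`k_j`), `1 < p < ∞` and `0 < α_j < k_j/p`, one has
`‖ f / ∏_j r_j^{α_j} ‖_{L^p} ≤ C ‖ Λ^{∑ α_j}_{(selected coordinates)} f ‖_{L^p}`
for all `f ∈ C_0^∞(ℝⁿ)`, where `r_j` is the Euclidean norm of the `j`-th group of
coordinates and the fractional derivative acts only in the selected coordinates. -/
theorem anisotropic_hardy_sobolev_radial_weights
    (n m : ℕ) (hm : 1 ≤ m) (G : Fin m → Finset (Fin n))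
    (hGne : ∀ j, (G j).Nonempty)
    (hGdisj : ∀ j j', j ≠ j' → Disjoint (G j) (G j'))
    (p : ℝ) (hp : 1 < p) (α : Fin m → ℝ)
    (hα : ∀ j, 0 < α j) (hα' : ∀ j, α j < (G j).card / p) :
    ∃ C : ℝ, 0 < C ∧ ∀ f : (Fin n → ℝ) → ℂ,
      ContDiff ℝ (⊤ : ℕ∞) f → HasCompactSupport f →
      eLpNorm
          (fun x => f x / (((∏ j, (∑ ℓ ∈ G j, x ℓ ^ 2) ^ (α j / 2) : ℝ)) : ℂ))
          (ENNReal.ofReal p) volume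
        ≤ ENNReal.ofReal C *
          eLpNorm (fracLapOn n (Finset.univ.biUnion G) (∑ j, α j) f)
            (ENNReal.ofReal p) volume := by
  classical
  set S := Finset.univ.biUnion G with hSdef
  have hp0 : 0 < p := by linarith
  have hpq := Real.HolderConjugate.conjExponent hp
  set β : Fin n → ℝ := fun i => ∑ j, if i ∈ G j then α j / (G j).card else 0 with hβdef
  have hβG : ∀ j, ∀ i ∈ G j, β i = α j / (G j).card := by
    intro j i hi
    rw [hβdef]
    simp only
    rw [Finset.sum_eq_single j, if_pos hi]
    · intro j' _ hj'
      rw [if_neg]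
      exact fun h => Finset.disjoint_left.1 (hGdisj j j' hj'.symm) hi h
    · simp
  have hcard : ∀ j, (0:ℝ) < (G j).card := fun j => by exact_mod_cast (hGne j).card_pos
  have hsum : ∀ j, ∑ i ∈ G j, β i = α j := by
    intro j
    rw [Finset.sum_congr rfl (hβG j), Finset.sum_const, nsmul_eq_mul]
    have := hcard j
    field_simp
  have hβ : ∀ i ∈ S, 0 < β i := by
    intro i hi
    obtain ⟨j, -, hj⟩ := Finset.mem_biUnion.1 hi
    rw [hβG j i hj]
    exact div_pos (hα j) (hcard j)
  have hβ' : ∀ i ∈ S, β i < 1 / p := by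
    intro i hi
    obtain ⟨j, -, hj⟩ := Finset.mem_biUnion.1 hi
    rw [hβG j i hj, div_lt_iff₀ (hcard j)]
    calc _ < _ := hα' j
      _ = _ := by ring
  have hβ1 : ∀ i ∈ S, β i < 1 := fun i hi =>
    (hβ' i hi).trans (by rw [div_lt_one hp0]; exact hp)
  have hsumS : ∑ i ∈ S, β i = ∑ j, α j := by
    rw [hSdef, Finset.sum_biUnion (fun j _ j' _ h => hGdisj j j' h)]
    exact Finset.sum_congr rfl fun j _ => hsum j
  have hSne : S.Nonempty := by
    obtain ⟨i, hi⟩ := hGne ⟨0, hm⟩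
    exact ⟨i, Finset.mem_biUnion.2 ⟨_, Finset.mem_univ _, hi⟩⟩
  obtain ⟨C₁, hC₁, h₁⟩ := riesz_pointwise S hSne β hβ hβ1
  obtain ⟨C₂, hC₂, h₂⟩ := hop_bound hpq β S hβ hβ'
  rw [hsumS] at h₁
  set D : ℝ≥0∞ := C₁ * C₂ ^ (1 / p) with hD
  have hDtop : D ≠ ⊤ :=
    ENNReal.mul_ne_top hC₁ (ENNReal.rpow_ne_top_of_nonneg (by positivity) hC₂)
  refine ⟨D.toReal + 1, by positivity, fun f hf hc => ?_⟩
  obtain ⟨hgc, hfx⟩ := h₁ f hf hc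
  set g := fracLapOn n S (∑ j, α j) f with hg
  have hDle : D ≤ ENNReal.ofReal (D.toReal + 1) := by
    rw [← ENNReal.ofReal_toReal hDtop, ENNReal.toReal_ofReal ENNReal.toReal_nonneg]
    exact ENNReal.ofReal_le_ofReal (by linarith)
  have hHm : Measurable fun z => ‖g z‖ₑ := hgc.enorm.measurable
  have hpt : ∀ x, ‖f x / (((∏ j, (∑ ℓ ∈ G j, x ℓ ^ 2) ^ (α j / 2) : ℝ)) : ℂ)‖ₑ ≤
      C₁ * hop β S (fun z => ‖g z‖ₑ) x := by
    intro x
    refine (weight_bound G hGdisj α β hβ hsum f x).trans ?_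
    calc _ ≤ (∏ i ∈ S, pw (-β i) (x i)) * _ := mul_le_mul_right (hfx x) _
      _ = C₁ * ((∏ i ∈ S, pw (-β i) (x i)) * _) := mul_left_comm _ _ _
      _ ≤ _ := by
        refine mul_le_mul_right ?_ _
        refine (lintegral_const_mul_le _ _).trans (le_of_eq ?_)
        rw [hop]
        refine lintegral_congr fun y => ?_
        rw [← Finset.prod_coe_sort S, ← mul_assoc, ← Finset.prod_mul_distrib]
        rfl
  have hpe : ENNReal.ofReal p ≠ 0 := by simpa using hp0
  rw [eLpNorm_eq_lintegral_rpow_enorm_toReal hpe ENNReal.ofReal_ne_top,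
    eLpNorm_eq_lintegral_rpow_enorm_toReal hpe ENNReal.ofReal_ne_top, ENNReal.toReal_ofReal hp0.le]
  have hmain : ∫⁻ x, ‖f x / (((∏ j, (∑ ℓ ∈ G j, x ℓ ^ 2) ^ (α j / 2) : ℝ)) : ℂ)‖ₑ ^ p ≤
      C₁ ^ p * (C₂ * ∫⁻ x, ‖g x‖ₑ ^ p) := by
    calc _ ≤ ∫⁻ x, C₁ ^ p * hop β S (fun z => ‖g z‖ₑ) x ^ p := by
          refine lintegral_mono fun x => ?_
          rw [← ENNReal.mul_rpow_of_nonneg _ _ hp0.le]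
          exact ENNReal.rpow_le_rpow (hpt x) hp0.le
      _ = C₁ ^ p * ∫⁻ x, hop β S (fun z => ‖g z‖ₑ) x ^ p :=
          lintegral_const_mul' _ _ (ENNReal.rpow_ne_top_of_nonneg hp0.le hC₁)
      _ ≤ _ := mul_le_mul_right (h₂ _ hHm) _
  have hpi : 0 ≤ 1 / p := by positivity
  refine (ENNReal.rpow_le_rpow hmain hpi).trans ?_
  rw [ENNReal.mul_rpow_of_nonneg _ _ hpi, ENNReal.mul_rpow_of_nonneg _ _ hpi, ← ENNReal.rpow_mul,
    mul_one_div_cancel hp0.ne', ENNReal.rpow_one, ← mul_assoc]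
  exact mul_le_mul_left hDle _
end
end

section
/- Let p>1 and let α satisfy max{1 − 2/p, 0} < α < 1/p. Write r = √(x_1² + x_2²) for points (x_1,x_2,x_3) ∈ ℝ³. Then there exists a constant C>0 such that for all f ∈ C_0^∞(ℝ³), ‖ f / ( r^{1−α} |x_3|^{α} ) ‖_{L^p(ℝ³)} ≤ C ‖ ∇f ‖_{L^p(ℝ³)}. -/
open MeasureTheory ENNReal Real Set

noncomputable section

lemma hs_young (p A c : ℝ) (hp : 1 < p) (hA : 0 < A) (hc : 0 < c) :
    ∃ C : ℝ, 0 < C ∧ ∀ X D : ℝ, 0 ≤ X → 0 ≤ D → A * X ^ (p-1) * D ≤ c * X ^ p + C * D ^ p := by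
  refine ⟨A * (A / c) ^ (p - 1), by positivity, fun X D hX hD => ?_⟩
  have hXp : X ^ (p-1) * X = X ^ p := by
    rw [← rpow_add_one' hX (by linarith)]; ring_nf
  have hDp : D ^ (p-1) * D = D ^ p := by
    rw [← rpow_add_one' hD (by linarith)]; ring_nf
  rcases le_total (A * D) (c * X) with h | h
  · have : X ^ (p-1) * (A * D) ≤ X ^ (p-1) * (c * X) := by gcongr
    have h2 : 0 ≤ A * (A / c) ^ (p - 1) * D ^ p := by positivity
    nlinarith
  · have h1 : X ≤ A / c * D := by
      rw [div_mul_eq_mul_div, le_div_iff₀ hc]; linarith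
    have h3 : X ^ (p-1) ≤ (A/c) ^ (p-1) * D ^ (p-1) := by
      rw [← mul_rpow (by positivity) hD]
      exact rpow_le_rpow hX h1 (by linarith)
    have h4 : A * X ^ (p-1) * D ≤ A * ((A/c) ^ (p-1) * D ^ (p-1)) * D := by gcongr
    have h5 : 0 ≤ c * X ^ p := by positivity
    rw [← hDp]
    linarith

/-- pointwise: `√R h1 ≤ h1^(1-1/p)` -/
lemma hs_V (p θ R N : ℝ) (hp : 1 < p) (h0 : 0 ≤ θ) (hR : 0 < R) (hRN : R ≤ N) :
    R ^ (1/2 : ℝ) * (R ^ (-((1-θ)*p)/2) * N ^ (-(θ*p)/2)) ≤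
      (R ^ (-((1-θ)*p)/2) * N ^ (-(θ*p)/2)) ^ ((p-1)/p) := by
  have hN : 0 < N := hR.trans_le hRN
  rw [mul_rpow (by positivity) (by positivity), ← rpow_mul hR.le, ← rpow_mul hN.le, ← mul_assoc,
    ← rpow_add hR]
  have e1 : (1/2 : ℝ) + -((1-θ)*p)/2 = (-((1-θ)*p)/2 * ((p-1)/p)) + θ/2 := by
    field_simp; ring
  have e2 : -(θ*p)/2 = -(θ*p)/2 * ((p-1)/p) + -(θ/2) := by field_simp; ring
  rw [e1, rpow_add hR]
  conv_lhs => rw [e2]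
  rw [rpow_add hN, rpow_neg hN.le]
  have h : R ^ (θ/2) * (N ^ (θ/2))⁻¹ ≤ 1 := by
    rw [← div_eq_mul_inv, div_le_one (by positivity)]
    exact rpow_le_rpow hR.le hRN (by linarith)
  calc _ = (R ^ (-((1-θ)*p)/2 * ((p-1)/p)) * N ^ (-(θ*p)/2 * ((p-1)/p))) *
      (R ^ (θ/2) * (N ^ (θ/2))⁻¹) := by ring
    _ ≤ (R ^ (-((1-θ)*p)/2 * ((p-1)/p)) * N ^ (-(θ*p)/2 * ((p-1)/p))) * 1 := by gcongr
    _ = _ := by ring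

/-- error term -/
lemma hs_err (a b q R N : ℝ) (ha : a ≤ 2) (hR : 0 < R) (hqR : q ≤ R) (hRN : R ≤ N) :
    q * (R ^ (-a/2) * N ^ (-b/2)) / N ≤ N ^ (-(a+b)/2) := by
  have hN : 0 < N := hR.trans_le hRN
  have e : N ^ (-(a+b)/2) = N ^ (1-a/2) * N ^ (-b/2) / N := by
    rw [← rpow_add hN, ← rpow_sub_one hN.ne']; ring_nf
  rw [e]
  have h1 : R * R ^ (-a/2) = R ^ (1-a/2) := by
    rw [mul_comm, ← rpow_add_one hR.ne']; ring_nf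
  have h2 : R ^ (1-a/2) ≤ N ^ (1-a/2) := rpow_le_rpow hR.le hRN (by linarith)
  have h3 : q * R ^ (-a/2) ≤ N ^ (1-a/2) := by
    have : q * R ^ (-a/2) ≤ R * R ^ (-a/2) := by gcongr
    linarith
  rw [← mul_assoc]
  gcongr

/-- comparison -/
lemma hs_W (a b R Z N : ℝ) (ha : 0 ≤ a) (hb : 0 ≤ b) (hR : 0 < R) (hZ : 0 < Z)
    (hN0 : 0 < N) (hN : N ≤ R + Z) :
    R ^ (-a/2) * Z ^ (-b/2) ≤ (2 ^ (a/2) + 2 ^ (b/2)) *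
      (R ^ (-a/2) * N ^ (-b/2) + Z ^ (-b/2) * N ^ (-a/2) + N ^ (-(a+b)/2)) := by
  have key : ∀ (Y c : ℝ), 0 ≤ c → 0 < Y → N ≤ 2 * Y → Y ^ (-c/2) ≤ 2 ^ (c/2) * N ^ (-c/2) := by
    intro Y c hc hY h
    have : (2 * Y) ^ (-c/2) ≤ N ^ (-c/2) := rpow_le_rpow_of_nonpos hN0 h (by linarith)
    rw [mul_rpow (by norm_num) hY.le] at this
    have h2 : (2:ℝ) ^ (c/2) * 2 ^ (-c/2) = 1 := by
      rw [← Real.rpow_add two_pos]; ring_nf; simp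
    calc Y ^ (-c/2) = 2 ^ (c/2) * (2 ^ (-c/2) * Y ^ (-c/2)) := by rw [← mul_assoc, h2, one_mul]
      _ ≤ _ := by gcongr
  have p1 : 0 < R ^ (-a/2) * N ^ (-b/2) := by positivity
  have p2 : 0 < Z ^ (-b/2) * N ^ (-a/2) := by positivity
  have p3 : 0 < N ^ (-(a+b)/2) := by positivity
  have p4 : 0 < (2:ℝ) ^ (a/2) := by positivity
  have p5 : 0 < (2:ℝ) ^ (b/2) := by positivity
  rcases le_total R Z with h | h
  · have := key Z b hb hZ (by linarith)
    have : R ^ (-a/2) * Z ^ (-b/2) ≤ R ^ (-a/2) * (2 ^ (b/2) * N ^ (-b/2)) := by gcongr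
    nlinarith [mul_pos p4 p1, mul_pos p4 p2, mul_pos p4 p3, mul_pos p5 p2, mul_pos p5 p3]
  · have := key R a ha hR (by linarith)
    have : R ^ (-a/2) * Z ^ (-b/2) ≤ (2 ^ (a/2) * N ^ (-a/2)) * Z ^ (-b/2) := by gcongr
    nlinarith [mul_pos p4 p1, mul_pos p5 p1, mul_pos p4 p3, mul_pos p5 p2, mul_pos p5 p3]

lemma hs_core (p c M : ℝ) (hp : 1 < p) (hc : 0 < c) (hM : 0 < M) :
    ∃ C : ℝ, 0 < C ∧ ∀ (f : (Fin 3 → ℝ) → ℝ) (V : Fin 3 → (Fin 3 → ℝ) → ℝ) (H : (Fin 3 → ℝ) → ℝ),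
      ContDiff ℝ (⊤ : ℕ∞) f → HasCompactSupport f → (∀ i, ContDiff ℝ 1 (V i)) → Continuous H →
      (∀ x, 0 ≤ H x) → (∀ x, c * H x ≤ ∑ i, fderiv ℝ (V i) x (Pi.single i 1)) →
      (∀ i x, |V i x| ≤ M * H x ^ ((p-1)/p)) →
      ∫⁻ x, ENNReal.ofReal (|f x| ^ p * H x) ≤
        ENNReal.ofReal C * ∫⁻ x, ‖fderiv ℝ f x‖ₑ ^ p := by
  obtain ⟨C, hC, hY⟩ := hs_young p (3 * p * M) (c/2) hp (by positivity) (by positivity)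
  refine ⟨C * (2 / c), by positivity, ?_⟩
  intro f V H hf hfs hV hHc hH hdiv hVb
  have hf1 : ContDiff ℝ 1 f := hf.of_le (by exact_mod_cast le_top)
  have hfd : Differentiable ℝ f := hf1.differentiable one_ne_zero
  have hu : ContDiff ℝ 1 (fun x => ‖f x‖ ^ p) := hf1.norm_rpow hp
  have hus : HasCompactSupport (fun x => ‖f x‖ ^ p) := by
    apply hfs.comp_left (g := fun y : ℝ => ‖y‖ ^ p)
    simp [Real.zero_rpow (by linarith : p ≠ 0)]
  have hud := fun v => hus.fderiv_apply (𝕜 := ℝ) v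
  have hudc : ∀ v, Continuous (fun x => fderiv ℝ (fun x => ‖f x‖ ^ p) x v) := fun v =>
    (hu.continuous_fderiv one_ne_zero).clm_apply continuous_const
  have hVdc : ∀ i v, Continuous (fun x => fderiv ℝ (V i) x v) := fun i v =>
    ((hV i).continuous_fderiv one_ne_zero).clm_apply continuous_const
  have i1 : ∀ i, Integrable (fun x => ‖f x‖ ^ p * fderiv ℝ (V i) x (Pi.single i 1)) := fun i =>
    (hu.continuous.mul (hVdc i _)).integrable_of_hasCompactSupport hus.mul_right
  have i2 : ∀ i, Integrable
      (fun x => fderiv ℝ (fun x => ‖f x‖ ^ p) x (Pi.single i 1) * V i x) := fun i =>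
    ((hudc _).mul (hV i).continuous).integrable_of_hasCompactSupport (hud _).mul_right
  have ibp : ∀ i, ∫ x, ‖f x‖ ^ p * fderiv ℝ (V i) x (Pi.single i 1) =
      - ∫ x, fderiv ℝ (fun x => ‖f x‖ ^ p) x (Pi.single i 1) * V i x := fun i =>
    integral_mul_fderiv_eq_neg_fderiv_mul_of_integrable (i2 i) (i1 i)
      ((hu.continuous.mul (hV i).continuous).integrable_of_hasCompactSupport hus.mul_right)
      (fun x _ => hu.differentiable one_ne_zero x) (fun x _ => (hV i).differentiable one_ne_zero x)
  have iH : Integrable (fun x => ‖f x‖ ^ p * H x) :=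
    (hu.continuous.mul hHc).integrable_of_hasCompactSupport hus.mul_right
  have hDs : HasCompactSupport (fun x => ‖fderiv ℝ f x‖ ^ p) := by
    apply (hfs.fderiv (𝕜 := ℝ)).comp_left (g := fun y => ‖y‖ ^ p)
    simp [Real.zero_rpow (by linarith : p ≠ 0)]
  have iD : Integrable (fun x => ‖fderiv ℝ f x‖ ^ p) :=
    ((hf1.continuous_fderiv one_ne_zero).norm.rpow_const
      (fun x => Or.inr (by linarith))).integrable_of_hasCompactSupport hDs
  have step1 : ∫ x, c * (‖f x‖ ^ p * H x) ≤
      ∫ x, ∑ i, ‖f x‖ ^ p * fderiv ℝ (V i) x (Pi.single i 1) := by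
    apply integral_mono (iH.const_mul c) (integrable_finsetSum _ (fun i _ => i1 i))
    intro x
    simp only
    rw [← Finset.mul_sum]
    have : ‖f x‖ ^ p * (c * H x) ≤ ‖f x‖ ^ p * ∑ i, fderiv ℝ (V i) x (Pi.single i 1) :=
      mul_le_mul_of_nonneg_left (hdiv x) (by positivity)
    linarith
  have step2 : ∫ x, ∑ i, ‖f x‖ ^ p * fderiv ℝ (V i) x (Pi.single i 1) =
      ∫ x, - ∑ i, fderiv ℝ (fun x => ‖f x‖ ^ p) x (Pi.single i 1) * V i x := by
    rw [integral_finsetSum _ (fun i _ => i1 i), integral_neg, integral_finsetSum _ (fun i _ => i2 i),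
      ← Finset.sum_neg_distrib]
    exact Finset.sum_congr rfl (fun i _ => ibp i)
  have step3 : ∫ x, - ∑ i, fderiv ℝ (fun x => ‖f x‖ ^ p) x (Pi.single i 1) * V i x ≤
      ∫ x, (c/2 * (‖f x‖ ^ p * H x) + C * ‖fderiv ℝ f x‖ ^ p) := by
    apply integral_mono (integrable_finsetSum _ (fun i _ => i2 i)).neg
      ((iH.const_mul _).add (iD.const_mul _))
    intro x
    change - ∑ i, fderiv ℝ (fun x => ‖f x‖ ^ p) x (Pi.single i 1) * V i x ≤
      c/2 * (‖f x‖ ^ p * H x) + C * ‖fderiv ℝ f x‖ ^ p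
    have hterm : ∀ i : Fin 3, -(fderiv ℝ (fun x => ‖f x‖ ^ p) x (Pi.single i 1) * V i x) ≤
        (p * ‖f x‖ ^ (p - 1) * ‖fderiv ℝ f x‖) * (M * H x ^ ((p-1)/p)) := by
      intro i
      refine (neg_le_abs _).trans ?_
      rw [abs_mul]
      refine mul_le_mul ?_ (hVb i x) (abs_nonneg _) (by positivity)
      have h1 := (fderiv ℝ (fun x => ‖f x‖ ^ p) x).le_opNorm (Pi.single i 1)
      have h2 : ‖(Pi.single i 1 : Fin 3 → ℝ)‖ = 1 := by rw [Pi.norm_single]; simp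
      rw [h2, mul_one] at h1
      exact h1.trans (norm_fderiv_norm_rpow_le hfd hp)
    have hsum : - ∑ i, fderiv ℝ (fun x => ‖f x‖ ^ p) x (Pi.single i 1) * V i x ≤
        3 * ((p * ‖f x‖ ^ (p - 1) * ‖fderiv ℝ f x‖) * (M * H x ^ ((p-1)/p))) := by
      rw [Fin.sum_univ_three]
      linarith [hterm 0, hterm 1, hterm 2]
    have hy := hY (‖f x‖ * H x ^ (1/p)) ‖fderiv ℝ f x‖
      (mul_nonneg (norm_nonneg _) (rpow_nonneg (hH x) _)) (norm_nonneg _)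
    rw [mul_rpow (norm_nonneg _) (rpow_nonneg (hH x) _),
      mul_rpow (norm_nonneg _) (rpow_nonneg (hH x) _), ← Real.rpow_mul (hH x),
      ← Real.rpow_mul (hH x), one_div_mul_cancel (by linarith : p ≠ 0), Real.rpow_one,
      one_div_mul_eq_div] at hy
    linarith
  rw [step2] at step1
  have step4 := step1.trans step3
  rw [integral_add (iH.const_mul _) (iD.const_mul _), integral_const_mul, integral_const_mul,
    integral_const_mul] at step4
  have step5 : ∫ x, ‖f x‖ ^ p * H x ≤ C * (2/c) * ∫ x, ‖fderiv ℝ f x‖ ^ p := by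
    have : c / 2 * ∫ x, ‖f x‖ ^ p * H x ≤ C * ∫ x, ‖fderiv ℝ f x‖ ^ p := by linarith
    calc ∫ x, ‖f x‖ ^ p * H x = 2 / c * (c / 2 * ∫ x, ‖f x‖ ^ p * H x) := by field_simp
      _ ≤ 2 / c * (C * ∫ x, ‖fderiv ℝ f x‖ ^ p) := by gcongr
      _ = _ := by ring
  have e1 : ∫⁻ x, ENNReal.ofReal (|f x| ^ p * H x) = ENNReal.ofReal (∫ x, ‖f x‖ ^ p * H x) := by
    rw [ofReal_integral_eq_lintegral_ofReal iH
      (Filter.Eventually.of_forall fun x => mul_nonneg (by positivity) (hH x))]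
    rfl
  have e2 : ∫⁻ x, ‖fderiv ℝ f x‖ₑ ^ p = ENNReal.ofReal (∫ x, ‖fderiv ℝ f x‖ ^ p) := by
    rw [ofReal_integral_eq_lintegral_ofReal iD
      (Filter.Eventually.of_forall fun x => by positivity)]
    refine lintegral_congr fun x => ?_
    rw [← ofReal_norm, ENNReal.ofReal_rpow_of_nonneg (norm_nonneg _) (by linarith)]
  rw [e1, e2, ← ENNReal.ofReal_mul (by positivity)]
  exact ENNReal.ofReal_le_ofReal step5

lemma hs_deriv (a b p K : ℝ) (i : Fin 3) (x : Fin 3 → ℝ) (Q N : (Fin 3 → ℝ) → ℝ)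
    (hQ : DifferentiableAt ℝ Q x) (hN : DifferentiableAt ℝ N x) (hQ0 : 0 < Q x) (hN0 : 0 < N x)
    (hQi : fderiv ℝ Q x (Pi.single i 1) = 2 * x i) (hNi : fderiv ℝ N x (Pi.single i 1) = 2 * x i) :
    fderiv ℝ (fun y => y i * (Q y ^ (-a/2) * N y ^ (-b/2) + K * N y ^ (-p/2))) x (Pi.single i 1) =
      Q x ^ (-a/2) * N x ^ (-b/2) + K * N x ^ (-p/2) -
      (a * (x i ^ 2 * (Q x ^ (-a/2) * N x ^ (-b/2)) / Q x) +
       b * (x i ^ 2 * (Q x ^ (-a/2) * N x ^ (-b/2)) / N x) +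
       K * p * (x i ^ 2 * N x ^ (-p/2) / N x)) := by
  have h1 := hQ.hasFDerivAt.rpow_const (p := -a/2) (Or.inl hQ0.ne')
  have h2 := hN.hasFDerivAt.rpow_const (p := -b/2) (Or.inl hN0.ne')
  have h3 := hN.hasFDerivAt.rpow_const (p := -p/2) (Or.inl hN0.ne')
  have hx : HasFDerivAt (fun y : Fin 3 → ℝ => y i) (ContinuousLinearMap.proj (R := ℝ) i) x :=
    hasFDerivAt_apply i x
  have h := hx.mul ((h1.mul h2).add (h3.const_mul K))
  have h' : HasFDerivAt (fun y => y i * (Q y ^ (-a/2) * N y ^ (-b/2) + K * N y ^ (-p/2))) _ x := h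
  rw [h'.fderiv]
  simp [hQi, hNi, Real.rpow_sub_one hQ0.ne', Real.rpow_sub_one hN0.ne']
  field_simp
  ring

lemma hs_fderivR (ε : ℝ) (x v : Fin 3 → ℝ) :
    fderiv ℝ (fun y : Fin 3 → ℝ => y 0 ^ 2 + y 1 ^ 2 + ε) x v = 2 * x 0 * v 0 + 2 * x 1 * v 1 := by
  have hx : ∀ i : Fin 3, HasFDerivAt (fun y : Fin 3 → ℝ => y i)
    (ContinuousLinearMap.proj (R := ℝ) i) x := fun i =>
    hasFDerivAt_apply i x
  have h := (((hx 0).pow 2).add ((hx 1).pow 2)).add_const ε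
  have h' : HasFDerivAt (fun y : Fin 3 → ℝ => y 0 ^ 2 + y 1 ^ 2 + ε) _ x := h
  rw [h'.fderiv]
  simp

lemma hs_fderivZ (ε : ℝ) (x v : Fin 3 → ℝ) :
    fderiv ℝ (fun y : Fin 3 → ℝ => y 2 ^ 2 + ε) x v = 2 * x 2 * v 2 := by
  have hx : ∀ i : Fin 3, HasFDerivAt (fun y : Fin 3 → ℝ => y i)
    (ContinuousLinearMap.proj (R := ℝ) i) x := fun i =>
    hasFDerivAt_apply i x
  have h := ((hx 2).pow 2).add_const ε
  have h' : HasFDerivAt (fun y : Fin 3 → ℝ => y 2 ^ 2 + ε) _ x := h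
  rw [h'.fderiv]
  simp

lemma hs_fderivN (ε : ℝ) (x v : Fin 3 → ℝ) :
    fderiv ℝ (fun y : Fin 3 → ℝ => y 0 ^ 2 + y 1 ^ 2 + y 2 ^ 2 + ε) x v =
      2 * x 0 * v 0 + 2 * x 1 * v 1 + 2 * x 2 * v 2 := by
  have hx : ∀ i : Fin 3, HasFDerivAt (fun y : Fin 3 → ℝ => y i)
    (ContinuousLinearMap.proj (R := ℝ) i) x := fun i =>
    hasFDerivAt_apply i x
  have h := ((((hx 0).pow 2).add ((hx 1).pow 2)).add ((hx 2).pow 2)).add_const ε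
  have h' : HasFDerivAt (fun y : Fin 3 → ℝ => y 0 ^ 2 + y 1 ^ 2 + y 2 ^ 2 + ε) _ x := h
  rw [h'.fderiv]
  simp

lemma hs_reg (p α : ℝ) (hp : 1 < p) (hα0 : 0 < α) (hα1 : 1 - 2 / p < α) (hα2 : α < 1 / p) :
    ∃ C : ℝ, 0 < C ∧ ∀ (ε : ℝ) (f : (Fin 3 → ℝ) → ℝ), 0 < ε →
      ContDiff ℝ (⊤ : ℕ∞) f → HasCompactSupport f →
      ∫⁻ x, ENNReal.ofReal (|f x| ^ p *
        ((x 0 ^ 2 + x 1 ^ 2 + ε) ^ (-((1-α)*p)/2) * (x 2 ^ 2 + ε) ^ (-(α*p)/2))) ≤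
        ENNReal.ofReal C * ∫⁻ x, ‖fderiv ℝ f x‖ₑ ^ p := by
  have hp0 : 0 < p := by linarith
  have hb1 : α * p < 1 := by rwa [lt_div_iff₀ hp0] at hα2
  have ha2 : (1 - α) * p < 2 := by
    have : 1 - α < 2 / p := by linarith
    rwa [lt_div_iff₀ hp0] at this
  have hα1' : α < 1 := by nlinarith
  have hbpos : 0 < α * p := by positivity
  have hapos : 0 < (1 - α) * p := mul_pos (by linarith) hp0
  have hab : (1 - α) * p + α * p = p := by ring
  obtain ⟨K, hK⟩ : ∃ K, K = (p + 1) / (3 - p) := ⟨_, rfl⟩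
  have h3p : 0 < 3 - p := by linarith
  have hKpos : 0 < K := by rw [hK]; positivity
  have hK3 : K * (3 - p) = p + 1 := by rw [hK]; field_simp
  obtain ⟨c, hc⟩ : ∃ c, c = min (min (2 - (1-α)*p) (1 - α*p)) 1 := ⟨_, rfl⟩
  have hcpos : 0 < c := by rw [hc]; simp; constructor <;> linarith
  have hca : c ≤ 2 - (1-α)*p := by rw [hc]; exact (min_le_left _ _).trans (min_le_left _ _)
  have hcb : c ≤ 1 - α*p := by rw [hc]; exact (min_le_left _ _).trans (min_le_right _ _)
  have hc1 : c ≤ 1 := by rw [hc]; exact min_le_right _ _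
  obtain ⟨C, hC, hcore⟩ := hs_core p c (1 + K) hp hcpos (by positivity)
  obtain ⟨B, hB⟩ : ∃ B : ℝ, B = (2 ^ (((1-α)*p)/2) + 2 ^ ((α*p)/2)) := ⟨_, rfl⟩
  have hBpos : 0 < B := by rw [hB]; positivity
  refine ⟨B * C, by positivity, ?_⟩
  intro ε f hε hf hfs
  generalize ha : (1 - α) * p = a at *
  generalize hb : α * p = b at *
  let R : (Fin 3 → ℝ) → ℝ := fun x => x 0 ^ 2 + x 1 ^ 2 + ε
  let Z : (Fin 3 → ℝ) → ℝ := fun x => x 2 ^ 2 + ε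
  let N : (Fin 3 → ℝ) → ℝ := fun x => x 0 ^ 2 + x 1 ^ 2 + x 2 ^ 2 + ε
  have hR : ∀ x, 0 < R x := fun x => by simp only [R]; positivity
  have hZ : ∀ x, 0 < Z x := fun x => by simp only [Z]; positivity
  have hN : ∀ x, 0 < N x := fun x => by simp only [N]; positivity
  have hRN : ∀ x, R x ≤ N x := fun x => by simp only [R, N]; nlinarith [sq_nonneg (x 2)]
  have hZN : ∀ x, Z x ≤ N x := fun x => by
    simp only [Z, N]; nlinarith [sq_nonneg (x 0), sq_nonneg (x 1)]
  have hNRZ : ∀ x, N x ≤ R x + Z x := fun x => by simp only [R, N, Z]; linarith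
  have cR : ContDiff ℝ 1 R := by simp only [R]; fun_prop
  have cZ : ContDiff ℝ 1 Z := by simp only [Z]; fun_prop
  have cN : ContDiff ℝ 1 N := by simp only [N]; fun_prop
  have cRp : ∀ s : ℝ, ContDiff ℝ 1 (fun x => R x ^ s) := fun s =>
    cR.rpow_const_of_ne (fun x => (hR x).ne')
  have cZp : ∀ s : ℝ, ContDiff ℝ 1 (fun x => Z x ^ s) := fun s =>
    cZ.rpow_const_of_ne (fun x => (hZ x).ne')
  have cNp : ∀ s : ℝ, ContDiff ℝ 1 (fun x => N x ^ s) := fun s =>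
    cN.rpow_const_of_ne (fun x => (hN x).ne')
  let h1 : (Fin 3 → ℝ) → ℝ := fun x => R x ^ (-a/2) * N x ^ (-b/2)
  let h2 : (Fin 3 → ℝ) → ℝ := fun x => Z x ^ (-b/2) * N x ^ (-a/2)
  let h0 : (Fin 3 → ℝ) → ℝ := fun x => N x ^ (-p/2)
  let H : (Fin 3 → ℝ) → ℝ := fun x => h1 x + h2 x + h0 x
  have c1 : ContDiff ℝ 1 h1 := (cRp _).mul (cNp _)
  have c2 : ContDiff ℝ 1 h2 := (cZp _).mul (cNp _)
  have c0 : ContDiff ℝ 1 h0 := cNp _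
  have p1 : ∀ x, 0 < h1 x := fun x => mul_pos (rpow_pos_of_pos (hR x) _) (rpow_pos_of_pos (hN x) _)
  have p2 : ∀ x, 0 < h2 x := fun x => mul_pos (rpow_pos_of_pos (hZ x) _) (rpow_pos_of_pos (hN x) _)
  have p0 : ∀ x, 0 < h0 x := fun x => rpow_pos_of_pos (hN x) _
  let V : Fin 3 → (Fin 3 → ℝ) → ℝ := ![fun y => y 0 * (h1 y + K * h0 y),
    fun y => y 1 * (h1 y + K * h0 y), fun y => y 2 * (h2 y + K * h0 y)]
  have hq : 0 ≤ (p-1)/p := div_nonneg (by linarith) hp0.le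
  have b1 : ∀ x, R x ^ (1/2 : ℝ) * h1 x ≤ H x ^ ((p-1)/p) := fun x => by
    have := hs_V p α (R x) (N x) hp hα0.le (hR x) (hRN x)
    rw [ha, hb] at this
    exact this.trans (rpow_le_rpow (p1 x).le (by simp only [H]; linarith [p2 x, p0 x]) hq)
  have b2 : ∀ x, Z x ^ (1/2 : ℝ) * h2 x ≤ H x ^ ((p-1)/p) := fun x => by
    have := hs_V p (1-α) (Z x) (N x) hp (by linarith) (hZ x) (hZN x)
    rw [_root_.sub_sub_cancel, ha, hb] at this
    exact this.trans (rpow_le_rpow (p2 x).le (by simp only [H]; linarith [p1 x, p0 x]) hq)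
  have b0 : ∀ x, N x ^ (1/2 : ℝ) * h0 x ≤ H x ^ ((p-1)/p) := fun x => by
    have h : N x ^ (1/2 : ℝ) * h0 x = h0 x ^ ((p-1)/p) := by
      simp only [h0]
      rw [← Real.rpow_mul (hN x).le, ← Real.rpow_add (hN x)]
      congr 1; field_simp; ring
    rw [h]
    exact rpow_le_rpow (p0 x).le (by simp only [H]; linarith [p1 x, p2 x]) hq
  have absle : ∀ t Y : ℝ, t ^ 2 ≤ Y → |t| ≤ Y ^ (1/2 : ℝ) := fun t Y h => by
    rw [← Real.sqrt_eq_rpow]; exact Real.abs_le_sqrt h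
  have hVbound : ∀ (x : Fin 3 → ℝ) (t Y h : ℝ), 0 < h → t ^ 2 ≤ Y → t ^ 2 ≤ N x →
      Y ^ (1/2 : ℝ) * h ≤ H x ^ ((p-1)/p) →
      |t * (h + K * h0 x)| ≤ (1 + K) * H x ^ ((p-1)/p) := by
    intro x t Y h hh hY hN' hle
    have hpos : 0 < h + K * h0 x := add_pos hh (mul_pos hKpos (p0 x))
    rw [abs_mul, abs_of_pos hpos]
    have e1 : |t| * h ≤ H x ^ ((p-1)/p) :=
      (mul_le_mul_of_nonneg_right (absle t Y hY) hh.le).trans hle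
    have e2 : |t| * h0 x ≤ H x ^ ((p-1)/p) :=
      (mul_le_mul_of_nonneg_right (absle t _ hN') (p0 x).le).trans (b0 x)
    nlinarith
  have main := hcore f V H hf hfs ?_ ((c1.add c2).add c0).continuous
    (fun x => by simp only [H]; linarith [p1 x, p2 x, p0 x]) ?_ ?_
  · calc _ ≤ ∫⁻ x, ENNReal.ofReal B * ENNReal.ofReal (|f x| ^ p * H x) := by
          apply lintegral_mono
          intro x
          simp only
          rw [← ENNReal.ofReal_mul hBpos.le]
          apply ENNReal.ofReal_le_ofReal
          have := hs_W a b (R x) (Z x) (N x) hapos.le hbpos.le (hR x) (hZ x) (hN x) (hNRZ x)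
          rw [← hB, hab] at this
          calc _ ≤ |f x| ^ p * (B * H x) := mul_le_mul_of_nonneg_left this (by positivity)
            _ = _ := by ring
      _ = ENNReal.ofReal B * ∫⁻ x, ENNReal.ofReal (|f x| ^ p * H x) :=
          lintegral_const_mul' _ _ ENNReal.ofReal_ne_top
      _ ≤ ENNReal.ofReal B * (ENNReal.ofReal C * ∫⁻ x, ‖fderiv ℝ f x‖ₑ ^ p) := by gcongr
      _ = _ := by rw [ENNReal.ofReal_mul hBpos.le, mul_assoc]
  · intro i
    fin_cases i
    · exact (by fun_prop : ContDiff ℝ 1 (fun y : Fin 3 → ℝ => y 0)).mul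
        (c1.add (contDiff_const.mul c0))
    · exact (by fun_prop : ContDiff ℝ 1 (fun y : Fin 3 → ℝ => y 1)).mul
        (c1.add (contDiff_const.mul c0))
    · exact (by fun_prop : ContDiff ℝ 1 (fun y : Fin 3 → ℝ => y 2)).mul
        (c2.add (contDiff_const.mul c0))
  · intro x
    have dR := cR.differentiable one_ne_zero x
    have dZ := cZ.differentiable one_ne_zero x
    have dN := cN.differentiable one_ne_zero x
    have d0 : fderiv ℝ (V 0) x (Pi.single 0 1) = _ := hs_deriv a b p K 0 x R N dR dN (hR x) (hN x)
      (by simp only [R]; rw [hs_fderivR]; simp) (by simp only [N]; rw [hs_fderivN]; simp)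
    have d1 : fderiv ℝ (V 1) x (Pi.single 1 1) = _ := hs_deriv a b p K 1 x R N dR dN (hR x) (hN x)
      (by simp only [R]; rw [hs_fderivR]; simp) (by simp only [N]; rw [hs_fderivN]; simp)
    have d2 : fderiv ℝ (V 2) x (Pi.single 2 1) = _ := hs_deriv b a p K 2 x Z N dZ dN (hZ x) (hN x)
      (by simp only [Z]; rw [hs_fderivZ]; simp) (by simp only [N]; rw [hs_fderivN]; simp)
    rw [Fin.sum_univ_three, d0, d1, d2]
    have e1 := hs_err a b (x 0 ^ 2 + x 1 ^ 2) (R x) (N x) ha2.le (hR x)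
      (by simp only [R]; linarith) (hRN x)
    have e2 := hs_err b a (x 2 ^ 2) (Z x) (N x) (by linarith) (hZ x)
      (by simp only [Z]; linarith) (hZN x)
    rw [hab] at e1
    rw [add_comm b a, hab] at e2
    change (x 0 ^ 2 + x 1 ^ 2) * h1 x / N x ≤ h0 x at e1
    change x 2 ^ 2 * h2 x / N x ≤ h0 x at e2
    change c * (h1 x + h2 x + h0 x) ≤
      h1 x + K * h0 x - (a * (x 0 ^ 2 * h1 x / R x) + b * (x 0 ^ 2 * h1 x / N x) +
        K * p * (x 0 ^ 2 * h0 x / N x)) +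
      (h1 x + K * h0 x - (a * (x 1 ^ 2 * h1 x / R x) + b * (x 1 ^ 2 * h1 x / N x) +
        K * p * (x 1 ^ 2 * h0 x / N x))) +
      (h2 x + K * h0 x - (b * (x 2 ^ 2 * h2 x / Z x) + a * (x 2 ^ 2 * h2 x / N x) +
        K * p * (x 2 ^ 2 * h0 x / N x)))
    have f1 : (x 0 ^ 2 + x 1 ^ 2) * h1 x / R x ≤ h1 x := by
      rw [div_le_iff₀ (hR x), mul_comm]
      exact mul_le_mul_of_nonneg_left (by simp only [R]; linarith) (p1 x).le
    have f2 : x 2 ^ 2 * h2 x / Z x ≤ h2 x := by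
      rw [div_le_iff₀ (hZ x), mul_comm]
      exact mul_le_mul_of_nonneg_left (by simp only [Z]; linarith) (p2 x).le
    have f0 : (x 0 ^ 2 + x 1 ^ 2 + x 2 ^ 2) * h0 x / N x ≤ h0 x := by
      rw [div_le_iff₀ (hN x), mul_comm]
      exact mul_le_mul_of_nonneg_left (by simp only [N]; linarith) (p0 x).le
    have g1 := mul_le_mul_of_nonneg_left f1 hapos.le
    have g2 := mul_le_mul_of_nonneg_left f2 hbpos.le
    have g0 := mul_le_mul_of_nonneg_left f0 (mul_pos hKpos hp0).le
    have k1 := mul_le_mul_of_nonneg_left e1 hbpos.le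
    have k2 := mul_le_mul_of_nonneg_left e2 hapos.le
    have m1 := mul_le_mul_of_nonneg_right hca (p1 x).le
    have m2 := mul_le_mul_of_nonneg_right hcb (p2 x).le
    have m0 := mul_le_mul_of_nonneg_right hc1 (p0 x).le
    have hK3' : K * (3 - p) * h0 x = (a + b + 1) * h0 x := by rw [hK3, hab]
    simp only [add_mul, add_div, mul_add, mul_sub, sub_mul] at *
    linarith
  · intro i x
    have q0 := sq_nonneg (x 0)
    have q1 := sq_nonneg (x 1)
    have q2 := sq_nonneg (x 2)
    fin_cases i
    · exact hVbound x (x 0) (R x) (h1 x) (p1 x) (by simp only [R]; linarith)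
        (by simp only [N]; linarith) (b1 x)
    · exact hVbound x (x 1) (R x) (h1 x) (p1 x) (by simp only [R]; linarith)
        (by simp only [N]; linarith) (b1 x)
    · exact hVbound x (x 2) (Z x) (h2 x) (p2 x) (by simp only [Z]; linarith)
        (by simp only [N]; linarith) (b2 x)

lemma hs_point (p α : ℝ) (hp : 1 < p) (hα0 : 0 < α) (hα1 : α < 1) (y s z : ℝ) (hs : 0 ≤ s) :
    ‖y / (s ^ ((1-α)/2) * |z| ^ α)‖ₑ ^ p ≤ Filter.liminf (fun n : ℕ => ENNReal.ofReal (|y| ^ p *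
      ((s + 1 / ((n:ℝ) + 1)) ^ (-((1-α)*p)/2) * (z ^ 2 + 1 / ((n:ℝ) + 1)) ^ (-(α*p)/2))))
      Filter.atTop := by
  have hp0 : 0 < p := by linarith
  by_cases h0 : s = 0 ∨ z = 0
  · have : s ^ ((1-α)/2) * |z| ^ α = 0 := by
      rcases h0 with h | h
      · rw [h, Real.zero_rpow (by linarith : 0 < (1-α)/2).ne', zero_mul]
      · rw [h, abs_zero, Real.zero_rpow hα0.ne', mul_zero]
    rw [this, _root_.div_zero, enorm_zero, ENNReal.zero_rpow_of_pos hp0]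
    exact bot_le
  · push Not at h0
    obtain ⟨hs0, hz0⟩ := h0
    have hs' : 0 < s := lt_of_le_of_ne hs (Ne.symm hs0)
    have hz' : 0 < |z| := abs_pos.2 hz0
    have hz2 : 0 < z ^ 2 := by positivity
    have ht : Filter.Tendsto (fun n : ℕ => 1 / ((n:ℝ) + 1)) Filter.atTop (nhds 0) :=
      tendsto_one_div_add_atTop_nhds_zero_nat
    have hlim : Filter.Tendsto (fun n : ℕ => ENNReal.ofReal (|y| ^ p *
      ((s + 1 / ((n:ℝ) + 1)) ^ (-((1-α)*p)/2) * (z ^ 2 + 1 / ((n:ℝ) + 1)) ^ (-(α*p)/2))))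
      Filter.atTop (nhds (ENNReal.ofReal (|y| ^ p *
        ((s + 0) ^ (-((1-α)*p)/2) * (z ^ 2 + 0) ^ (-(α*p)/2))))) := by
      apply ENNReal.tendsto_ofReal
      apply Filter.Tendsto.const_mul
      apply Filter.Tendsto.mul
      · exact (tendsto_const_nhds.add ht).rpow_const (Or.inl (by simpa using hs0))
      · exact (tendsto_const_nhds.add ht).rpow_const (Or.inl (by simpa using hz0))
    rw [hlim.liminf_eq, add_zero, add_zero, ← ofReal_norm,
      ENNReal.ofReal_rpow_of_nonneg (norm_nonneg _) hp0.le]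
    apply le_of_eq
    congr 1
    have hw : 0 < s ^ ((1-α)/2) * |z| ^ α := by positivity
    rw [Real.norm_eq_abs, abs_div, abs_of_pos hw, Real.div_rpow (abs_nonneg _) hw.le,
      Real.mul_rpow (by positivity) (by positivity), ← Real.rpow_mul hs, ← Real.rpow_mul hz'.le,
      ← sq_abs z, ← Real.rpow_natCast, ← Real.rpow_mul hz'.le, div_eq_mul_inv, mul_inv,
      ← Real.rpow_neg hs, ← Real.rpow_neg hz'.le]
    congr 3
    · ring
    · push_cast; ring

/-- **Variant of Yu's inequality.** For `p > 1` and `max{1−2/p, 0} < α < 1/p`,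
`‖ f / ( r^{1−α} |x_3|^{α} ) ‖_{L^p(ℝ³)} ≤ C ‖ ∇f ‖_{L^p(ℝ³)}` for all `f ∈ C_0^∞(ℝ³)`,
where `r = √(x_1² + x_2²)`. -/
theorem hardy_sobolev_axis_weight_variant
    (p α : ℝ) (hp : 1 < p) (hα1 : max (1 - 2 / p) 0 < α) (hα2 : α < 1 / p) :
    ∃ C : ℝ, 0 < C ∧ ∀ f : (Fin 3 → ℝ) → ℝ,
      ContDiff ℝ (⊤ : ℕ∞) f → HasCompactSupport f →
      eLpNorm
          (fun x => f x / ((x 0 ^ 2 + x 1 ^ 2) ^ ((1 - α) / 2) * |x 2| ^ α))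
          (ENNReal.ofReal p) volume
        ≤ ENNReal.ofReal C * eLpNorm (fderiv ℝ f) (ENNReal.ofReal p) volume := by
  have hp0 : 0 < p := by linarith
  have hα0 : 0 < α := (le_max_right _ _).trans_lt hα1
  have hα3 : 1 - 2 / p < α := (le_max_left _ _).trans_lt hα1
  have hα4 : α < 1 := hα2.trans ((div_lt_one hp0).2 hp)
  obtain ⟨C, hC, hreg⟩ := hs_reg p α hp hα0 hα3 hα2
  refine ⟨C ^ (1/p), by positivity, ?_⟩
  intro f hf hfs
  have hpt : (ENNReal.ofReal p).toReal = p := ENNReal.toReal_ofReal hp0.le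
  rw [eLpNorm_eq_lintegral_rpow_enorm_toReal (by simpa using hp0) ENNReal.ofReal_ne_top,
    eLpNorm_eq_lintegral_rpow_enorm_toReal (by simpa using hp0) ENNReal.ofReal_ne_top, hpt,
    ← ENNReal.ofReal_rpow_of_pos hC, ← ENNReal.mul_rpow_of_nonneg _ _ (by positivity)]
  apply ENNReal.rpow_le_rpow _ (by positivity)
  have hfm : Measurable f := hf.continuous.measurable
  calc _ ≤ ∫⁻ x : Fin 3 → ℝ, Filter.liminf (fun n : ℕ => ENNReal.ofReal (|f x| ^ p *
        ((x 0 ^ 2 + x 1 ^ 2 + 1 / ((n:ℝ) + 1)) ^ (-((1-α)*p)/2) *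
          (x 2 ^ 2 + 1 / ((n:ℝ) + 1)) ^ (-(α*p)/2)))) Filter.atTop :=
        lintegral_mono fun x => hs_point p α hp hα0 hα4 (f x) _ (x 2) (by positivity)
    _ ≤ Filter.liminf (fun n : ℕ => ∫⁻ x : Fin 3 → ℝ, ENNReal.ofReal (|f x| ^ p *
        ((x 0 ^ 2 + x 1 ^ 2 + 1 / ((n:ℝ) + 1)) ^ (-((1-α)*p)/2) *
          (x 2 ^ 2 + 1 / ((n:ℝ) + 1)) ^ (-(α*p)/2)))) Filter.atTop := by
        apply lintegral_liminf_le
        intro n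
        fun_prop
    _ ≤ Filter.liminf (fun n : ℕ => ENNReal.ofReal C * ∫⁻ x, ‖fderiv ℝ f x‖ₑ ^ p)
          Filter.atTop := by
        refine Filter.liminf_le_liminf ?_
        exact Filter.Eventually.of_forall fun n => hreg _ f (by positivity) hf hfs
    _ = _ := by simp
end
end
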